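/- arXiv:2011.04025 — 4 statements merged into one kernel-verified Lean document; each statement's English description precedes it below -/
import Mathlib

section
/- Let f₁,…,f_m ∈ ℝ[x₁,…,x_d] be finitely many polynomials (not necessarily generating the whole polynomial algebra). Suppose L is a linear functional on ℝ[x₁,…,x_d] satisfying L(p²) ≥ 0 and L(f_j·p²) ≥ 0 for all p ∈ ℝ[x₁,…,x_d] and all j = 1,…,m, and such that for each j = 1,…,m the series Σ_{n=1}^∞ L(f_jⁿ)^{-1/(2n)} diverges to +∞. Then there exists a measure μ on ℝ^d supported on K(f) = {x ∈ ℝ^d : f₁(x) ≥ 0, …, f_m(x) ≥ 0} such that every element q of the ℝ-subalgebra of ℝ[x₁,…,x_d] generated by f₁,…,f_m is μ-integrable and L(q) = ∫ q dμ for all such q. -/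
section

open Polynomial

/-- The intermediate value property for polynomials over an ordered field. -/
def PolyIVT (R : Type*) [Field R] [LinearOrder R] : Prop :=
  ∀ (p : R[X]) (a b : R), a < b → p.eval a * p.eval b < 0 → ∃ c, a < c ∧ c < b ∧ p.eval c = 0

namespace PolyIVT

theorem mul_eval_nonneg {R : Type*} [Field R] [LinearOrder R] (h : PolyIVT R) {p : R[X]}
    {a b : R} (hab : a < b)
    (hp : ∀ c, a < c → c < b → p.eval c ≠ 0) : 0 ≤ p.eval a * p.eval b := by
  by_contra! hlt
  obtain ⟨c, h1, h2, h3⟩ := h p a b hab hlt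
  exact hp c h1 h2 h3

variable {R : Type*} [Field R] [LinearOrder R] [IsStrictOrderedRing R]

theorem exists_derivative_eq_zero_of_consecutive (h : PolyIVT R) {p : R[X]} {a b : R}
    (hab : a < b) (ha : p.eval a = 0) (hb : p.eval b = 0)
    (hp : ∀ c, a < c → c < b → p.eval c ≠ 0) :
    ∃ c, a < c ∧ c < b ∧ p.derivative.eval c = 0 := by
  have hp0 : p ≠ 0 := by
    rintro rfl
    obtain ⟨c, hc⟩ := exists_between hab
    exact hp c hc.1 hc.2 (by simp)
  obtain ⟨q, hq, hqa⟩ := exists_eq_pow_rootMultiplicity_mul_and_not_dvd p hp0 a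
  have hq0 : q ≠ 0 := by rintro rfl; simp at hqa
  obtain ⟨r, hr, hrb⟩ := exists_eq_pow_rootMultiplicity_mul_and_not_dvd q hq0 b
  obtain ⟨m, hm⟩ : ∃ m, p.rootMultiplicity a = m + 1 :=
    Nat.exists_eq_succ_of_ne_zero ((rootMultiplicity_pos hp0).2 ha).ne'
  have hqb : q.eval b = 0 := by
    rw [hq] at hb
    simpa [sub_ne_zero.2 hab.ne'] using hb
  obtain ⟨n, hn⟩ : ∃ n, q.rootMultiplicity b = n + 1 :=
    Nat.exists_eq_succ_of_ne_zero ((rootMultiplicity_pos hq0).2 hqb).ne'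
  rw [hm] at hq
  rw [hn] at hr
  have hra : r.eval a ≠ 0 := by
    intro h0
    apply hqa
    rw [dvd_iff_isRoot, IsRoot.def, hr]
    simp [h0]
  have hrb' : r.eval b ≠ 0 := by rwa [dvd_iff_isRoot, IsRoot.def] at hrb
  have hpr : p = (X - C a) ^ (m + 1) * ((X - C b) ^ (n + 1) * r) := by rw [← hr, ← hq]
  have hrpos : 0 < r.eval a * r.eval b := by
    refine lt_of_le_of_ne (h.mul_eval_nonneg hab ?_) (mul_ne_zero hra hrb').symm
    intro c h1 h2 h3
    apply hp c h1 h2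
    rw [hpr]
    simp [h3]
  obtain ⟨c, h1, h2, h3⟩ := h (C ((m : R) + 1) * (X - C b) * r + C ((n : R) + 1) * (X - C a) * r
    + (X - C a) * (X - C b) * derivative r) a b hab (by
      have : 0 < ((m : R) + 1) * ((n : R) + 1) * (b - a) ^ 2 * (r.eval a * r.eval b) := by
        have : 0 < b - a := sub_pos.2 hab
        positivity
      simp only [eval_add, eval_mul, eval_sub, eval_X, eval_C]
      nlinarith)
  refine ⟨c, h1, h2, ?_⟩
  have hd : derivative p = (X - C a) ^ m * (X - C b) ^ n * (C ((m : R) + 1) * (X - C b) * r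
      + C ((n : R) + 1) * (X - C a) * r + (X - C a) * (X - C b) * derivative r) := by
    rw [hpr]
    simp only [derivative_mul, derivative_X_sub_C_pow, Nat.cast_add, Nat.cast_one,
      Nat.add_sub_cancel, map_add, map_natCast, map_one]
    ring
  rw [hd, eval_mul, h3, mul_zero]

/-- Rolle's theorem for polynomials. -/
theorem exists_derivative_eq_zero (h : PolyIVT R) {p : R[X]} {a b : R}
    (hab : a < b) (ha : p.eval a = 0) (hb : p.eval b = 0) :
    ∃ c, a < c ∧ c < b ∧ p.derivative.eval c = 0 := by
  by_cases hp0 : p = 0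
  · obtain ⟨c, hc⟩ := exists_between hab
    exact ⟨c, hc.1, hc.2, by simp [hp0]⟩
  have hne : (p.roots.toFinset.filter (fun c => a < c)).Nonempty :=
    ⟨b, by simp [hp0, hab, hb]⟩
  obtain ⟨c, hc, hmin⟩ := Finset.exists_min_image _ id hne
  simp only [Finset.mem_filter, Multiset.mem_toFinset, mem_roots', IsRoot.def, id] at hc hmin
  obtain ⟨x, h1, h2, h3⟩ := h.exists_derivative_eq_zero_of_consecutive hc.2 ha hc.1.2
    (fun x h1 h2 h3 => absurd (hmin x ⟨⟨hp0, h3⟩, h1⟩) (not_le.2 h2))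
  exact ⟨x, h1, h2.trans_le (hmin b ⟨⟨hp0, hb⟩, hab⟩), h3⟩

/-- The mean value theorem for polynomials. -/
theorem exists_derivative_eq_slope (h : PolyIVT R) (p : R[X]) {a b : R} (hab : a < b) :
    ∃ c, a < c ∧ c < b ∧ p.eval b - p.eval a = p.derivative.eval c * (b - a) := by
  obtain ⟨c, h1, h2, h3⟩ := h.exists_derivative_eq_zero
    (p := C (b - a) * (p - C (p.eval a)) - C (p.eval b - p.eval a) * (X - C a)) hab
    (by simp) (by simp; ring)
  refine ⟨c, h1, h2, ?_⟩
  simp at h3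
  linarith

theorem eval_ne_zero_of_derivative (h : PolyIVT R) {p : R[X]} {a b : R}
    (hd : ∀ c, a < c → c < b → p.derivative.eval c ≠ 0)
    (hp : 0 ≤ p.eval a * p.eval b) {c : R} (h1 : a < c) (h2 : c < b) : p.eval c ≠ 0 := by
  intro hc
  obtain ⟨x, x1, x2, hx⟩ := h.exists_derivative_eq_slope p h1
  obtain ⟨y, y1, y2, hy⟩ := h.exists_derivative_eq_slope p h2
  have h0 : 0 ≤ p.derivative.eval x * p.derivative.eval y :=
    h.mul_eval_nonneg (x2.trans y1)
      (fun z z1 z2 => hd z (x1.trans z1) (z2.trans y2))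
  have hx0 := hd x x1 (x2.trans h2)
  have hy0 := hd y (h1.trans y1) y2
  have hpos : 0 < p.derivative.eval x * p.derivative.eval y :=
    lt_of_le_of_ne h0 (mul_ne_zero hx0 hy0).symm
  have : 0 < (p.derivative.eval x * p.derivative.eval y) * ((c - a) * (b - c)) :=
    mul_pos hpos (mul_pos (sub_pos.2 h1) (sub_pos.2 h2))
  rw [hc] at hx hy
  have hxy : p.eval a * p.eval b =
      -((p.derivative.eval x * p.derivative.eval y) * ((c - a) * (b - c))) := by
    rw [sub_zero] at hy
    rw [hy, show p.eval a = -(p.derivative.eval x * (c - a)) by rw [← hx]; ring]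
    ring
  linarith

/-- The sign of a polynomial without roots on an open interval is that of either endpoint, as soon
as this is nonzero. -/
theorem sign_eval_left (h : PolyIVT R) {p : R[X]} {a b : R}
    (hp : ∀ c, a < c → c < b → p.eval c ≠ 0) (ha : p.eval a ≠ 0) {c : R} (h1 : a < c)
    (h2 : c < b) : SignType.sign (p.eval c) = SignType.sign (p.eval a) := by
  have h0 := h.mul_eval_nonneg (p := p) h1 (fun x x1 x2 => hp x x1 (x2.trans h2))
  have hpos := lt_of_le_of_ne h0 (mul_ne_zero ha (hp c h1 h2)).symm
  rcases ha.lt_or_gt with ha | ha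
  · rw [sign_neg ha, sign_neg (by nlinarith)]
  · rw [sign_pos ha, sign_pos (pos_of_mul_pos_right hpos ha.le)]

theorem sign_eval_right (h : PolyIVT R) {p : R[X]} {a b : R}
    (hp : ∀ c, a < c → c < b → p.eval c ≠ 0) (hb : p.eval b ≠ 0) {c : R} (h1 : a < c)
    (h2 : c < b) : SignType.sign (p.eval c) = SignType.sign (p.eval b) := by
  have h0 := h.mul_eval_nonneg (p := p) h2 (fun x x1 x2 => hp x (h1.trans x1) x2)
  have hpos := lt_of_le_of_ne h0 (mul_ne_zero (hp c h1 h2) hb).symm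
  rcases hb.lt_or_gt with hb | hb
  · rw [sign_neg hb, sign_neg (by nlinarith)]
  · rw [sign_pos hb, sign_pos (pos_of_mul_pos_left hpos hb.le)]

end PolyIVT

section AtInfinity

variable {R : Type*} [Field R] [LinearOrder R] [IsStrictOrderedRing R]

theorem Polynomial.exists_forall_le_leadingCoeff_mul_eval (p : R[X]) (hp : p ≠ 0) :
    ∃ δ > 0, ∃ M, ∀ x, M ≤ x → δ ≤ p.leadingCoeff * p.eval x := by
  induction hn : p.natDegree generalizing p with
  | zero =>
    rw [natDegree_eq_zero] at hn
    obtain ⟨c, rfl⟩ := hn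
    have hc : c ≠ 0 := by simpa using hp
    exact ⟨c * c, mul_self_pos.2 hc, 0, fun x _ => by simp⟩
  | succ n ih =>
    have hq : p.divX ≠ 0 := by
      intro h0
      have := natDegree_divX_eq_natDegree_tsub_one (p := p)
      rw [divX_eq_zero_iff] at h0
      rw [h0] at hn
      simp at hn
    have hqn : p.divX.natDegree = n := by rw [natDegree_divX_eq_natDegree_tsub_one, hn]; rfl
    obtain ⟨δ, hδ, M, hM⟩ := ih p.divX hq hqn
    have hl : p.divX.leadingCoeff = p.leadingCoeff := by
      rw [leadingCoeff, leadingCoeff, coeff_divX, hqn, hn]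
    refine ⟨δ, hδ, max (max M 0) (1 + |p.leadingCoeff * p.coeff 0| / δ), fun x hx => ?_⟩
    have h1 := hM x (le_trans (le_trans (le_max_left _ _) (le_max_left _ _)) hx)
    have hx0 : 0 ≤ x := le_trans (le_trans (le_max_right _ _) (le_max_left _ _)) hx
    have h2 : 1 + |p.leadingCoeff * p.coeff 0| / δ ≤ x := le_trans (le_max_right _ _) hx
    have h3 : δ + |p.leadingCoeff * p.coeff 0| ≤ x * δ := by
      have := mul_le_mul_of_nonneg_right h2 hδ.le
      rwa [add_mul, one_mul, div_mul_cancel₀ _ hδ.ne'] at this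
    have h4 : p.eval x = p.divX.eval x * x + p.coeff 0 := by
      conv_lhs => rw [← divX_mul_X_add p]
      simp
    have h5 := neg_abs_le (p.leadingCoeff * p.coeff 0)
    rw [h4, ← hl]
    rw [← hl] at h3 h5
    nlinarith

theorem Polynomial.exists_forall_sign_eval_eq (p : R[X]) :
    ∃ M, ∀ x, M ≤ x → SignType.sign (p.eval x) = SignType.sign p.leadingCoeff := by
  by_cases hp : p = 0
  · exact ⟨0, fun x _ => by simp [hp]⟩
  obtain ⟨δ, hδ, M, hM⟩ := p.exists_forall_le_leadingCoeff_mul_eval hp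
  refine ⟨M, fun x hx => ?_⟩
  have hpos := hδ.trans_le (hM x hx)
  rcases (leadingCoeff_ne_zero.2 hp).lt_or_gt with ha | ha
  · rw [sign_neg ha, sign_neg (by nlinarith)]
  · rw [sign_pos ha, sign_pos (pos_of_mul_pos_right hpos ha.le)]

theorem Polynomial.exists_forall_sign_eval_neg_eq (p : R[X]) :
    ∃ M, ∀ x, M ≤ x → SignType.sign (p.eval (-x)) =
      SignType.sign ((-1) ^ p.natDegree * p.leadingCoeff) := by
  obtain ⟨M, hM⟩ := (p.comp (-X)).exists_forall_sign_eval_eq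
  refine ⟨M, fun x hx => ?_⟩
  have := hM x hx
  rw [leadingCoeff_comp (by simp)] at this
  simpa [mul_comm] using this

end AtInfinity

section SignTransfer

variable {R R' ι : Type*} [Field R] [LinearOrder R] [IsStrictOrderedRing R]
  [Field R'] [LinearOrder R'] [IsStrictOrderedRing R']

/-- Two families of polynomials, over two ordered fields, with the same degrees and the same signs
of leading coefficients, which are compatibly closed under derivatives and remainders. -/
structure SignCompatible (P : ι → R[X]) (P' : ι → R'[X]) (s : Finset ι) : Prop where
  natDegree_eq : ∀ i ∈ s, (P i).natDegree = (P' i).natDegree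
  sign_leadingCoeff : ∀ i ∈ s,
    SignType.sign (P i).leadingCoeff = SignType.sign (P' i).leadingCoeff
  exists_derivative : ∀ i ∈ s, 0 < (P i).natDegree →
    ∃ j ∈ s, P j = derivative (P i) ∧ P' j = derivative (P' i)
  exists_remainder : ∀ i ∈ s, ∀ q ∈ s, 0 < (P q).natDegree → (P q).natDegree ≤ (P i).natDegree →
    ∃ j ∈ s, (P j).natDegree < (P q).natDegree ∧
      (∀ x, (P q).eval x = 0 →
        SignType.sign ((P i).eval x) = SignType.sign ((P j).eval x)) ∧
      (∀ x, (P' q).eval x = 0 →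
        SignType.sign ((P' i).eval x) = SignType.sign ((P' j).eval x))

/-- The signs of the polynomials of a family agree at a pair of points. -/
def SignMatch (P : ι → R[X]) (P' : ι → R'[X]) (s : Finset ι) (u : R × R') : Prop :=
  ∀ i ∈ s, SignType.sign ((P i).eval u.1) = SignType.sign ((P' i).eval u.2)

/-- A common root of some nonconstant polynomial of the family, or one of two given end points,
at which all the signs agree. -/
def SignNode (P : ι → R[X]) (P' : ι → R'[X]) (u₀ v₀ : R × R') (s : Finset ι) (u : R × R') : Prop :=
  (u = u₀ ∨ u = v₀ ∨
    ∃ q ∈ s, 0 < (P q).natDegree ∧ (P q).eval u.1 = 0 ∧ (P' q).eval u.2 = 0) ∧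
  SignMatch P P' s u

/-- Two consecutive nodes: no nonconstant polynomial of the family has a root in between. -/
structure SignGap (P : ι → R[X]) (P' : ι → R'[X]) (u₀ v₀ : R × R') (s : Finset ι)
    (u v : R × R') : Prop where
  lt_fst : u.1 < v.1
  lt_snd : u.2 < v.2
  left : SignNode P P' u₀ v₀ s u
  right : SignNode P P' u₀ v₀ s v
  ne_fst : ∀ i ∈ s, 0 < (P i).natDegree → ∀ x, u.1 < x → x < v.1 → (P i).eval x ≠ 0
  ne_snd : ∀ i ∈ s, 0 < (P i).natDegree → ∀ x, u.2 < x → x < v.2 → (P' i).eval x ≠ 0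

/-- A set of indices closed under passing to indices of smaller degree. -/
def DegreeClosed (P : ι → R[X]) (t s : Finset ι) : Prop :=
  ∀ i ∈ s, ∀ j ∈ t, (P j).natDegree < (P i).natDegree → j ∈ s

variable {P : ι → R[X]} {P' : ι → R'[X]} {u₀ v₀ u v : R × R'} {s t : Finset ι}

set_option linter.unusedSectionVars false in
theorem SignCompatible.sign_eval_of_natDegree_eq_zero (h : SignCompatible P P' t) {i : ι}
    (hi : i ∈ t) (h0 : (P i).natDegree = 0) (x : R) (x' : R') :
    SignType.sign ((P i).eval x) = SignType.sign ((P' i).eval x') := by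
  have h1 := h.sign_leadingCoeff i hi
  have h2 := h.natDegree_eq i hi
  rw [leadingCoeff, leadingCoeff, ← h2, h0] at h1
  rw [h0] at h2
  rw [eq_C_of_natDegree_eq_zero h0, eq_C_of_natDegree_eq_zero h2.symm]
  simpa using h1

theorem SignGap.derivative_ne_zero (h : SignCompatible P P' t) (hg : SignGap P P' u₀ v₀ s u v)
    {i : ι} (hi : i ∈ t)
    (hlow : ∀ j ∈ t, (P j).natDegree < (P i).natDegree → j ∈ s) (hpos : 0 < (P i).natDegree) :
    (∀ x, u.1 < x → x < v.1 → (derivative (P i)).eval x ≠ 0) ∧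
      ∀ x, u.2 < x → x < v.2 → (derivative (P' i)).eval x ≠ 0 := by
  obtain ⟨j, hj, e1, e2⟩ := h.exists_derivative i hi hpos
  have hlt : (P j).natDegree < (P i).natDegree := by
    rw [e1]; exact natDegree_derivative_lt hpos.ne'
  have hjs := hlow j hj hlt
  rcases Nat.eq_zero_or_pos (P j).natDegree with h0 | h0
  · have hne : derivative (P i) ≠ 0 := by
      intro h3
      exact hpos.ne' (derivative_eq_zero.1 h3)
    have hne' : ∀ x, (P j).eval x ≠ 0 := by
      intro x
      rw [← e1] at hne
      rw [eq_C_of_natDegree_eq_zero h0] at hne ⊢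
      simpa using hne
    have hne2 : ∀ x, (P' j).eval x ≠ 0 := by
      intro x hx
      have := h.sign_eval_of_natDegree_eq_zero hj h0 0 x
      rw [hx, sign_zero, sign_eq_zero_iff] at this
      exact hne' 0 this
    rw [← e1, ← e2]
    exact ⟨fun x _ _ => hne' x, fun x _ _ => hne2 x⟩
  · rw [← e1, ← e2]
    exact ⟨hg.ne_fst j hjs h0, hg.ne_snd j hjs h0⟩

theorem SignGap.signMatch (hR : PolyIVT R) (hR' : PolyIVT R') (h : SignCompatible P P' t)
    (hs : DegreeClosed P t s) (hst : s ⊆ t) (hg : SignGap P P' u₀ v₀ s u v) {w : R × R'}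
    (h1 : u.1 < w.1) (h2 : w.1 < v.1) (h3 : u.2 < w.2) (h4 : w.2 < v.2) :
    SignMatch P P' s w := by
  intro i hi
  rcases Nat.eq_zero_or_pos (P i).natDegree with h0 | h0
  · exact h.sign_eval_of_natDegree_eq_zero (hst hi) h0 _ _
  have hu := hg.left.2 i hi
  have hv := hg.right.2 i hi
  have n1 := hg.ne_fst i hi h0
  have n2 := hg.ne_snd i hi h0
  by_cases hu0 : (P i).eval u.1 = 0
  · have hv0 : (P i).eval v.1 ≠ 0 := by
      intro hv0
      obtain ⟨c, c1, c2, c3⟩ := hR.exists_derivative_eq_zero (h1.trans h2) hu0 hv0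
      exact (hg.derivative_ne_zero h (hst hi) (hs i hi) h0).1 c c1 c2 c3
    have hv0' : (P' i).eval v.2 ≠ 0 := by
      rwa [← sign_ne_zero, ← hv, sign_ne_zero]
    rw [hR.sign_eval_right n1 hv0 h1 h2, hR'.sign_eval_right n2 hv0' h3 h4, hv]
  · have hu0' : (P' i).eval u.2 ≠ 0 := by
      rwa [← sign_ne_zero, ← hu, sign_ne_zero]
    rw [hR.sign_eval_left n1 hu0 h1 h2, hR'.sign_eval_left n2 hu0' h3 h4, hu]

variable [DecidableEq ι]

set_option linter.unusedSectionVars false in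
theorem SignNode.insert (h : SignCompatible P P' t) (hst : s ⊆ t)
    (hs : DegreeClosed P t s) (hu₀ : SignMatch P P' t u₀) (hv₀ : SignMatch P P' t v₀)
    {p : ι} (hp : p ∈ t) (hmax : ∀ i ∈ s, (P i).natDegree ≤ (P p).natDegree)
    (hu : SignNode P P' u₀ v₀ s u) : SignNode P P' u₀ v₀ (insert p s) u := by
  constructor
  · rcases hu.1 with h1 | h1 | ⟨q, hq, h1⟩
    · exact Or.inl h1
    · exact Or.inr (Or.inl h1)
    · exact Or.inr (Or.inr ⟨q, Finset.mem_insert_of_mem hq, h1⟩)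
  · intro i hi
    rcases Finset.mem_insert.1 hi with rfl | hi
    · rcases hu.1 with rfl | rfl | ⟨q, hq, h1, h2, h3⟩
      · exact hu₀ _ hp
      · exact hv₀ _ hp
      · obtain ⟨j, hj, j1, j2, j3⟩ := h.exists_remainder i hp q (hst hq) h1 (hmax q hq)
        rw [j2 _ h2, j3 _ h3]
        exact hu.2 j (hs q hq j hj j1)
    · exact hu.2 i hi

theorem SignGap.transGen_insert (hR : PolyIVT R) (hR' : PolyIVT R') (h : SignCompatible P P' t)
    (hst : s ⊆ t) (hs : DegreeClosed P t s) (hu₀ : SignMatch P P' t u₀)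
    (hv₀ : SignMatch P P' t v₀) {p : ι} (hp : p ∈ t)
    (hlow : ∀ j ∈ t, (P j).natDegree < (P p).natDegree → j ∈ s)
    (hmax : ∀ i ∈ s, (P i).natDegree ≤ (P p).natDegree) (hg : SignGap P P' u₀ v₀ s u v) :
    Relation.TransGen (SignGap P P' u₀ v₀ (insert p s)) u v := by
  have hu := hg.left.insert h hst hs hu₀ hv₀ hp hmax
  have hv := hg.right.insert h hst hs hu₀ hv₀ hp hmax
  have key : ∀ {a b : R × R'}, SignNode P P' u₀ v₀ (insert p s) a →
      SignNode P P' u₀ v₀ (insert p s) b → u.1 ≤ a.1 → u.2 ≤ a.2 → b.1 ≤ v.1 → b.2 ≤ v.2 →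
      a.1 < b.1 → a.2 < b.2 →
      (0 < (P p).natDegree → (∀ x, a.1 < x → x < b.1 → (P p).eval x ≠ 0) ∧
        ∀ x, a.2 < x → x < b.2 → (P' p).eval x ≠ 0) →
      SignGap P P' u₀ v₀ (insert p s) a b := by
    intro a b ha hb a1 a2 b1 b2 ab1 ab2 hpp
    refine ⟨ab1, ab2, ha, hb, fun i hi h0 x x1 x2 => ?_, fun i hi h0 x x1 x2 => ?_⟩
    · rcases Finset.mem_insert.1 hi with rfl | hi
      · exact (hpp h0).1 x x1 x2
      · exact hg.ne_fst i hi h0 x (a1.trans_lt x1) (x2.trans_le b1)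
    · rcases Finset.mem_insert.1 hi with rfl | hi
      · exact (hpp h0).2 x x1 x2
      · exact hg.ne_snd i hi h0 x (a2.trans_lt x1) (x2.trans_le b2)
  rcases Nat.eq_zero_or_pos (P p).natDegree with h0 | h0
  · exact Relation.TransGen.single (key hu hv le_rfl le_rfl le_rfl le_rfl hg.lt_fst hg.lt_snd
      (fun h1 => absurd h0 h1.ne'))
  obtain ⟨d1, d2⟩ := hg.derivative_ne_zero h hp hlow h0
  have su := hu.2 p (Finset.mem_insert_self _ _)
  have sv := hv.2 p (Finset.mem_insert_self _ _)
  have hsgn : SignType.sign ((P p).eval u.1 * (P p).eval v.1) =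
      SignType.sign ((P' p).eval u.2 * (P' p).eval v.2) := by
    rw [sign_mul, sign_mul, su, sv]
  rcases lt_or_ge ((P p).eval u.1 * (P p).eval v.1) 0 with hneg | hnn
  · have hneg' : (P' p).eval u.2 * (P' p).eval v.2 < 0 := by
      rwa [← sign_eq_neg_one_iff, ← hsgn, sign_eq_neg_one_iff]
    obtain ⟨c, c1, c2, c3⟩ := hR _ _ _ hg.lt_fst hneg
    obtain ⟨c', c1', c2', c3'⟩ := hR' _ _ _ hg.lt_snd hneg'
    have hc : SignNode P P' u₀ v₀ (insert p s) (c, c') := by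
      refine ⟨Or.inr (Or.inr ⟨p, Finset.mem_insert_self _ _, h0, c3, c3'⟩), fun i hi => ?_⟩
      rcases Finset.mem_insert.1 hi with rfl | hi
      · simp only [c3, c3', sign_zero]
      · exact hg.signMatch hR hR' h hs hst (w := (c, c')) c1 c2 c1' c2' i hi
    refine (Relation.TransGen.single (key hu hc le_rfl le_rfl c2.le c2'.le c1 c1'
      (fun _ => ⟨?_, ?_⟩))).tail
      (key hc hv c1.le c1'.le le_rfl le_rfl c2 c2' (fun _ => ⟨?_, ?_⟩))
    · intro x x1 x2 x3
      obtain ⟨y, y1, y2, y3⟩ := hR.exists_derivative_eq_zero x2 x3 c3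
      exact d1 y (x1.trans y1) (y2.trans c2) y3
    · intro x x1 x2 x3
      obtain ⟨y, y1, y2, y3⟩ := hR'.exists_derivative_eq_zero x2 x3 c3'
      exact d2 y (x1.trans y1) (y2.trans c2') y3
    · intro x x1 x2 x3
      obtain ⟨y, y1, y2, y3⟩ := hR.exists_derivative_eq_zero x1 c3 x3
      exact d1 y (c1.trans y1) (y2.trans x2) y3
    · intro x x1 x2 x3
      obtain ⟨y, y1, y2, y3⟩ := hR'.exists_derivative_eq_zero x1 c3' x3
      exact d2 y (c1'.trans y1) (y2.trans x2) y3
  · have hnn' : 0 ≤ (P' p).eval u.2 * (P' p).eval v.2 := by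
      by_contra! hlt
      rw [← sign_eq_neg_one_iff, ← hsgn, sign_eq_neg_one_iff] at hlt
      exact absurd hnn (not_le.2 hlt)
    exact Relation.TransGen.single (key hu hv le_rfl le_rfl le_rfl le_rfl hg.lt_fst hg.lt_snd
      (fun _ => ⟨fun x x1 x2 => hR.eval_ne_zero_of_derivative d1 hnn x1 x2,
        fun x x1 x2 => hR'.eval_ne_zero_of_derivative d2 hnn' x1 x2⟩))

theorem SignCompatible.transGen (hR : PolyIVT R) (hR' : PolyIVT R') (h : SignCompatible P P' t)
    (hu₀ : SignMatch P P' t u₀) (hv₀ : SignMatch P P' t v₀) (h1 : u₀.1 < v₀.1)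
    (h2 : u₀.2 < v₀.2) : Relation.TransGen (SignGap P P' u₀ v₀ t) u₀ v₀ := by
  have H : ∀ s : Finset ι, s ⊆ t → DegreeClosed P t s →
      Relation.TransGen (SignGap P P' u₀ v₀ s) u₀ v₀ := by
    intro s
    induction s using Finset.induction_on_max_value (fun i => (P i).natDegree) with
    | empty =>
      intro _ _
      refine Relation.TransGen.single ⟨h1, h2, ⟨Or.inl rfl, ?_⟩, ⟨Or.inr (Or.inl rfl), ?_⟩, ?_, ?_⟩
      all_goals intro i hi; simp at hi
    | insert p s hps hmax ih =>
      intro hst hs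
      have hp : p ∈ t := hst (Finset.mem_insert_self _ _)
      have hst' : s ⊆ t := (Finset.subset_insert _ _).trans hst
      have hlow : ∀ j ∈ t, (P j).natDegree < (P p).natDegree → j ∈ s := by
        intro j hj hlt
        refine Finset.mem_of_mem_insert_of_ne (hs p (Finset.mem_insert_self _ _) j hj hlt) ?_
        rintro rfl
        exact hlt.false
      have hs' : DegreeClosed P t s := fun i hi j hj hlt => hlow j hj (hlt.trans_le (hmax i hi))
      exact Relation.TransGen.lift' (r := SignGap P P' u₀ v₀ s) id
        (fun u v (hg : SignGap P P' u₀ v₀ s u v) =>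
          hg.transGen_insert hR hR' h hst' hs' hu₀ hv₀ hp hlow hmax) _ _ (ih hst' hs')
  exact H t subset_rfl (fun i _ j hj _ => hj)

theorem SignCompatible.exists_signMatch (hR : PolyIVT R) (hR' : PolyIVT R')
    (h : SignCompatible P P' t) (y : R) : ∃ y' : R', SignMatch P P' t (y, y') := by
  choose M hM using fun i => (P i).exists_forall_sign_eval_eq
  choose N hN using fun i => (P i).exists_forall_sign_eval_neg_eq
  choose M' hM' using fun i => (P' i).exists_forall_sign_eval_eq
  choose N' hN' using fun i => (P' i).exists_forall_sign_eval_neg_eq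
  obtain ⟨B, hB⟩ := Finset.exists_le (insert (|y| + 1) (t.image M ∪ t.image N))
  obtain ⟨B', hB'⟩ := Finset.exists_le (insert 1 (t.image M' ∪ t.image N'))
  have hy : |y| + 1 ≤ B := hB _ (Finset.mem_insert_self _ _)
  have h1 : 1 ≤ B' := hB' _ (Finset.mem_insert_self _ _)
  have hy1 := (abs_lt.1 (show |y| < B by linarith))
  have hu₀ : SignMatch P P' t (-B, -B') := by
    intro i hi
    rw [hN i B (hB _ (by simp only [Finset.mem_insert, Finset.mem_union]
                         exact Or.inr (Or.inr (Finset.mem_image_of_mem _ hi)))),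
      hN' i B' (hB' _ (by simp only [Finset.mem_insert, Finset.mem_union]
                          exact Or.inr (Or.inr (Finset.mem_image_of_mem _ hi)))),
      h.natDegree_eq i hi, sign_mul, sign_mul, h.sign_leadingCoeff i hi]
    congr 1
    rcases Nat.even_or_odd (P' i).natDegree with he | ho
    · simp [he.neg_one_pow]
    · simp [ho.neg_one_pow]
  have hv₀ : SignMatch P P' t (B, B') := by
    intro i hi
    rw [hM i B (hB _ (by simp only [Finset.mem_insert, Finset.mem_union]
                         exact Or.inr (Or.inl (Finset.mem_image_of_mem _ hi)))),
      hM' i B' (hB' _ (by simp only [Finset.mem_insert, Finset.mem_union]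
                          exact Or.inr (Or.inl (Finset.mem_image_of_mem _ hi)))),
      h.sign_leadingCoeff i hi]
  have hT := h.transGen hR hR' hu₀ hv₀ (show -B < B by linarith [hy1.1, hy1.2])
    (show -B' < B' by linarith)
  have key : ∀ u v, Relation.TransGen (SignGap P P' (-B, -B') (B, B') t) u v →
      u.1 < y → y < v.1 → ∃ y' : R', SignMatch P P' t (y, y') := by
    intro u v huv
    induction huv with
    | single hg =>
      intro y1 y2
      obtain ⟨y', z1, z2⟩ := exists_between hg.lt_snd
      exact ⟨y', hg.signMatch hR hR' h (fun i _ j hj _ => hj) subset_rfl (w := (y, y'))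
        y1 y2 z1 z2⟩
    | @tail w v hw hg ih =>
      intro y1 y2
      rcases lt_trichotomy y w.1 with hlt | heq | hgt
      · exact ih y1 hlt
      · refine ⟨w.2, ?_⟩
        rw [heq]
        exact hg.left.2
      · obtain ⟨y', z1, z2⟩ := exists_between hg.lt_snd
        exact ⟨y', hg.signMatch hR hR' h (fun i _ j hj _ => hj) subset_rfl (w := (y, y'))
          hgt y2 z1 z2⟩
  exact key _ _ hT hy1.1 hy1.2

end SignTransfer

section Closure

/-- A finite set can be enlarged to a finite set closed under operations that strictly lower a
natural number valued degree. -/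
theorem Finset.exists_superset_closed_of_lt {α : Type*} (deg : α → ℕ) (op : α → α → Finset α)
    (hop : ∀ p q, 0 < deg q → deg q ≤ deg p → ∀ r ∈ op p q, deg r < deg q) (s : Finset α) :
    ∃ t : Finset α, s ⊆ t ∧
      ∀ p ∈ t, ∀ q ∈ t, 0 < deg q → deg q ≤ deg p → op p q ⊆ t := by
  classical
  have H : ∀ n, ∀ s : Finset α, ∃ t : Finset α, s ⊆ t ∧ (∀ r ∈ t, r ∉ s → deg r < n) ∧
      ∀ p ∈ t, ∀ q ∈ t, 0 < deg q → deg q ≤ deg p → deg q ≤ n → op p q ⊆ t := by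
    intro n
    induction n with
    | zero =>
      intro s
      exact ⟨s, subset_rfl, fun r h1 h2 => absurd h1 h2, fun p _ q _ h1 _ h3 => by omega⟩
    | succ n ih =>
      intro s
      set s' := s ∪ (s ×ˢ s).biUnion (fun x =>
        if deg x.2 = n + 1 ∧ n + 1 ≤ deg x.1 then op x.1 x.2 else ∅) with hs'
      obtain ⟨t, h1, h2, h3⟩ := ih s'
      have hnew : ∀ r ∈ t, r ∉ s → deg r < n + 1 := by
        intro r hr hrs
        by_cases hr' : r ∈ s'
        · simp only [hs', Finset.mem_union, hrs, false_or, Finset.mem_biUnion,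
            Finset.mem_product] at hr'
          obtain ⟨x, -, hx⟩ := hr'
          split_ifs at hx with hc
          · exact (hop _ _ (by omega) (by omega) r hx).trans_le hc.1.le
          · simp at hx
        · exact (h2 r hr hr').trans (Nat.lt_succ_self n)
      refine ⟨t, Finset.subset_union_left.trans h1, hnew, ?_⟩
      intro p hp q hq q0 qp qn
      rcases Nat.lt_or_ge n (deg q) with hlt | hle
      · have hps : p ∈ s := by
          by_contra hps
          have := hnew p hp hps
          omega
        have hqs : q ∈ s := by
          by_contra hqs
          have := hnew q hq hqs
          omega
        refine Finset.Subset.trans ?_ h1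
        intro r hr
        rw [hs', Finset.mem_union, Finset.mem_biUnion]
        refine Or.inr ⟨(p, q), Finset.mem_product.2 ⟨hps, hqs⟩, ?_⟩
        rw [if_pos ⟨by show deg q = n + 1; omega, by show n + 1 ≤ deg p; omega⟩]
        exact hr
      · exact h3 p hp q hq q0 qp hle
  obtain ⟨t, h1, h2, h3⟩ := H (s.sup deg) s
  refine ⟨t, h1, fun p hp q hq q0 qp => h3 p hp q hq q0 qp ?_⟩
  by_cases hqs : q ∈ s
  · exact Finset.le_sup hqs
  · exact (h2 q hq hqs).le

theorem Polynomial.exists_pseudoRemainder {D : Type*} [CommRing D] (p q : D[X])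
    (hq : 0 < q.natDegree) : ∃ (k : ℕ) (u r : D[X]),
      C (q.leadingCoeff ^ (2 * k)) * p = u * q + r ∧ r.natDegree < q.natDegree := by
  induction hn : p.natDegree using Nat.strong_induction_on generalizing p with
  | _ n ih =>
    rcases Nat.lt_or_ge p.natDegree q.natDegree with hlt | hge
    · exact ⟨0, 0, p, by simp, hlt⟩
    set p₁ := C (q.leadingCoeff ^ 2) * p -
      C (q.leadingCoeff * p.leadingCoeff) * X ^ (p.natDegree - q.natDegree) * q with hp₁
    have h1 : p₁.natDegree ≤ p.natDegree := by
      refine (natDegree_sub_le _ _).trans (max_le (natDegree_C_mul_le _ _) ?_)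
      refine natDegree_mul_le.trans ?_
      have := natDegree_C_mul_X_pow_le (q.leadingCoeff * p.leadingCoeff)
        (p.natDegree - q.natDegree)
      omega
    have h2 : p₁.coeff p.natDegree = 0 := by
      have h3 : p.natDegree = q.natDegree + (p.natDegree - q.natDegree) := by omega
      have h4 : (X ^ (p.natDegree - q.natDegree) * q).coeff p.natDegree = q.leadingCoeff := by
        conv_lhs => rw [h3]
        simp [coeff_X_pow_mul]
      rw [hp₁, coeff_sub, coeff_C_mul, mul_assoc, coeff_C_mul, h4, leadingCoeff, leadingCoeff]
      ring
    have h3 : p₁.natDegree < p.natDegree := by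
      refine lt_of_le_of_ne h1 fun h4 => ?_
      rw [← h4] at h2
      have h5 : p₁ = 0 := leadingCoeff_eq_zero.1 h2
      rw [h5, natDegree_zero] at h4
      omega
    obtain ⟨k, u, r, e, hr⟩ := ih p₁.natDegree (hn ▸ h3) p₁ rfl
    refine ⟨k + 1, u + C (q.leadingCoeff ^ (2 * k)) *
      (C (q.leadingCoeff * p.leadingCoeff) * X ^ (p.natDegree - q.natDegree)), r, ?_, hr⟩
    have : C (q.leadingCoeff ^ (2 * (k + 1))) * p = C (q.leadingCoeff ^ (2 * k)) * p₁ +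
        C (q.leadingCoeff ^ (2 * k)) *
          (C (q.leadingCoeff * p.leadingCoeff) * X ^ (p.natDegree - q.natDegree)) * q := by
      rw [hp₁, show 2 * (k + 1) = 2 * k + 2 by ring, pow_add, C_mul]
      ring
    rw [this, e]
    ring

end Closure

/-- The signs of finitely many polynomials in one variable over a ring `D` are controlled by the
signs of finitely many elements of `D`. -/
theorem exists_sign_transfer {D : Type*} [CommRing D] (F : Finset D[X]) :
    ∃ S : Finset D, ∀ {R R' : Type} [Field R] [LinearOrder R] [IsStrictOrderedRing R]
      [Field R'] [LinearOrder R'] [IsStrictOrderedRing R'] (φ : D →+* R) (φ' : D →+* R'),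
      PolyIVT R → PolyIVT R' →
      (∀ c ∈ S, SignType.sign (φ c) = SignType.sign (φ' c)) →
      ∀ y : R, ∃ y' : R', ∀ p ∈ F,
        SignType.sign ((p.map φ).eval y) = SignType.sign ((p.map φ').eval y') := by
  classical
  choose k u r hr using fun x : D[X] × D[X] => fun hq : 0 < x.2.natDegree =>
    Polynomial.exists_pseudoRemainder x.1 x.2 hq
  obtain ⟨T, hFT, hT⟩ := Finset.exists_superset_closed_of_lt (α := D[X]) natDegree
    (fun p q => if hq : 0 < q.natDegree then {derivative q, q.eraseLead, r (p, q) hq} else ∅)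
    (by
      intro p q hq hqp x hx
      rw [dif_pos hq] at hx
      simp only [Finset.mem_insert, Finset.mem_singleton] at hx
      rcases hx with rfl | rfl | rfl
      · exact natDegree_derivative_lt hq.ne'
      · exact lt_of_le_of_lt (eraseLead_natDegree_le q) (by omega)
      · exact (hr (p, q) hq).2) F
  refine ⟨T.image leadingCoeff, ?_⟩
  intro R R' _ _ _ _ _ _ φ φ' hR hR' hS y
  have hlc : ∀ p ∈ T, SignType.sign (φ p.leadingCoeff) = SignType.sign (φ' p.leadingCoeff) :=
    fun p hp => hS _ (Finset.mem_image_of_mem _ hp)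
  have hlc0 : ∀ p ∈ T, φ p.leadingCoeff = 0 → φ' p.leadingCoeff = 0 := by
    intro p hp h0
    have := hlc p hp
    rw [h0, sign_zero] at this
    exact sign_eq_zero_iff.1 this.symm
  have hlc1 : ∀ p ∈ T, φ p.leadingCoeff ≠ 0 → φ' p.leadingCoeff ≠ 0 := by
    intro p hp h0 h1
    have := hlc p hp
    rw [h1, sign_zero] at this
    exact h0 (sign_eq_zero_iff.1 this)
  set G := insert 0 (T.filter (fun p => φ p.leadingCoeff ≠ 0)) with hG
  have hgood : ∀ p ∈ T, ∃ g ∈ G, g.natDegree ≤ p.natDegree ∧ g.map φ = p.map φ ∧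
      g.map φ' = p.map φ' := by
    intro p
    induction hn : p.natDegree using Nat.strong_induction_on generalizing p with
    | _ n ih =>
      intro hp
      by_cases h0 : φ p.leadingCoeff = 0
      · have h0' := hlc0 p hp h0
        rcases Nat.eq_zero_or_pos p.natDegree with hd | hd
        · refine ⟨0, Finset.mem_insert_self _ _, by simp, ?_, ?_⟩
          · rw [leadingCoeff, hd] at h0
            rw [eq_C_of_natDegree_eq_zero hd, map_C, h0, Polynomial.map_zero, C_0]
          · rw [leadingCoeff, hd] at h0'
            rw [eq_C_of_natDegree_eq_zero hd, map_C, h0', Polynomial.map_zero, C_0]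
        · have he : p.eraseLead ∈ T := by
            apply hT p hp p hp hd le_rfl
            rw [dif_pos hd]
            simp
          have hlt : p.eraseLead.natDegree < n := by
            have := eraseLead_natDegree_le p
            omega
          obtain ⟨g, hg, g1, g2, g3⟩ := ih _ hlt p.eraseLead rfl he
          have e := p.eraseLead_add_C_mul_X_pow
          refine ⟨g, hg, by omega, ?_, ?_⟩
          · have e' := congrArg (Polynomial.map φ) e
            simp only [Polynomial.map_add, Polynomial.map_mul, map_C, h0, C_0, zero_mul,
              add_zero] at e'
            rw [g2, e']
          · have e' := congrArg (Polynomial.map φ') e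
            simp only [Polynomial.map_add, Polynomial.map_mul, map_C, h0', C_0, zero_mul,
              add_zero] at e'
            rw [g3, e']
      · exact ⟨p, Finset.mem_insert_of_mem (Finset.mem_filter.2 ⟨hp, h0⟩), hn.le, rfl, rfl⟩
  have hdeg : ∀ p ∈ G, (p.map φ).natDegree = p.natDegree ∧ (p.map φ').natDegree = p.natDegree := by
    intro p hp
    rcases Finset.mem_insert.1 hp with rfl | hp
    · simp
    · rw [Finset.mem_filter] at hp
      exact ⟨natDegree_map_of_leadingCoeff_ne_zero φ hp.2,
        natDegree_map_of_leadingCoeff_ne_zero φ' (hlc1 p hp.1 hp.2)⟩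
  have hmem : ∀ p ∈ G, 0 < p.natDegree → p ∈ T ∧ φ p.leadingCoeff ≠ 0 := by
    intro p hp hd
    rcases Finset.mem_insert.1 hp with rfl | hp
    · simp at hd
    · exact Finset.mem_filter.1 hp
  have hcomp : SignCompatible (fun p : D[X] => p.map φ) (fun p : D[X] => p.map φ') G := by
    refine ⟨fun p hp => ?_, fun p hp => ?_, fun p hp hd => ?_, fun p hp q hq hd hqp => ?_⟩
    · rw [(hdeg p hp).1, (hdeg p hp).2]
    · rcases Finset.mem_insert.1 hp with rfl | hp
      · simp
      · rw [Finset.mem_filter] at hp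
        rw [leadingCoeff_map_of_leadingCoeff_ne_zero φ hp.2,
          leadingCoeff_map_of_leadingCoeff_ne_zero φ' (hlc1 p hp.1 hp.2), hlc p hp.1]
    · rw [(hdeg p hp).1] at hd
      have hpT := (hmem p hp hd).1
      have hder : derivative p ∈ T := by
        apply hT p hpT p hpT hd le_rfl
        rw [dif_pos hd]
        simp
      obtain ⟨g, hg, -, g2, g3⟩ := hgood _ hder
      exact ⟨g, hg, by rw [g2, derivative_map], by rw [g3, derivative_map]⟩
    · rw [(hdeg q hq).1] at hd hqp
      rw [(hdeg p hp).1] at hqp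
      have hpT := (hmem p hp (hd.trans_le hqp)).1
      obtain ⟨hqT, hq0⟩ := hmem q hq hd
      have hrT : r (p, q) hd ∈ T := by
        apply hT p hpT q hqT hd hqp
        rw [dif_pos hd]
        simp
      obtain ⟨e, hrd⟩ := hr (p, q) hd
      obtain ⟨g, hg, g1, g2, g3⟩ := hgood _ hrT
      have main : ∀ {K : Type} [Field K] [LinearOrder K] [IsStrictOrderedRing K] (ψ : D →+* K),
          ψ q.leadingCoeff ≠ 0 → g.map ψ = (r (p, q) hd).map ψ → ∀ x, (q.map ψ).eval x = 0 →
          SignType.sign ((p.map ψ).eval x) = SignType.sign ((g.map ψ).eval x) := by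
        intro K _ _ _ ψ h0 hgr x hx
        have := congrArg (fun z => (z.map ψ).eval x) e
        simp only [Polynomial.map_mul, Polynomial.map_add, map_C, eval_mul, eval_add, eval_C, hx,
          mul_zero, zero_add, map_pow ψ] at this
        have hpos : 0 < ψ q.leadingCoeff ^ (2 * k (p, q) hd) := by
          rw [pow_mul]
          positivity
        rw [hgr, ← this, sign_mul, sign_pos hpos, one_mul]
      refine ⟨g, hg, ?_, main φ hq0 g2, main φ' (hlc1 q hqT hq0) g3⟩
      rw [(hdeg q hq).1, (hdeg g hg).1]
      exact lt_of_le_of_lt g1 hrd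
  obtain ⟨y', hy'⟩ := hcomp.exists_signMatch hR hR' y
  refine ⟨y', fun p hp => ?_⟩
  obtain ⟨g, hg, -, g2, g3⟩ := hgood p (hFT hp)
  rw [← g2, ← g3]
  exact hy' g hg

theorem polyIVT_real : PolyIVT ℝ := by
  intro p a b hab hp
  have hc : ContinuousOn (fun x => p.eval x) (Set.Icc a b) := p.continuous.continuousOn
  rcases mul_neg_iff.1 hp with ⟨h1, h2⟩ | ⟨h1, h2⟩
  · obtain ⟨c, hc1, hc2⟩ := intermediate_value_Ioo' hab.le hc ⟨h2, h1⟩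
    exact ⟨c, hc1.1, hc1.2, hc2⟩
  · obtain ⟨c, hc1, hc2⟩ := intermediate_value_Ioo hab.le hc ⟨h1, h2⟩
    exact ⟨c, hc1.1, hc1.2, hc2⟩

theorem RingHom.sign_map_real {E : Type*} [Field E] [LinearOrder E] [IsStrictOrderedRing E]
    (φ : ℝ →+* E) (c : ℝ) : SignType.sign (φ c) = SignType.sign c := by
  have hpos : ∀ c : ℝ, 0 < c → 0 < φ c := by
    intro c hc
    rw [← Real.mul_self_sqrt hc.le, map_mul]
    exact mul_self_pos.2 (by simpa using (Real.sqrt_pos.2 hc).ne')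
  rcases lt_trichotomy c 0 with h | rfl | h
  · have := hpos (-c) (by linarith)
    rw [map_neg] at this
    rw [sign_neg h, sign_neg (by linarith)]
  · simp
  · rw [sign_pos h, sign_pos (hpos c h)]

theorem MvPolynomial.aeval_eq_eval_map_finSuccEquiv {E : Type*} [CommRing E] [Algebra ℝ E] {n : ℕ}
    (y : Fin (n + 1) → E) (p : MvPolynomial (Fin (n + 1)) ℝ) :
    aeval y p = ((finSuccEquiv ℝ n p).map
      (aeval (fun i => y (Fin.succ i)) : MvPolynomial (Fin n) ℝ →ₐ[ℝ] E).toRingHom).eval (y 0) := by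
  induction p using MvPolynomial.induction_on with
  | C a => simp [finSuccEquiv_apply]
  | add p q hp hq => simp only [map_add, Polynomial.map_add, Polynomial.eval_add, hp, hq]
  | mul_X p i hp =>
    simp only [map_mul, Polynomial.map_mul, Polynomial.eval_mul, hp]
    congr 1
    refine Fin.cases ?_ (fun i => ?_) i
    · simp [finSuccEquiv_X_zero]
    · simp [finSuccEquiv_X_succ]

theorem MvPolynomial.exists_real_sign_eq {E : Type} [Field E] [LinearOrder E]
    [IsStrictOrderedRing E] [Algebra ℝ E] (hE : PolyIVT E) {n : ℕ} (y : Fin n → E)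
    (F : Finset (MvPolynomial (Fin n) ℝ)) :
    ∃ x : Fin n → ℝ, ∀ p ∈ F,
      SignType.sign (aeval y p) = SignType.sign (aeval x p) := by
  classical
  induction n with
  | zero =>
    refine ⟨0, fun p _ => ?_⟩
    obtain ⟨c, rfl⟩ := C_surjective (Fin 0) p
    simpa using RingHom.sign_map_real (algebraMap ℝ E) c
  | succ n ih =>
    obtain ⟨S, hS⟩ := exists_sign_transfer (F.image (finSuccEquiv ℝ n))
    obtain ⟨x, hx⟩ := ih (fun i => y (Fin.succ i)) S
    obtain ⟨x₀, hx₀⟩ := hS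
      (aeval (fun i => y (Fin.succ i)) : MvPolynomial (Fin n) ℝ →ₐ[ℝ] E).toRingHom
      (aeval x : MvPolynomial (Fin n) ℝ →ₐ[ℝ] ℝ).toRingHom hE polyIVT_real hx (y 0)
    refine ⟨Fin.cons x₀ x, fun p hp => ?_⟩
    rw [aeval_eq_eval_map_finSuccEquiv, aeval_eq_eval_map_finSuccEquiv]
    simpa only [Fin.cons_zero, Fin.cons_succ] using hx₀ _ (Finset.mem_image_of_mem _ hp)

theorem IsSumSq.map_ringHom {A B : Type*} [CommRing A] [CommRing B] (φ : A →+* B) {s : A}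
    (hs : IsSumSq s) : IsSumSq (φ s) := by
  induction hs with
  | zero => simp
  | sq_add a _ ih =>
    rw [map_add, map_mul]
    exact IsSumSq.sq_add _ ih

/-- Sums of squares of polynomials of degree less than `n`. -/
noncomputable def Polynomial.sumSqNatDegreeLT (E : Type*) [Field E] (n : ℕ) : AddSubmonoid E[X] :=
  AddSubmonoid.closure {x | ∃ g : E[X], g.natDegree < n ∧ x = g * g}

section RealClosedOrder

variable {E : Type*} [Field E]

theorem IsSumSq.eq_zero_of_neg (hE : ¬ IsSumSq (-1 : E)) {x : E} (h1 : IsSumSq x)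
    (h2 : IsSumSq (-x)) : x = 0 := by
  by_contra hx
  apply hE
  have : (-1 : E) = -x * x * (x⁻¹ * x⁻¹) := by field_simp
  rw [this]
  exact (h2.mul h1).mul (IsSumSq.mul_self _)

theorem Polynomial.natDegree_sumSqNatDegreeLT {n : ℕ} {s : E[X]}
    (hs : s ∈ sumSqNatDegreeLT E n) : s.natDegree ≤ 2 * (n - 1) := by
  induction hs using AddSubmonoid.closure_induction with
  | mem x hx =>
    obtain ⟨g, hg, rfl⟩ := hx
    have := natDegree_mul_le (p := g) (q := g)
    omega
  | zero => simp
  | add x y _ _ hx hy => exact (natDegree_add_le _ _).trans (max_le hx hy)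

theorem Polynomial.isSumSq_eval_sumSqNatDegreeLT {n : ℕ} {s : E[X]}
    (hs : s ∈ sumSqNatDegreeLT E n) (c : E) : IsSumSq (s.eval c) := by
  induction hs using AddSubmonoid.closure_induction with
  | mem x hx =>
    obtain ⟨g, hg, rfl⟩ := hx
    simp
  | zero => simp
  | add x y _ _ hx hy => rw [eval_add]; exact hx.add hy

theorem isSumSq_neg_of_not_isSquare (hE : ¬ IsSumSq (-1 : E))
    (hirr : ∀ P : E[X], Irreducible P → 2 ≤ P.natDegree →
      ∃ s ∈ sumSqNatDegreeLT E P.natDegree, P ∣ 1 + s) {a : E} (ha : ¬ IsSquare a) :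
    IsSumSq (-a) := by
  have hP : Irreducible (X ^ 2 - C a) :=
    X_pow_sub_C_irreducible_of_prime Nat.prime_two (fun b hb => ha ⟨b, by rw [← hb, sq]⟩)
  have hdeg : (X ^ 2 - C a).natDegree = 2 := natDegree_X_pow_sub_C
  obtain ⟨s, hs, h, hh⟩ := hirr _ hP hdeg.ge
  rw [hdeg] at hs
  have hs2 := natDegree_sumSqNatDegreeLT hs
  have hsBDG : ∀ s ∈ sumSqNatDegreeLT E 2, ∃ B D G : E, IsSumSq B ∧ IsSumSq G ∧
      s = C B + C D * X + C G * X ^ 2 := by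
    intro s hs
    induction hs using AddSubmonoid.closure_induction with
    | mem x hx =>
      obtain ⟨g, hg, rfl⟩ := hx
      obtain ⟨c, b, rfl⟩ := exists_eq_X_add_C_of_natDegree_le_one (p := g) (by omega)
      refine ⟨b * b, 2 * b * c, c * c, by simp, by simp, ?_⟩
      simp only [C_mul, C_ofNat]
      ring
    | zero => exact ⟨0, 0, 0, by simp, by simp, by simp⟩
    | add x y hx' hy' hx hy =>
      obtain ⟨B, D, G, hB, hG, rfl⟩ := hx
      obtain ⟨B', D', G', hB', hG', rfl⟩ := hy
      refine ⟨B + B', D + D', G + G', hB.add hB', hG.add hG', ?_⟩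
      simp only [C_add]
      ring
  obtain ⟨B, D, G, hB, hG, rfl⟩ : ∃ B D G : E, IsSumSq B ∧ IsSumSq G ∧
      s = C B + C D * X + C G * X ^ 2 := hsBDG s hs
  have c0 := congrArg (fun p => p.coeff 0) hh
  have hB1 : 1 + B ≠ 0 := by
    intro h0
    exact hE (by rwa [← eq_neg_of_add_eq_zero_right h0])
  have hh0 : h ≠ 0 := by
    rintro rfl
    simp at c0
    exact hB1 c0
  have hdh : h.natDegree = 0 := by
    have h1 := congrArg natDegree hh
    rw [natDegree_mul hP.ne_zero hh0, hdeg] at h1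
    have h2 := natDegree_add_le (1 : E[X]) (C B + C D * X + C G * X ^ 2)
    rw [natDegree_one] at h2
    omega
  obtain ⟨k, rfl⟩ := natDegree_eq_zero.1 hdh
  have c2 := congrArg (fun p => p.coeff 2) hh
  simp [coeff_one, coeff_X, coeff_C] at c0 c2
  subst c2
  have hG0 : G ≠ 0 := by rintro rfl; simp at hh0
  have : -a = (1 + B) * G * (G⁻¹ * G⁻¹) := by
    rw [c0]; field_simp
  rw [this]
  exact ((IsSumSq.one.add hB).mul hG).mul (IsSumSq.mul_self _)

theorem exists_linearOrder_polyIVT (hE : ¬ IsSumSq (-1 : E))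
    (hirr : ∀ P : E[X], Irreducible P → 2 ≤ P.natDegree →
      ∃ s ∈ sumSqNatDegreeLT E P.natDegree, P ∣ 1 + s) :
    ∃ (_ : LinearOrder E) (_ : IsStrictOrderedRing E), PolyIVT E := by
  classical
  have hsq : ∀ a : E, IsSumSq a → IsSquare a := by
    intro a ha
    by_contra hns
    have := ha.eq_zero_of_neg hE (isSumSq_neg_of_not_isSquare hE hirr hns)
    exact hns (this ▸ IsSquare.zero)
  let cone : RingCone E :=
    { Subsemiring.sumSq E with
      eq_zero_of_mem_of_neg_mem' := fun {a} h1 h2 =>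
        IsSumSq.eq_zero_of_neg hE (Subsemiring.mem_sumSq.1 h1) (Subsemiring.mem_sumSq.1 h2) }
  have hmem : ∀ a : E, a ∈ cone ↔ IsSumSq a := fun a => Subsemiring.mem_sumSq
  have : HasMemOrNegMem cone := ⟨fun a => by
    rw [hmem, hmem]
    by_cases ha : IsSquare a
    · exact Or.inl ha.isSumSq
    · exact Or.inr (isSumSq_neg_of_not_isSquare hE hirr ha)⟩
  let o : LinearOrder E := LinearOrder.mkOfAddGroupCone cone
  have : IsOrderedRing E := IsOrderedRing.mkOfCone cone
  have : IsStrictOrderedRing E := inferInstance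
  refine ⟨o, inferInstance, ?_⟩
  have hlin : ∀ (P : E[X]) (a b : E), P.natDegree = 1 → P.eval a * P.eval b < 0 → a < b →
      ∃ c, a < c ∧ c < b ∧ P.eval c = 0 := by
    intro P a b hd hP hab
    obtain ⟨u, v, rfl⟩ := exists_eq_X_add_C_of_natDegree_le_one hd.le
    have hu : u ≠ 0 := by rintro rfl; simp at hd
    simp only [eval_add, eval_mul, eval_C, eval_X] at hP ⊢
    have hneg : (a + v / u) * (b + v / u) < 0 := by
      have : (u * a + v) * (u * b + v) = u ^ 2 * ((a + v / u) * (b + v / u)) := by field_simp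
      rw [this] at hP
      have hu2 : 0 < u ^ 2 := by positivity
      exact (mul_neg_iff.1 hP).resolve_right (fun h => absurd h.1 hu2.not_gt) |>.2
    refine ⟨-(v / u), ?_, ?_, by field_simp; ring⟩
    · by_contra! h
      nlinarith
    · by_contra! h
      nlinarith
  intro P
  induction hn : P.natDegree using Nat.strong_induction_on generalizing P with
  | _ n ih =>
    intro a b hab hP
    have hP0 : P ≠ 0 := by rintro rfl; simp at hP
    have hd0 : P.natDegree ≠ 0 := by
      intro h0
      obtain ⟨c, rfl⟩ := natDegree_eq_zero.1 h0
      simp only [eval_C] at hP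
      exact absurd hP (mul_self_nonneg c).not_gt
    have hunit : ¬ IsUnit P := fun h => hd0 (natDegree_eq_zero_of_isUnit h)
    by_cases hirrP : Irreducible P
    · rcases Nat.lt_or_ge P.natDegree 2 with h2 | h2
      · exact hlin P a b (by omega) hP hab
      obtain ⟨s, hs, h, hh⟩ := hirr P hirrP h2
      have hpos : ∀ c, 0 < P.eval c * h.eval c := by
        intro c
        rw [← eval_mul, ← hh, eval_add, eval_one]
        have := (isSumSq_eval_sumSqNatDegreeLT hs c).nonneg
        linarith
      have hh0 : h ≠ 0 := by
        rintro rfl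
        simpa using hpos 0
      have hdh : h.natDegree < n := by
        have h1 := congrArg natDegree hh
        rw [natDegree_mul hP0 hh0] at h1
        have h3 := natDegree_add_le (1 : E[X]) s
        have h4 := natDegree_sumSqNatDegreeLT hs
        rw [natDegree_one] at h3
        omega
      obtain ⟨c, -, -, hc⟩ := ih _ hdh h rfl a b hab (by
        have h1 := mul_pos (hpos a) (hpos b)
        have h2 : (P.eval a * P.eval b) * (h.eval a * h.eval b) > 0 := by
          have : (P.eval a * P.eval b) * (h.eval a * h.eval b) =
            P.eval a * h.eval a * (P.eval b * h.eval b) := by ring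
          rw [this]; exact h1
        exact neg_of_mul_pos_right h2 hP.le)
      have := hpos c
      rw [hc, mul_zero] at this
      exact absurd this (lt_irrefl 0)
    · obtain ⟨Q, R, hQR, hQ, hR⟩ : ∃ Q R, P = Q * R ∧ ¬ IsUnit Q ∧ ¬ IsUnit R := by
        rw [irreducible_iff] at hirrP
        push Not at hirrP
        obtain ⟨Q, R, h1, h2, h3⟩ := hirrP hunit
        exact ⟨Q, R, h1, h2, h3⟩
      subst hQR
      have hQ0 := left_ne_zero_of_mul hP0
      have hR0 := right_ne_zero_of_mul hP0
      have hpos : ∀ S : E[X], S ≠ 0 → ¬ IsUnit S → 0 < S.natDegree := by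
        intro S h0 hS
        by_contra! h1
        apply hS
        rw [isUnit_iff_degree_eq_zero, degree_eq_natDegree h0, Nat.le_zero.1 h1]
        rfl
      have hQd := hpos Q hQ0 hQ
      have hRd := hpos R hR0 hR
      rw [natDegree_mul hQ0 hR0] at hn
      have hQR' : (Q.eval a * Q.eval b) * (R.eval a * R.eval b) < 0 := by
        rw [eval_mul, eval_mul] at hP
        linarith [show (Q.eval a * Q.eval b) * (R.eval a * R.eval b) =
          Q.eval a * R.eval a * (Q.eval b * R.eval b) by ring]
      rcases mul_neg_iff.1 hQR' with ⟨-, h1⟩ | ⟨h1, -⟩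
      · obtain ⟨c, c1, c2, c3⟩ := ih _ (by omega) R rfl a b hab h1
        exact ⟨c, c1, c2, by rw [eval_mul, c3, mul_zero]⟩
      · obtain ⟨c, c1, c2, c3⟩ := ih _ (by omega) Q rfl a b hab h1
        exact ⟨c, c1, c2, by rw [eval_mul, c3, zero_mul]⟩

end RealClosedOrder

theorem IntermediateField.exists_maximal_not_isSumSq_neg_one {K Ω : Type*} [Field K] [Field Ω]
    [Algebra K Ω] (hK : ¬ IsSumSq (-1 : K)) :
    ∃ F : IntermediateField K Ω,
      Maximal (· ∈ {F : IntermediateField K Ω | ¬ IsSumSq (-1 : F)}) F := by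
  suffices H : ∃ m, (⊥ : IntermediateField K Ω) ≤ m ∧
      Maximal (· ∈ {F : IntermediateField K Ω | ¬ IsSumSq (-1 : F)}) m by
    obtain ⟨m, -, hm⟩ := H
    exact ⟨m, hm⟩
  apply zorn_le_nonempty₀
  · intro c hc hchain F₀ hF₀
    refine ⟨sSup c, ?_, fun F hF => le_sSup hF⟩
    have hdir : DirectedOn (· ≤ ·) c := hchain.directedOn
    have hmem : ∀ x : Ω, x ∈ sSup c → ∃ F ∈ c, x ∈ F := by
      intro x hx
      have : Nonempty c := ⟨⟨F₀, hF₀⟩⟩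
      rw [sSup_eq_iSup', ← SetLike.mem_coe,
        IntermediateField.coe_iSup_of_directed hchain.directed, Set.mem_iUnion] at hx
      obtain ⟨F, hF⟩ := hx
      exact ⟨F.1, F.2, hF⟩
    have key : ∀ x : ↥(sSup c), IsSumSq x → ∃ F ∈ c, ∃ y : F, IsSumSq y ∧ (y : Ω) = x := by
      intro x hx
      induction hx with
      | zero => exact ⟨F₀, hF₀, 0, by simp, by simp⟩
      | sq_add a _ ih =>
        obtain ⟨F₁, hF₁, y, hy, hys⟩ := ih
        obtain ⟨F₂, hF₂, ha⟩ := hmem a a.2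
        obtain ⟨F, hF, h1, h2⟩ := hdir F₁ hF₁ F₂ hF₂
        refine ⟨F, hF, ⟨a, h2 ha⟩ * ⟨a, h2 ha⟩ + IntermediateField.inclusion h1 y,
          IsSumSq.sq_add _ (hy.map_ringHom (IntermediateField.inclusion h1).toRingHom), ?_⟩
        push_cast
        rw [← hys]
        rfl
    intro hneg
    obtain ⟨F, hF, y, hy, hyx⟩ := key _ hneg
    refine hc hF ?_
    have : y = -1 := Subtype.ext (by rw [hyx]; simp)
    exact this ▸ hy
  · intro h
    apply hK
    have := h.map_ringHom (IntermediateField.botEquiv K Ω).toAlgHom.toRingHom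
    simpa using this

theorem exists_real_closed_extension {K : Type} [Field K] (hK : ¬ IsSumSq (-1 : K)) :
    ∃ (E : Type) (_ : Field E) (_ : Algebra K E) (_ : LinearOrder E) (_ : IsStrictOrderedRing E),
      PolyIVT E := by
  obtain ⟨F, hF⟩ :=
    IntermediateField.exists_maximal_not_isSumSq_neg_one (Ω := AlgebraicClosure K) hK
  have hirr : ∀ P : F[X], Irreducible P → 2 ≤ P.natDegree →
      ∃ s ∈ sumSqNatDegreeLT F P.natDegree, P ∣ 1 + s := by
    intro P hP hdeg
    obtain ⟨α, hα⟩ := IsAlgClosed.exists_aeval_eq_zero (AlgebraicClosure K) P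
      hP.degree_pos.ne'
    have hαF : α ∉ F := by
      intro hmem
      have hroot : P.IsRoot ⟨α, hmem⟩ := by
        have h1 : aeval (algebraMap F (AlgebraicClosure K) ⟨α, hmem⟩) P = 0 := hα
        rw [aeval_algebraMap_apply] at h1
        simpa using h1
      have := degree_eq_one_of_irreducible_of_root hP hroot
      rw [degree_eq_natDegree hP.ne_zero] at this
      norm_cast at this
      omega
    have halg : IsAlgebraic F α := ⟨P, hP.ne_zero, hα⟩
    set F' := IntermediateField.adjoin F {α} with hF'
    have hlt : F < F'.restrictScalars K := by
      refine lt_of_le_of_ne (fun x hx => ?_) ?_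
      · exact F'.algebraMap_mem ⟨x, hx⟩
      · intro heq
        apply hαF
        rw [heq]
        exact IntermediateField.mem_adjoin_simple_self F α
    have hneg : IsSumSq (-1 : ↥(F'.restrictScalars K)) := by
      by_contra hcon
      exact hF.not_prop_of_gt hlt hcon
    have hrep : ∀ x ∈ F', ∃ g : F[X], g.natDegree < P.natDegree ∧ aeval α g = x := by
      intro x hx
      rw [← IntermediateField.mem_toSubalgebra, hF',
        IntermediateField.adjoin_simple_toSubalgebra_of_isAlgebraic halg,
        Algebra.adjoin_singleton_eq_range_aeval] at hx
      obtain ⟨g, rfl⟩ := hx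
      refine ⟨g % P, natDegree_mod_lt g (by omega), ?_⟩
      have := congrArg (aeval α) (EuclideanDomain.div_add_mod g P)
      rw [map_add, map_mul, hα, zero_mul, zero_add] at this
      exact this
    have key : ∀ x : ↥(F'.restrictScalars K), IsSumSq x →
        ∃ s ∈ sumSqNatDegreeLT F P.natDegree, aeval α s = (x : AlgebraicClosure K) := by
      intro x hx
      induction hx with
      | zero => exact ⟨0, zero_mem _, by simp⟩
      | sq_add a _ ih =>
        obtain ⟨s, hs, hsx⟩ := ih
        obtain ⟨g, hg, hga⟩ := hrep a a.2
        refine ⟨g * g + s, add_mem (AddSubmonoid.subset_closure ⟨g, hg, rfl⟩) hs, ?_⟩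
        rw [map_add, map_mul, hga, hsx]
        rfl
    obtain ⟨s, hs, hs1⟩ := key _ hneg
    refine ⟨s, hs, ?_⟩
    have hdvd : minpoly F α ∣ 1 + s := by
      apply minpoly.dvd
      rw [map_add, hs1]
      simp
    rw [← minpoly.eq_of_irreducible hP hα] at hdvd
    exact (dvd_mul_right _ _).trans hdvd
  obtain ⟨o, h1, h2⟩ := exists_linearOrder_polyIVT hF.prop hirr
  exact ⟨F, inferInstance, inferInstance, o, h1, h2⟩

section RealIdeal

variable {A : Type*} [CommRing A]

/-- An ideal avoiding all elements `1 + s`, with `s` a sum of squares, is contained in a real prime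
ideal. -/
theorem Ideal.exists_le_real_prime (I : Ideal A) (hI : ∀ s : A, IsSumSq s → 1 + s ∉ I) :
    ∃ J : Ideal A, J.IsPrime ∧ I ≤ J ∧ ∀ a s : A, IsSumSq s → a * a + s ∈ J → a ∈ J := by
  let T : Submonoid A :=
    { carrier := {x | ∃ s, IsSumSq s ∧ x = 1 + s}
      one_mem' := ⟨0, by simp, by simp⟩
      mul_mem' := by
        rintro _ _ ⟨s, hs, rfl⟩ ⟨t, ht, rfl⟩
        exact ⟨s + t + s * t, (hs.add ht).add (hs.mul ht), by ring⟩ }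
  have hIT : Disjoint (I : Set A) T := by
    rw [Set.disjoint_left]
    rintro _ hx ⟨s, hs, rfl⟩
    exact hI s hs hx
  obtain ⟨J, hIJ, hJ⟩ := zorn_le_nonempty₀ {J : Ideal A | Disjoint (J : Set A) T} (by
    intro c hc hchain J₀ hJ₀
    refine ⟨sSup c, Set.disjoint_left.2 fun x hx => ?_, fun _ => le_sSup⟩
    have : Nonempty c := ⟨⟨J₀, hJ₀⟩⟩
    obtain ⟨p, hp⟩ :=
      (Submodule.mem_iSup_of_directed _ hchain.directed).1 (sSup_eq_iSup' c ▸ hx)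
    exact Set.disjoint_left.1 (hc p.2) hp) I hIT
  have hmax : ∀ J' : Ideal A, J < J' → ¬ Disjoint (J' : Set A) T :=
    fun _ => hJ.not_prop_of_gt
  refine ⟨J, Ideal.isPrime_of_maximally_disjoint _ _ hJ.prop hmax, hIJ, ?_⟩
  intro a s hs has
  by_contra haJ
  have hlt : J < J ⊔ Ideal.span {a} := Submodule.lt_sup_iff_notMem.2 haJ
  have := hmax _ hlt
  rw [Set.not_disjoint_iff] at this
  obtain ⟨x, hx, t, ht, rfl⟩ := this
  rw [SetLike.mem_coe, Submodule.mem_sup] at hx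
  obtain ⟨j, hj, z, hz, hjz⟩ := hx
  obtain ⟨b, rfl⟩ := Ideal.mem_span_singleton'.1 hz
  have hmem : 1 + (t + t + t * t + b * b * s) ∈ J := by
    have : 1 + (t + t + t * t + b * b * s) =
        (1 + t + b * a) * j + b * b * (a * a + s) := by
      have hj' : j = 1 + t - b * a := by rw [← hjz]; ring
      rw [hj']; ring
    rw [this]
    exact J.add_mem (J.mul_mem_left _ hj) (J.mul_mem_left _ has)
  exact Set.disjoint_left.1 hJ.prop hmem
    ⟨_, ((ht.add ht).add (ht.mul ht)).add ((IsSumSq.mul_self b).mul hs), rfl⟩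

theorem Ideal.not_isSumSq_neg_one_fractionRing (J : Ideal A) [J.IsPrime]
    (hJ : ∀ a s : A, IsSumSq s → a * a + s ∈ J → a ∈ J) :
    ¬ IsSumSq (-1 : FractionRing (A ⧸ J)) := by
  have hφ : ∀ a : A, algebraMap (A ⧸ J) (FractionRing (A ⧸ J)) (Ideal.Quotient.mk J a) = 0 ↔
      a ∈ J := by
    intro a
    rw [FaithfulSMul.algebraMap_eq_zero_iff, Ideal.Quotient.eq_zero_iff_mem]
  set φ : A →+* FractionRing (A ⧸ J) :=
    (algebraMap (A ⧸ J) (FractionRing (A ⧸ J))).comp (Ideal.Quotient.mk J) with hφdef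
  have hφ0 : ∀ a : A, φ a = 0 ↔ a ∈ J := hφ
  have key : ∀ x : FractionRing (A ⧸ J), IsSumSq x →
      ∃ s d : A, IsSumSq s ∧ d ∉ J ∧ x * (φ d * φ d) = φ s := by
    intro x hx
    induction hx with
    | zero => exact ⟨0, 1, by simp, (Ideal.ne_top_iff_one J).1 (Ideal.IsPrime.ne_top ‹_›), by simp⟩
    | sq_add a _ ih =>
      obtain ⟨s, d, hs, hd, hsd⟩ := ih
      obtain ⟨n, e, he, rfl⟩ := IsFractionRing.div_surjective (A := A ⧸ J) a
      obtain ⟨n, rfl⟩ := Ideal.Quotient.mk_surjective n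
      obtain ⟨e, rfl⟩ := Ideal.Quotient.mk_surjective e
      have heJ : e ∉ J := by
        intro h
        rw [← Ideal.Quotient.eq_zero_iff_mem] at h
        rw [h] at he
        exact zero_notMem_nonZeroDivisors he
      have heφ : φ e ≠ 0 := fun h => heJ ((hφ0 e).1 h)
      refine ⟨n * d * (n * d) + e * e * s, e * d,
        (IsSumSq.mul_self _).add ((IsSumSq.mul_self e).mul hs),
        fun h => (Ideal.IsPrime.mem_or_mem ‹_› h).elim heJ hd, ?_⟩
      simp only [map_add, map_mul, ← hsd]
      change (φ n / φ e * (φ n / φ e) + _) * _ = _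
      field_simp
  intro h
  obtain ⟨s, d, hs, hd, hsd⟩ := key _ h
  apply hd
  apply hJ d s hs
  rw [← hφ0, map_add, map_mul, ← hsd]
  ring

end RealIdeal

/-- The weak real Nullstellensatz. -/
theorem MvPolynomial.exists_real_zero {n : ℕ} (I : Ideal (MvPolynomial (Fin n) ℝ))
    (hI : ∀ s : MvPolynomial (Fin n) ℝ, IsSumSq s → 1 + s ∉ I)
    (F : Finset (MvPolynomial (Fin n) ℝ)) (hF : ∀ p ∈ F, p ∈ I) :
    ∃ x : Fin n → ℝ, ∀ p ∈ F, eval x p = 0 := by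
  obtain ⟨J, hJ, hIJ, hreal⟩ := I.exists_le_real_prime hI
  obtain ⟨E, _, _, _, _, hE⟩ :=
    exists_real_closed_extension (J.not_isSumSq_neg_one_fractionRing hreal)
  let ψ : MvPolynomial (Fin n) ℝ →+* E :=
    (algebraMap (FractionRing (MvPolynomial (Fin n) ℝ ⧸ J)) E).comp
      ((algebraMap (MvPolynomial (Fin n) ℝ ⧸ J) (FractionRing (MvPolynomial (Fin n) ℝ ⧸ J))).comp
        (Ideal.Quotient.mk J))
  let : Algebra ℝ E := (ψ.comp C).toAlgebra
  have hψ : ∀ p, aeval (fun i => ψ (X i)) p = ψ p := by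
    intro p
    induction p using MvPolynomial.induction_on with
    | C a => simp only [aeval_C]; rfl
    | add p q hp hq => simp only [map_add, hp, hq]
    | mul_X p i hp => simp only [map_mul, hp, aeval_X]
  obtain ⟨x, hx⟩ := exists_real_sign_eq hE (fun i => ψ (X i)) F
  refine ⟨x, fun p hp => ?_⟩
  have h0 : ψ p = 0 := by
    have : Ideal.Quotient.mk J p = 0 := Ideal.Quotient.eq_zero_iff_mem.2 (hIJ (hF p hp))
    simp only [ψ, RingHom.comp_apply, this, map_zero]
  have := hx p hp
  rw [hψ, h0, sign_zero] at this
  simpa [aeval_eq_eval] using sign_eq_zero_iff.1 this.symm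

end

/-- Carleman's inequality, for partial sums. -/
theorem Real.carleman_inequality (a : ℕ → ℝ) (ha : ∀ n, 0 ≤ a n) (N : ℕ) :
    ∑ n ∈ Finset.range N, (∏ k ∈ Finset.range (n + 1), a k) ^ (1 / ((n : ℝ) + 1)) ≤
      Real.exp 1 * ∑ n ∈ Finset.range N, a n := by
  set c : ℕ → ℝ := fun k => ((k : ℝ) + 2) ^ (k + 1) / ((k : ℝ) + 1) ^ k with hc
  have hcpos : ∀ k, 0 < c k := fun k => by simp only [hc]; positivity
  have hprod : ∀ n, ∏ k ∈ Finset.range (n + 1), c k = ((n : ℝ) + 2) ^ (n + 1) := by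
    intro n
    induction n with
    | zero => simp [hc]
    | succ n ih =>
      rw [Finset.prod_range_succ, ih, hc]
      push_cast
      have : (n : ℝ) + 1 + 1 = n + 2 := by ring
      rw [this, mul_div_cancel₀ _ (by positivity)]
  set T : ℕ → ℝ := fun N => ∑ k ∈ Finset.range N, a k * c k with hT
  have hterm : ∀ n : ℕ, (∏ k ∈ Finset.range (n + 1), a k) ^ (1 / ((n : ℝ) + 1)) ≤
      T (n + 1) / (((n : ℝ) + 1) * (n + 2)) := by
    intro n
    have h1 := Real.geom_mean_le_arith_mean_weighted (Finset.range (n + 1))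
      (fun _ => 1 / ((n : ℝ) + 1)) (fun k => a k * c k) (fun _ _ => by positivity)
      (by simp; field_simp) (fun k _ => mul_nonneg (ha k) (hcpos k).le)
    rw [Real.finsetProd_rpow _ _ (fun k _ => mul_nonneg (ha k) (hcpos k).le),
      Finset.prod_mul_distrib, hprod, Real.mul_rpow (Finset.prod_nonneg fun k _ => ha k)
        (by positivity), ← Finset.mul_sum] at h1
    have h2 : (((n : ℝ) + 2) ^ (n + 1)) ^ (1 / ((n : ℝ) + 1)) = n + 2 := by
      rw [← Real.rpow_natCast, ← Real.rpow_mul (by positivity)]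
      push_cast
      rw [mul_one_div_cancel (by positivity), Real.rpow_one]
    rw [h2] at h1
    have h3 : (1 / ((n : ℝ) + 1)) * T (n + 1) * ((n : ℝ) + 1) = T (n + 1) := by field_simp
    have h4 := mul_le_mul_of_nonneg_right h1 (by positivity : (0 : ℝ) ≤ (n : ℝ) + 1)
    rw [le_div_iff₀ (by positivity)]
    calc _ = _ := by ring
      _ ≤ _ := h4
      _ = _ := h3
  have hsum : ∀ N : ℕ, ∑ n ∈ Finset.range N, T (n + 1) / (((n : ℝ) + 1) * (n + 2)) +
      T N / ((N : ℝ) + 1) = ∑ k ∈ Finset.range N, a k * c k / ((k : ℝ) + 1) := by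
    intro N
    induction N with
    | zero => simp [hT]
    | succ N ih =>
      rw [Finset.sum_range_succ, Finset.sum_range_succ, ← ih]
      have : T (N + 1) = T N + a N * c N := Finset.sum_range_succ _ _
      rw [this]
      push_cast
      field_simp
      ring
  have hT0 : 0 ≤ T N := Finset.sum_nonneg fun k _ => mul_nonneg (ha k) (hcpos k).le
  have hce : ∀ k : ℕ, c k / ((k : ℝ) + 1) ≤ Real.exp 1 := by
    intro k
    have h1 : c k / ((k : ℝ) + 1) = (1 / ((k : ℝ) + 1) + 1) ^ (k + 1) := by
      simp only [hc]
      rw [div_div, ← pow_succ, ← div_pow]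
      congr 1
      field_simp
      ring
    rw [h1]
    calc (1 / ((k : ℝ) + 1) + 1) ^ (k + 1) ≤ (Real.exp (1 / ((k : ℝ) + 1))) ^ (k + 1) := by
          gcongr
          exact Real.add_one_le_exp _
      _ = Real.exp 1 := by
          rw [← Real.exp_nat_mul]
          congr 1
          push_cast
          field_simp
  calc _ ≤ ∑ n ∈ Finset.range N, T (n + 1) / (((n : ℝ) + 1) * (n + 2)) :=
        Finset.sum_le_sum fun n _ => hterm n
    _ ≤ ∑ k ∈ Finset.range N, a k * c k / ((k : ℝ) + 1) := by
        rw [← hsum N]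
        have : 0 ≤ T N / ((N : ℝ) + 1) := by positivity
        linarith
    _ ≤ ∑ k ∈ Finset.range N, Real.exp 1 * a k := by
        refine Finset.sum_le_sum fun k _ => ?_
        rw [mul_div_assoc, mul_comm]
        exact mul_le_mul_of_nonneg_right (hce k) (ha k)
    _ = _ := by rw [Finset.mul_sum]

section Krylov

variable {V : Type*} [AddCommGroup V] [Module ℝ V]

/-- The monic orthogonal sequence obtained by applying the three term recurrence without diagonal
terms to the powers of `X` at `e`. -/
noncomputable def orthoSeq (B : V →ₗ[ℝ] V →ₗ[ℝ] ℝ) (X : V →ₗ[ℝ] V) (e : V) : ℕ → V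
  | 0 => e
  | 1 => X e
  | n + 2 => X (orthoSeq B X e (n + 1)) -
      (B (orthoSeq B X e (n + 1)) (orthoSeq B X e (n + 1)) /
        B (orthoSeq B X e n) (orthoSeq B X e n)) • orthoSeq B X e n

variable {B : V →ₗ[ℝ] V →ₗ[ℝ] ℝ} {X J : V →ₗ[ℝ] V} {e : V}

theorem orthoSeq_parity (hJX : ∀ v, J (X v) = -X (J v)) (hJe : J e = e) (n : ℕ) :
    J (orthoSeq B X e n) = (-1 : ℝ) ^ n • orthoSeq B X e n := by
  induction n using Nat.strong_induction_on with
  | _ n ih =>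
    match n with
    | 0 => simp [orthoSeq, hJe]
    | 1 => simp [orthoSeq, hJX, hJe]
    | n + 2 =>
      rw [orthoSeq, map_sub, hJX, map_smul, ih (n + 1) (by omega), ih n (by omega), map_smul,
        pow_succ, pow_succ]
      module

theorem apply_orthoSeq_eq_zero_of_odd (hJB : ∀ u v, B (J u) (J v) = B u v)
    (hJX : ∀ v, J (X v) = -X (J v)) (hJe : J e = e) {i j : ℕ} (hij : Odd (i + j)) :
    B (orthoSeq B X e i) (orthoSeq B X e j) = 0 := by
  have h := hJB (orthoSeq B X e i) (orthoSeq B X e j)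
  rw [orthoSeq_parity hJX hJe, orthoSeq_parity hJX hJe] at h
  simp only [map_smul, LinearMap.smul_apply, smul_eq_mul] at h
  rw [← mul_assoc, ← pow_add, add_comm j i, hij.neg_one_pow] at h
  linarith

theorem map_orthoSeq (j : ℕ) : ∃ c : ℝ, (j = 0 → c = 0) ∧
    X (orthoSeq B X e j) = orthoSeq B X e (j + 1) + c • orthoSeq B X e (j - 1) := by
  match j with
  | 0 => exact ⟨0, fun _ => rfl, by simp [orthoSeq]⟩
  | j + 1 =>
    exact ⟨B (orthoSeq B X e (j + 1)) (orthoSeq B X e (j + 1)) /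
      B (orthoSeq B X e j) (orthoSeq B X e j), fun h => by omega, by rw [orthoSeq]; simp⟩

theorem apply_orthoSeq_of_lt (hX : ∀ u v, B (X u) v = B u (X v))
    (hJB : ∀ u v, B (J u) (J v) = B u v)
    (hJX : ∀ v, J (X v) = -X (J v)) (hJe : J e = e) (i : ℕ)
    (hi : ∀ k < i, B (orthoSeq B X e k) (orthoSeq B X e k) ≠ 0) :
    ∀ j < i, B (orthoSeq B X e i) (orthoSeq B X e j) = 0 := by
  induction i using Nat.strong_induction_on with
  | _ i ih =>
    intro j hj
    match i with
    | 0 => omega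
    | 1 => exact apply_orthoSeq_eq_zero_of_odd hJB hJX hJe (by
        have : j = 0 := by omega
        subst this
        exact odd_one)
    | n + 2 =>
      rcases Nat.lt_or_ge n j with hlt | hle
      · have : j = n + 1 := by omega
        subst this
        exact apply_orthoSeq_eq_zero_of_odd hJB hJX hJe ⟨n + 1, by ring⟩
      obtain ⟨c, -, hc⟩ := map_orthoSeq (B := B) (X := X) (e := e) j
      rw [orthoSeq, map_sub, LinearMap.sub_apply, hX, hc, map_add, map_smul, map_smul,
        ih (n + 1) (by omega) (fun k hk => hi k (by omega)) (j - 1) (by omega)]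
      rcases hle.lt_or_eq with hlt | rfl
      · rw [ih (n + 1) (by omega) (fun k hk => hi k (by omega)) (j + 1) (by omega),
          LinearMap.smul_apply, ih n (by omega) (fun k hk => hi k (by omega)) j hlt]
        simp
      · rw [LinearMap.smul_apply, smul_zero, add_zero, smul_eq_mul,
          div_mul_cancel₀ _ (hi j (by omega)), sub_self]

theorem apply_orthoSeq_self_le (hB : ∀ u v, B u v = B v u) (hpos : ∀ v, 0 ≤ B v v)
    (hX : ∀ u v, B (X u) v = B u (X v)) (hJB : ∀ u v, B (J u) (J v) = B u v)
    (hJX : ∀ v, J (X v) = -X (J v)) (hJe : J e = e) (n : ℕ)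
    (hn : ∀ k < n, B (orthoSeq B X e k) (orthoSeq B X e k) ≠ 0) :
    B (orthoSeq B X e n) (orthoSeq B X e n) ≤ B ((X ^ n) e) ((X ^ n) e) := by
  have hmono : ∀ n, Submodule.span ℝ (orthoSeq B X e '' Set.Iio n) ≤
      Submodule.span ℝ (orthoSeq B X e '' Set.Iio (n + 1)) := fun n =>
    Submodule.span_mono (Set.image_mono (Set.Iio_subset_Iio (Nat.le_succ n)))
  have hmap : ∀ n, ∀ v ∈ Submodule.span ℝ (orthoSeq B X e '' Set.Iio n),
      X v ∈ Submodule.span ℝ (orthoSeq B X e '' Set.Iio (n + 1)) := by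
    intro n v hv
    induction hv using Submodule.span_induction with
    | mem x hx =>
      obtain ⟨k, hk, rfl⟩ := hx
      obtain ⟨c, -, hc⟩ := map_orthoSeq (B := B) (X := X) (e := e) k
      rw [hc]
      rw [Set.mem_Iio] at hk
      exact add_mem (Submodule.subset_span ⟨k + 1, Set.mem_Iio.2 (by omega), rfl⟩)
        (Submodule.smul_mem _ _ (Submodule.subset_span ⟨k - 1, Set.mem_Iio.2 (by omega), rfl⟩))
    | zero => simp
    | add x y _ _ hx hy => rw [map_add]; exact add_mem hx hy
    | smul a x _ hx => rw [map_smul]; exact Submodule.smul_mem _ _ hx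
  have hrep : ∀ n, (X ^ n) e - orthoSeq B X e n ∈
      Submodule.span ℝ (orthoSeq B X e '' Set.Iio n) := by
    intro n
    induction n with
    | zero => simp [orthoSeq]
    | succ n ih =>
      obtain ⟨c, hc0, hc⟩ := map_orthoSeq (B := B) (X := X) (e := e) n
      have : (X ^ (n + 1)) e - orthoSeq B X e (n + 1) =
          X ((X ^ n) e - orthoSeq B X e n) + c • orthoSeq B X e (n - 1) := by
        rw [map_sub, hc, pow_succ', Module.End.mul_apply]
        abel
      rw [this]
      exact add_mem (hmap n _ ih)
        (Submodule.smul_mem _ _ (Submodule.subset_span ⟨n - 1, Set.mem_Iio.2 (by omega), rfl⟩))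
  have horth : ∀ v ∈ Submodule.span ℝ (orthoSeq B X e '' Set.Iio n),
      B (orthoSeq B X e n) v = 0 := by
    intro v hv
    induction hv using Submodule.span_induction with
    | mem x hx =>
      obtain ⟨k, hk, rfl⟩ := hx
      exact apply_orthoSeq_of_lt hX hJB hJX hJe n hn k hk
    | zero => simp
    | add x y _ _ hx hy => rw [map_add, hx, hy, add_zero]
    | smul a x _ hx => rw [map_smul, hx, smul_zero]
  set r := (X ^ n) e - orthoSeq B X e n with hr
  have h0 := horth r (hrep n)
  have : (X ^ n) e = orthoSeq B X e n + r := by rw [hr]; abel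
  rw [this]
  simp only [map_add, LinearMap.add_apply]
  rw [hB r, h0]
  linarith [hpos r]

theorem functional_orthoSeq_add_two {l : V →ₗ[ℝ] ℝ} (hJX : ∀ v, J (X v) = -X (J v))
    (hJe : J e = e) (hl : ∀ v, l (X v) = l (J v)) (n : ℕ) :
    l (orthoSeq B X e (n + 2)) = (-1) ^ (n + 1) * l (orthoSeq B X e (n + 1)) -
      B (orthoSeq B X e (n + 1)) (orthoSeq B X e (n + 1)) /
        B (orthoSeq B X e n) (orthoSeq B X e n) * l (orthoSeq B X e n) := by
  rw [orthoSeq, map_sub, hl, orthoSeq_parity hJX hJe, map_smul, map_smul, smul_eq_mul, smul_eq_mul]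

theorem christoffel_darboux_orthoSeq {l : V →ₗ[ℝ] ℝ} (hJX : ∀ v, J (X v) = -X (J v))
    (hJe : J e = e) (hl : ∀ v, l (X v) = l (J v)) (hle : l e = 1) (n : ℕ)
    (hn : ∀ k ≤ n, B (orthoSeq B X e k) (orthoSeq B X e k) ≠ 0) :
    (-1) ^ n * (l (orthoSeq B X e n) * l (orthoSeq B X e (n + 1))) =
      B (orthoSeq B X e n) (orthoSeq B X e n) * ∑ k ∈ Finset.range (n + 1),
        l (orthoSeq B X e k) ^ 2 / B (orthoSeq B X e k) (orthoSeq B X e k) := by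
  induction n with
  | zero =>
    have h0 := hn 0 le_rfl
    simp only [orthoSeq, hl, hJe, hle] at h0 ⊢
    simp only [zero_add, Finset.sum_range_one, orthoSeq, hle]
    field_simp
  | succ n ih =>
    have h1 := ih fun k hk => hn k (by omega)
    have h2 := hn n (by omega)
    have h3 := hn (n + 1) le_rfl
    rw [functional_orthoSeq_add_two hJX hJe hl, Finset.sum_range_succ, mul_add,
      mul_div_cancel₀ _ h3, mul_sub, mul_sub]
    have h4 : ((-1 : ℝ) ^ (n + 1)) * (-1) ^ (n + 1) = 1 := by
      rw [← mul_pow]; norm_num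
    generalize (∑ k ∈ Finset.range (n + 1), l (orthoSeq B X e k) ^ 2 /
      B (orthoSeq B X e k) (orthoSeq B X e k)) = K at h1 ⊢
    have h5 : K = (-1) ^ n * (l (orthoSeq B X e n) * l (orthoSeq B X e (n + 1))) /
        B (orthoSeq B X e n) (orthoSeq B X e n) := by
      rw [h1, mul_div_cancel_left₀ _ h2]
    rw [h5]
    linear_combination (l (orthoSeq B X e (n + 1)) ^ 2) * h4

theorem apply_sum_smul_orthoSeq (hB : ∀ u v, B u v = B v u)
    (hX : ∀ u v, B (X u) v = B u (X v))
    (hJB : ∀ u v, B (J u) (J v) = B u v)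
    (hJX : ∀ v, J (X v) = -X (J v)) (hJe : J e = e)
    (hn : ∀ k, B (orthoSeq B X e k) (orthoSeq B X e k) ≠ 0) (c : ℕ → ℝ) (n : ℕ) :
    B (∑ k ∈ Finset.range n, c k • orthoSeq B X e k)
      (∑ k ∈ Finset.range n, c k • orthoSeq B X e k) =
      ∑ k ∈ Finset.range n, c k ^ 2 * B (orthoSeq B X e k) (orthoSeq B X e k) := by
  induction n with
  | zero => simp
  | succ n ih =>
    have h0 : B (orthoSeq B X e n) (∑ k ∈ Finset.range n, c k • orthoSeq B X e k) = 0 := by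
      rw [map_sum]
      refine Finset.sum_eq_zero fun k hk => ?_
      rw [map_smul, apply_orthoSeq_of_lt hX hJB hJX hJe n (fun k _ => hn k) k
        (Finset.mem_range.1 hk), smul_zero]
    rw [Finset.sum_range_succ, Finset.sum_range_succ, ← ih]
    simp only [map_add, LinearMap.add_apply, map_smul, LinearMap.smul_apply, smul_eq_mul]
    rw [hB (∑ k ∈ Finset.range n, c k • orthoSeq B X e k) (orthoSeq B X e n), h0]
    ring

/-- A Carleman type criterion for a functional on the Krylov space of `X` and `e` to be unbounded
with respect to the seminorm of `B`. -/
theorem exists_functional_eq_one_apply_self_lt {l : V →ₗ[ℝ] ℝ}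
    (hB : ∀ u v, B u v = B v u) (hpos : ∀ v, 0 ≤ B v v)
    (hX : ∀ u v, B (X u) v = B u (X v)) (hJB : ∀ u v, B (J u) (J v) = B u v)
    (hJX : ∀ v, J (X v) = -X (J v)) (hJe : J e = e) (hl : ∀ v, l (X v) = l (J v))
    (hle : l e = 1)
    (hdiv : (∀ n, 0 < B ((X ^ n) e) ((X ^ n) e)) → ∀ M : ℝ, ∃ N : ℕ,
      M < ∑ n ∈ Finset.range N,
        B ((X ^ (n + 1)) e) ((X ^ (n + 1)) e) ^ (-(1 / (2 * ((n : ℝ) + 1)))))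
    {ε : ℝ} (hε : 0 < ε) : ∃ w, l w = 1 ∧ B w w < ε := by
  classical
  set h : ℕ → ℝ := fun n => B (orthoSeq B X e n) (orthoSeq B X e n) with hh
  set K : ℕ → ℝ := fun n => ∑ k ∈ Finset.range (n + 1), l (orthoSeq B X e k) ^ 2 / h k with hK
  have hl0 : l (orthoSeq B X e 0) = 1 := hle
  by_cases hz : ∃ n, h n = 0
  · have hmin : ∀ k < Nat.find hz, h k ≠ 0 := fun k hk => Nat.find_min hz hk
    have h0 : h (Nat.find hz) = 0 := Nat.find_spec hz
    generalize Nat.find hz = n at hmin h0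
    have hG : l (orthoSeq B X e n) ≠ 0 := by
      match n with
      | 0 => rw [hl0]; exact one_ne_zero
      | n + 1 =>
        intro hG
        have h1 := christoffel_darboux_orthoSeq (B := B) hJX hJe hl hle n
          fun k hk => hmin k (by omega)
        rw [hG, mul_zero, mul_zero, eq_comm, mul_eq_zero] at h1
        rcases h1 with h1 | h1
        · exact hmin n (by omega) h1
        · rw [Finset.sum_eq_zero_iff_of_nonneg
            (fun k _ => div_nonneg (sq_nonneg _) (hpos _))] at h1
          have h2 := h1 0 (by simp)
          rw [hl0] at h2
          have := hmin 0 (by omega)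
          simp only [hh] at this
          simp [this] at h2
    refine ⟨(l (orthoSeq B X e n))⁻¹ • orthoSeq B X e n, ?_, ?_⟩
    · rw [map_smul, smul_eq_mul, inv_mul_cancel₀ hG]
    · simp only [hh] at h0
      simpa [h0] using hε
  · push Not at hz
    have hp : ∀ n, 0 < h n := fun n => lt_of_le_of_ne (hpos _) (hz n).symm
    have hterm : ∀ k, 0 ≤ l (orthoSeq B X e k) ^ 2 / h k := fun k =>
      div_nonneg (sq_nonneg _) (hp k).le
    have hK0 : ∀ n, 1 / h 0 ≤ K n := fun n => by
      have := Finset.single_le_sum (fun k _ => hterm k)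
        (Finset.mem_range.2 (Nat.succ_pos n))
      rw [hl0, one_pow] at this
      exact this
    have hKpos : ∀ n, 0 < K n := fun n => lt_of_lt_of_le (by have := hp 0; positivity) (hK0 n)
    by_contra! hcon
    have hKM : ∀ n, K n ≤ 1 / ε := by
      intro n
      have h1 := hcon ((K n)⁻¹ • ∑ k ∈ Finset.range (n + 1),
        (l (orthoSeq B X e k) / h k) • orthoSeq B X e k) (by
          rw [map_smul, map_sum, smul_eq_mul, inv_mul_eq_one₀ (hKpos n).ne']
          refine Finset.sum_congr rfl fun k _ => ?_
          rw [map_smul, smul_eq_mul]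
          ring)
      rw [map_smul, map_smul, LinearMap.smul_apply, apply_sum_smul_orthoSeq hB hX hJB hJX hJe hz]
        at h1
      have h2 : ∑ k ∈ Finset.range (n + 1), (l (orthoSeq B X e k) / h k) ^ 2 * h k = K n := by
        refine Finset.sum_congr rfl fun k _ => ?_
        have := hz k
        field_simp
      simp only [hh] at h2
      rw [h2, smul_eq_mul, smul_eq_mul, inv_mul_cancel₀ (hKpos n).ne', mul_one] at h1
      rw [le_div_iff₀ hε]
      calc K n * ε ≤ K n * (K n)⁻¹ := mul_le_mul_of_nonneg_left h1 (hKpos n).le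
        _ = 1 := mul_inv_cancel₀ (hKpos n).ne'
    set g : ℕ → ℝ := fun k => l (orthoSeq B X e k) ^ 2 / h k with hg
    have hratio : ∀ n, √(h n / h (n + 1)) ≤ h 0 * ((g n + g (n + 1)) / 2) := by
      intro n
      have hq : 0 ≤ (g n + g (n + 1)) / 2 := by
        have := hterm n; have := hterm (n + 1); positivity
      rw [Real.sqrt_le_left (mul_nonneg (hp 0).le hq), mul_pow]
      have h1 := christoffel_darboux_orthoSeq (B := B) hJX hJe hl hle n fun k _ => hz k
      have h2 : (h n * K n) ^ 2 = (g n * h n) * (g (n + 1) * h (n + 1)) := by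
        have : h n * K n = (-1) ^ n * (l (orthoSeq B X e n) * l (orthoSeq B X e (n + 1))) :=
          h1.symm
        rw [this, mul_pow, ← pow_mul, mul_comm n 2, pow_mul]
        simp only [hg]
        rw [div_mul_cancel₀ _ (hz n), div_mul_cancel₀ _ (hz (n + 1))]
        ring
      have h3 : h n / h (n + 1) = g n * g (n + 1) / (K n) ^ 2 := by
        rw [div_eq_div_iff (hz _) (pow_ne_zero 2 (hKpos n).ne')]
        apply mul_left_cancel₀ (hz n)
        linear_combination h2
      rw [h3, div_le_iff₀ (pow_pos (hKpos n) 2)]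
      have h4 : 1 ≤ h 0 * K n := by
        have := hK0 n
        rwa [div_le_iff₀' (hp 0)] at this
      have h5 : 1 ≤ (h 0 * K n) ^ 2 := one_le_pow₀ h4
      calc g n * g (n + 1) ≤ ((g n + g (n + 1)) / 2) ^ 2 := by
            nlinarith [sq_nonneg (g n - g (n + 1))]
        _ ≤ (h 0 * K n) ^ 2 * ((g n + g (n + 1)) / 2) ^ 2 :=
            le_mul_of_one_le_left (sq_nonneg _) h5
        _ = _ := by ring
    have hsumle : ∀ N, ∑ n ∈ Finset.range N, √(h n / h (n + 1)) ≤ h 0 * (1 / ε) := by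
      intro N
      calc _ ≤ ∑ n ∈ Finset.range N, h 0 * ((g n + g (n + 1)) / 2) :=
            Finset.sum_le_sum fun n _ => hratio n
        _ = h 0 * ((∑ n ∈ Finset.range N, g n + ∑ n ∈ Finset.range N, g (n + 1)) / 2) := by
            rw [← Finset.mul_sum, ← Finset.sum_div, Finset.sum_add_distrib]
        _ ≤ h 0 * (1 / ε) := by
            have h1 : ∑ n ∈ Finset.range N, g n ≤ K N := by
              simp only [hK]
              rw [Finset.sum_range_succ]
              linarith [hterm N]
            have h2 : ∑ n ∈ Finset.range N, g (n + 1) ≤ K N := by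
              simp only [hK]
              rw [Finset.sum_range_succ']
              linarith [hterm 0]
            exact mul_le_mul_of_nonneg_left (by linarith [hKM N]) (hp 0).le
    have hprod : ∀ n, ∏ k ∈ Finset.range n, √(h k / h (k + 1)) = √(h 0 / h n) := by
      intro n
      induction n with
      | zero => simp [div_self (hz 0)]
      | succ n ih =>
        rw [Finset.prod_range_succ, ih, ← Real.sqrt_mul (div_pos (hp _) (hp _)).le,
          div_mul_div_cancel₀ (hz n)]
    have hsle := apply_orthoSeq_self_le hB hpos hX hJB hJX hJe
    set c := min 1 (h 0) with hc
    have hcpos : 0 < c := lt_min one_pos (hp 0)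
    obtain ⟨N, hN⟩ := hdiv
      (fun n => lt_of_lt_of_le (hp n) (hsle n fun k _ => hz k))
      (c⁻¹ * (Real.exp 1 * (h 0 * (1 / ε))))
    refine absurd hN (not_lt.2 ?_)
    have hcar := (Real.carleman_inequality (fun n => √(h n / h (n + 1)))
      (fun n => Real.sqrt_nonneg _) N).trans
      (mul_le_mul_of_nonneg_left (hsumle N) (Real.exp_pos 1).le)
    refine le_trans ?_ (mul_le_mul_of_nonneg_left hcar (inv_nonneg.2 hcpos.le))
    rw [Finset.mul_sum]
    refine Finset.sum_le_sum fun n _ => ?_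
    rw [hprod, Real.sqrt_eq_rpow, ← Real.rpow_mul (div_pos (hp _) (hp _)).le,
      Real.div_rpow (hp _).le (hp _).le, ← div_eq_inv_mul, div_div, le_div_iff₀
      (mul_pos (Real.rpow_pos_of_pos (hp _) _) hcpos)]
    have hpe : (1 / 2 * (1 / ((n : ℝ) + 1))) = 1 / (2 * ((n : ℝ) + 1)) := by
      rw [div_mul_div_comm, one_mul]
    rw [hpe]
    set p := 1 / (2 * ((n : ℝ) + 1)) with hpdef
    have hp0 : 0 ≤ p := by positivity
    have hp1 : p ≤ 1 := by
      rw [hpdef, div_le_one (by positivity)]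
      have : (0 : ℝ) ≤ n := Nat.cast_nonneg n
      linarith
    have hch : c ≤ h 0 ^ p := by
      rcases le_total 1 (h 0) with h1 | h1
      · exact (min_le_left _ _).trans (Real.one_le_rpow h1 hp0)
      · refine (min_le_right _ _).trans ?_
        calc h 0 = h 0 ^ (1 : ℝ) := (Real.rpow_one _).symm
          _ ≤ h 0 ^ p := Real.rpow_le_rpow_of_exponent_ge (hp 0) h1 hp1
    have hs : B ((X ^ (n + 1)) e) ((X ^ (n + 1)) e) ^ (-p) ≤ h (n + 1) ^ (-p) :=
      Real.rpow_le_rpow_of_nonpos (hp _) (hsle _ fun k _ => hz k) (by linarith)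
    calc _ ≤ h (n + 1) ^ (-p) * (h (n + 1) ^ p * c) :=
          mul_le_mul_of_nonneg_right hs
            (mul_nonneg (Real.rpow_nonneg (hp _).le _) hcpos.le)
      _ = c := by
          rw [← mul_assoc, ← Real.rpow_add (hp _), neg_add_cancel, Real.rpow_zero, one_mul]
      _ ≤ _ := hch

end Krylov

theorem sq_apply_mul_le {A : Type*} [CommRing A] [Algebra ℝ A] (L : A →ₗ[ℝ] ℝ) (c : A)
    (h : ∀ p : A, 0 ≤ L (c * p ^ 2)) (a b : A) :
    L (c * (a * b)) ^ 2 ≤ L (c * a ^ 2) * L (c * b ^ 2) := by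
  have key : ∀ t : ℝ, 0 ≤ L (c * b ^ 2) * (t * t) + 2 * L (c * (a * b)) * t + L (c * a ^ 2) := by
    intro t
    have h1 := h (a + t • b)
    have h2 : c * (a + t • b) ^ 2 = c * a ^ 2 + (2 * t) • (c * (a * b)) + (t * t) • (c * b ^ 2) := by
      simp only [Algebra.smul_def, map_mul, map_ofNat]
      ring
    rw [h2, map_add, map_add, map_smul, map_smul, smul_eq_mul, smul_eq_mul] at h1
    linarith
  have := discrim_le_zero key
  rw [discrim] at this
  nlinarith

theorem Real.inv_max_le_rpow_neg {c p : ℝ} (hc : 0 < c) (hp0 : 0 ≤ p) (hp1 : p ≤ 1) :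
    (max 1 c)⁻¹ ≤ c ^ (-p) := by
  rw [Real.rpow_neg hc.le]
  apply inv_anti₀ (Real.rpow_pos_of_pos hc _)
  rcases le_total 1 c with h | h
  · refine le_trans ?_ (le_max_right _ _)
    calc c ^ p ≤ c ^ (1 : ℝ) := Real.rpow_le_rpow_of_exponent_le h hp1
      _ = c := Real.rpow_one c
  · exact (Real.rpow_le_one hc.le h hp0).trans (le_max_left _ _)

theorem pow_succ_le_pow_mul_of_logConvex {m : ℕ → ℝ} (hm : ∀ n, 0 < m n)
    (hconv : ∀ n, m (n + 1) ^ 2 ≤ m n * m (n + 2)) (n : ℕ) :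
    m n ^ (n + 1) ≤ m (n + 1) ^ n * m 0 := by
  induction n with
  | zero => simp
  | succ n ih =>
    have h1 : (m (n + 1) ^ 2) ^ (n + 1) ≤ (m n * m (n + 2)) ^ (n + 1) := by
      have := hm (n + 1)
      gcongr
      exact hconv n
    have h2 : m (n + 1) ^ n * m (n + 1) ^ (n + 2) ≤
        m (n + 1) ^ n * (m (n + 2) ^ (n + 1) * m 0) := by
      calc _ = (m (n + 1) ^ 2) ^ (n + 1) := by ring
        _ ≤ (m n * m (n + 2)) ^ (n + 1) := h1
        _ = m n ^ (n + 1) * m (n + 2) ^ (n + 1) := mul_pow _ _ _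
        _ ≤ (m (n + 1) ^ n * m 0) * m (n + 2) ^ (n + 1) :=
            mul_le_mul_of_nonneg_right ih (pow_nonneg (hm _).le _)
        _ = _ := by ring
    exact le_of_mul_le_mul_left h2 (pow_pos (hm _) _)

theorem rpow_succ_le_of_logConvex {m : ℕ → ℝ} (hm : ∀ n, 0 < m n)
    (hconv : ∀ n, m (n + 1) ^ 2 ≤ m n * m (n + 2)) (n : ℕ) :
    m (n + 2) ^ (-(1 / (2 * ((n : ℝ) + 2)))) ≤
      max 1 (m 0) * m (n + 1) ^ (-(1 / (2 * ((n : ℝ) + 1)))) := by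
  have h := pow_succ_le_pow_mul_of_logConvex hm hconv (n + 1)
  set p : ℝ := 1 / (2 * ((n : ℝ) + 1) * ((n : ℝ) + 2)) with hp
  have hp0 : 0 ≤ p := by positivity
  have hp1 : p ≤ 1 := by
    rw [hp, div_le_one (by positivity)]
    have : (0 : ℝ) ≤ n := Nat.cast_nonneg n
    nlinarith
  have h1 := Real.rpow_le_rpow_of_nonpos (pow_pos (hm (n + 1)) (n + 1 + 1)) h
    (by linarith : -p ≤ 0)
  rw [Real.mul_rpow (pow_nonneg (hm _).le _) (hm 0).le, ← Real.rpow_natCast, ← Real.rpow_natCast,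
    ← Real.rpow_mul (hm _).le, ← Real.rpow_mul (hm _).le] at h1
  have e1 : ((n + 1 + 1 : ℕ) : ℝ) * -p = -(1 / (2 * ((n : ℝ) + 1))) := by
    rw [hp]; push_cast; field_simp; ring
  have e2 : ((n + 1 : ℕ) : ℝ) * -p = -(1 / (2 * ((n : ℝ) + 2))) := by
    rw [hp]; push_cast; field_simp
  rw [e1, e2] at h1
  have h2 := Real.inv_max_le_rpow_neg (hm 0) hp0 hp1
  have hpos : 0 < m (n + 2) ^ (-(1 / (2 * ((n : ℝ) + 2)))) := Real.rpow_pos_of_pos (hm _) _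
  have h3 := (mul_le_mul_of_nonneg_left h2 hpos.le).trans h1
  have hmax : 0 < max 1 (m 0) := lt_max_of_lt_left one_pos
  rwa [← div_eq_mul_inv, div_le_iff₀' hmax] at h3

theorem sum_rpow_unbounded_of_logConvex {m s : ℕ → ℝ} (hm : ∀ n, 0 < m n)
    (hconv : ∀ n, m (n + 1) ^ 2 ≤ m n * m (n + 2)) {C : ℝ} (hC : 0 < C) (hs : ∀ n, 0 < s n)
    (hsm : ∀ n, s n ^ 2 ≤ C * m (2 * n))
    (hdiv : ∀ M : ℝ, ∃ N : ℕ,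
      M < ∑ n ∈ Finset.range N, m (n + 1) ^ (-(1 / (2 * ((n : ℝ) + 1))))) (M : ℝ) :
    ∃ N : ℕ, M < ∑ n ∈ Finset.range N, s (n + 1) ^ (-(1 / (2 * ((n : ℝ) + 1)))) := by
  set u : ℕ → ℝ := fun n => m (n + 1) ^ (-(1 / (2 * ((n : ℝ) + 1)))) with hu
  have hu0 : ∀ n, 0 ≤ u n := fun n => Real.rpow_nonneg (hm _).le _
  set D := max 1 (m 0)
  have hD : 0 < D := lt_max_of_lt_left one_pos
  set E := (max 1 C)⁻¹
  have hE : 0 < E := inv_pos.2 (lt_max_of_lt_left one_pos)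
  have hstep : ∀ n, u (n + 1) ≤ D * u n := fun n => by
    have := rpow_succ_le_of_logConvex hm hconv n
    simp only [hu]
    push_cast
    rwa [show (n : ℝ) + 1 + 1 = n + 2 by ring]
  have hsu : ∀ n : ℕ, E * u (2 * n + 1) ≤ s (n + 1) ^ (-(1 / (2 * ((n : ℝ) + 1)))) := by
    intro n
    set p : ℝ := 1 / (4 * ((n : ℝ) + 1)) with hp
    have hp0 : 0 ≤ p := by positivity
    have hp1 : p ≤ 1 := by
      rw [hp, div_le_one (by positivity)]
      have : (0 : ℝ) ≤ n := Nat.cast_nonneg n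
      nlinarith
    have h1 := Real.rpow_le_rpow_of_nonpos (pow_pos (hs (n + 1)) 2) (hsm (n + 1))
      (by linarith : -p ≤ 0)
    rw [Real.mul_rpow hC.le (hm _).le, ← Real.rpow_natCast, ← Real.rpow_mul (hs _).le] at h1
    have e1 : ((2 : ℕ) : ℝ) * -p = -(1 / (2 * ((n : ℝ) + 1))) := by
      rw [hp]; push_cast; field_simp; norm_num
    rw [e1] at h1
    refine le_trans ?_ h1
    have e2 : m (2 * (n + 1)) ^ (-p) = u (2 * n + 1) := by
      simp only [hu, hp]
      congr 3
      push_cast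
      ring
    rw [e2]
    exact mul_le_mul_of_nonneg_right (Real.inv_max_le_rpow_neg hC hp0 hp1) (hu0 _)
  have hsplit : ∀ N : ℕ, ∑ n ∈ Finset.range (2 * N + 1), u n ≤
      u 0 + (1 + D) * ∑ n ∈ Finset.range N, u (2 * n + 1) := by
    intro N
    induction N with
    | zero => simp
    | succ N ih =>
      rw [show 2 * (N + 1) + 1 = 2 * N + 1 + 1 + 1 by ring, Finset.sum_range_succ,
        Finset.sum_range_succ, Finset.sum_range_succ _ N]
      have := hstep (2 * N + 1)
      linarith
  obtain ⟨N, hN⟩ := hdiv (u 0 + (1 + D) * (E⁻¹ * M))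
  refine ⟨N, ?_⟩
  have h1 : ∑ n ∈ Finset.range N, u n ≤ ∑ n ∈ Finset.range (2 * N + 1), u n :=
    Finset.sum_le_sum_of_subset_of_nonneg (Finset.range_mono (by omega)) fun n _ _ => hu0 n
  have h2 : E⁻¹ * M < ∑ n ∈ Finset.range N, u (2 * n + 1) := by
    have := hN.trans_le (h1.trans (hsplit N))
    have h3 : (1 + D) * (E⁻¹ * M) < (1 + D) * ∑ n ∈ Finset.range N, u (2 * n + 1) := by linarith
    exact lt_of_mul_lt_mul_left h3 (by linarith)
  rw [inv_mul_lt_iff₀ hE, Finset.mul_sum] at h2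
  exact h2.trans_le (Finset.sum_le_sum fun n _ => hsu n)

theorem ENNReal.sum_rpow_unbounded_of_tsum_eq_top {m : ℕ → ℝ} (hm : ∀ n, 0 < m n)
    {p : ℕ → ℝ} (h : ∑' n : ℕ, ENNReal.ofReal (m n) ^ p n = ⊤) (M : ℝ) :
    ∃ N : ℕ, M < ∑ n ∈ Finset.range N, m n ^ p n := by
  by_contra! hcon
  refine absurd h (ne_of_lt ?_)
  refine lt_of_le_of_lt (ENNReal.tsum_le_of_sum_range_le (c := ENNReal.ofReal M) fun N => ?_)
    ENNReal.ofReal_lt_top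
  calc ∑ n ∈ Finset.range N, ENNReal.ofReal (m n) ^ p n
      = ∑ n ∈ Finset.range N, ENNReal.ofReal (m n ^ p n) :=
        Finset.sum_congr rfl fun n _ => ENNReal.ofReal_rpow_of_pos (hm n)
    _ = ENNReal.ofReal (∑ n ∈ Finset.range N, m n ^ p n) :=
        (ENNReal.ofReal_sum_of_nonneg fun n _ => Real.rpow_nonneg (hm n).le _).symm
    _ ≤ _ := ENNReal.ofReal_le_ofReal (hcon N)

section Approximation

variable {A : Type*} [CommRing A] [Algebra ℝ A] (L : A →ₗ[ℝ] ℝ)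

theorem exists_apply_one_sub_mul_sq_lt_of_unbounded {f g : A} (hsq : ∀ p : A, 0 ≤ L (p ^ 2))
    (hfsq : ∀ p : A, 0 ≤ L (f * p ^ 2))
    (hdiv : (∀ n, 0 < L (g ^ 2 * (1 + f) * f ^ n)) → ∀ M : ℝ, ∃ N : ℕ,
      M < ∑ n ∈ Finset.range N,
        L (g ^ 2 * (1 + f) * f ^ (n + 1)) ^ (-(1 / (2 * ((n : ℝ) + 1)))))
    {ε : ℝ} (hε : 0 < ε) : ∃ q : A, L (g ^ 2 * (1 - (1 + f) * q) ^ 2) < ε := by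
  let Φ : Polynomial ℝ →ₗ[ℝ] ℝ :=
    L ∘ₗ LinearMap.mulLeft ℝ (g ^ 2 * (1 + f)) ∘ₗ (Polynomial.aeval f).toLinearMap
  have hΦ : ∀ p, Φ p = L (g ^ 2 * (1 + f) * Polynomial.aeval f p) := fun p => rfl
  let X : Polynomial ℝ × Polynomial ℝ →ₗ[ℝ] Polynomial ℝ × Polynomial ℝ :=
    (LinearMap.mulLeft ℝ Polynomial.X ∘ₗ LinearMap.snd ℝ _ _).prod (LinearMap.fst ℝ _ _)
  have hXd : ∀ w, X w = (Polynomial.X * w.2, w.1) := fun w => rfl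
  let J : Polynomial ℝ × Polynomial ℝ →ₗ[ℝ] Polynomial ℝ × Polynomial ℝ :=
    (LinearMap.fst ℝ _ _).prod (-LinearMap.snd ℝ _ _)
  have hJd : ∀ w, J w = (w.1, -w.2) := fun w => rfl
  let l : Polynomial ℝ × Polynomial ℝ →ₗ[ℝ] ℝ :=
    (Polynomial.leval (-1)).coprod (Polynomial.leval (-1))
  have hld : ∀ w, l w = w.1.eval (-1) + w.2.eval (-1) := fun w => rfl
  let B : Polynomial ℝ × Polynomial ℝ →ₗ[ℝ] Polynomial ℝ × Polynomial ℝ →ₗ[ℝ] ℝ :=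
    LinearMap.mk₂ ℝ (fun w z => Φ (w.1 * z.1 + Polynomial.X * (w.2 * z.2)))
      (fun w w' z => by
        rw [← map_add]; congr 1; simp only [Prod.fst_add, Prod.snd_add]; ring)
      (fun c w z => by
        rw [← map_smul]; congr 1
        simp only [Prod.smul_fst, Prod.smul_snd, Polynomial.smul_eq_C_mul]; ring)
      (fun w z z' => by
        rw [← map_add]; congr 1; simp only [Prod.fst_add, Prod.snd_add]; ring)
      (fun c w z => by
        rw [← map_smul]; congr 1
        simp only [Prod.smul_fst, Prod.smul_snd, Polynomial.smul_eq_C_mul]; ring)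
  have hBd : ∀ w z, B w z = Φ (w.1 * z.1 + Polynomial.X * (w.2 * z.2)) := fun w z => rfl
  have hB : ∀ u v, B u v = B v u := fun u v => by
    rw [hBd, hBd]; congr 1; ring
  have hX : ∀ u v, B (X u) v = B u (X v) := fun u v => by
    rw [hBd, hBd, hXd, hXd]; congr 1; ring
  have hpow : ∀ n u v, B ((X ^ n) u) v = B u ((X ^ n) v) := by
    intro n
    induction n with
    | zero => intro u v; simp
    | succ n ih => intro u v; rw [pow_succ, Module.End.mul_apply, ih, hX, ← Module.End.mul_apply,
        ← pow_succ', pow_succ]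
  have hpow2 : ∀ n : ℕ, (X ^ n) ((X ^ n) ((1, 0) : Polynomial ℝ × Polynomial ℝ)) =
      (Polynomial.X ^ n, 0) := by
    intro n
    rw [← Module.End.mul_apply, ← pow_add, ← two_mul]
    induction n with
    | zero => simp
    | succ n ih =>
      rw [mul_add, mul_one, add_comm, pow_add, Module.End.mul_apply, ih, pow_two,
        Module.End.mul_apply, hXd, hXd]
      simp [pow_succ']
  have hs : ∀ n : ℕ, B ((X ^ n) (1, 0)) ((X ^ n) (1, 0)) = L (g ^ 2 * (1 + f) * f ^ n) := by
    intro n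
    rw [hpow, hpow2, hBd, hΦ]
    simp
  obtain ⟨w, hw1, hw⟩ := exists_functional_eq_one_apply_self_lt (B := B) (X := X) (J := J)
    (e := (1, 0)) (l := l) hB (fun w => by
      rw [hBd, hΦ]
      have h1 := hsq (g * Polynomial.aeval f w.1)
      have h2 := hfsq (g * Polynomial.aeval f w.1)
      have h3 := hfsq (g * Polynomial.aeval f w.2)
      have h4 := hsq (g * f * Polynomial.aeval f w.2)
      have : g ^ 2 * (1 + f) * Polynomial.aeval f (w.1 * w.1 + Polynomial.X * (w.2 * w.2)) =
          (g * Polynomial.aeval f w.1) ^ 2 + f * (g * Polynomial.aeval f w.1) ^ 2 +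
          f * (g * Polynomial.aeval f w.2) ^ 2 + (g * f * Polynomial.aeval f w.2) ^ 2 := by
        simp only [map_add, map_mul, Polynomial.aeval_X]
        ring
      rw [this, map_add, map_add, map_add]
      positivity) hX
    (fun u v => by rw [hBd, hBd, hJd, hJd]; congr 1; ring)
    (fun v => by rw [hJd, hXd, hXd, hJd]; simp)
    (by rw [hJd]; simp) (fun v => by rw [hld, hld, hXd, hJd]; simp; ring)
    (by rw [hld]; simp) (by simpa only [hs] using hdiv) (half_pos hε)
  set a := Polynomial.aeval f w.1 with ha
  set b := Polynomial.aeval f w.2 with hb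
  have hroot : (1 - (w.1 - Polynomial.X * w.2)).IsRoot (-1) := by
    rw [hld] at hw1
    simp only [Polynomial.IsRoot, Polynomial.eval_sub, Polynomial.eval_mul, Polynomial.eval_X,
      Polynomial.eval_one]
    linarith
  obtain ⟨q, hq⟩ := Polynomial.dvd_iff_isRoot.2 hroot
  refine ⟨Polynomial.aeval f q, ?_⟩
  have hq' := congrArg (Polynomial.aeval f) hq
  simp only [map_sub, map_mul, map_one, Polynomial.aeval_X, map_neg] at hq'
  have h1 : 1 - (1 + f) * Polynomial.aeval f q = a - f * b := by
    linear_combination hq'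
  rw [h1]
  rw [hBd, hΦ] at hw
  have h2 : g ^ 2 * (1 + f) * Polynomial.aeval f (w.1 * w.1 + Polynomial.X * (w.2 * w.2)) +
      g ^ 2 * (1 + f) * Polynomial.aeval f (w.1 * w.1 + Polynomial.X * (w.2 * w.2)) =
      g ^ 2 * (a - f * b) ^ 2 + (g * (a + f * b)) ^ 2 + f * (g * a) ^ 2 + f * (g * a) ^ 2 +
        f * (g * b) ^ 2 + f * (g * b) ^ 2 := by
    simp only [map_add, map_mul, Polynomial.aeval_X, ← ha, ← hb]
    ring
  have h3 := congrArg L h2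
  simp only [map_add] at h3
  simp only [map_add] at hw
  have := hsq (g * (a + f * b))
  have := hfsq (g * a)
  have := hfsq (g * b)
  linarith

theorem exists_apply_one_sub_mul_sq_lt {f : A} (hsq : ∀ p : A, 0 ≤ L (p ^ 2))
    (hfsq : ∀ p : A, 0 ≤ L (f * p ^ 2))
    (hst : ∑' n : ℕ,
      (ENNReal.ofReal (L (f ^ (n + 1)))) ^ (-(1 / (2 * ((n : ℝ) + 1)))) = ⊤)
    (g : A) {ε : ℝ} (hε : 0 < ε) : ∃ q : A, L (g ^ 2 * (1 - (1 + f) * q) ^ 2) < ε := by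
  refine exists_apply_one_sub_mul_sq_lt_of_unbounded L hsq hfsq (fun hs => ?_) hε
  have hconv : ∀ n, L (f ^ (n + 1)) ^ 2 ≤ L (f ^ n) * L (f ^ (n + 2)) := by
    intro n
    rcases Nat.even_or_odd' n with ⟨k, rfl | rfl⟩
    · have := sq_apply_mul_le L 1 (by simpa using hsq) (f ^ k) (f ^ (k + 1))
      rw [one_mul, one_mul, one_mul] at this
      convert this using 3 <;> ring
    · have := sq_apply_mul_le L f hfsq (f ^ k) (f ^ (k + 1))
      convert this using 3 <;> ring
  have hsm : ∀ n, L (g ^ 2 * (1 + f) * f ^ n) ^ 2 ≤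
      L ((g ^ 2 * (1 + f)) ^ 2) * L (f ^ (2 * n)) := by
    intro n
    have := sq_apply_mul_le L 1 (by simpa using hsq) (g ^ 2 * (1 + f)) (f ^ n)
    rw [one_mul, one_mul, one_mul] at this
    convert this using 3
    ring
  have hC : 0 < L ((g ^ 2 * (1 + f)) ^ 2) := lt_of_le_of_ne (hsq _) fun h => by
    have := hsm 0
    rw [← h, zero_mul] at this
    exact absurd this (not_le.2 (pow_pos (hs 0) 2))
  have heven : ∀ n, 0 < L (f ^ (2 * n)) := fun n =>
    pos_of_mul_pos_right ((pow_pos (hs n) 2).trans_le (hsm n)) hC.le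
  have hm : ∀ n, 0 < L (f ^ n) := by
    intro n
    rcases Nat.even_or_odd' n with ⟨k, rfl | rfl⟩
    · exact heven k
    · have h1 := hconv (2 * k + 1)
      have h2 : 0 < L (f ^ (2 * k + 1 + 1)) := heven (k + 1)
      have h3 : 0 < L (f ^ (2 * k + 1)) * L (f ^ (2 * k + 1 + 2)) := (pow_pos h2 2).trans_le h1
      refine lt_of_le_of_ne ?_ fun h => by rw [← h, zero_mul] at h3; exact lt_irrefl _ h3
      have := hfsq (f ^ k)
      rwa [show f * (f ^ k) ^ 2 = f ^ (2 * k + 1) by ring] at this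
  exact sum_rpow_unbounded_of_logConvex (m := fun n => L (f ^ n)) hm hconv hC hs hsm
    (ENNReal.sum_rpow_unbounded_of_tsum_eq_top (fun n => hm (n + 1)) hst)

theorem exists_apply_one_sub_mul_sq_lt_of_mem_closure {T : Set A} (hsq : ∀ p : A, 0 ≤ L (p ^ 2))
    (hT : ∀ t ∈ T, ∀ g : A, ∀ ε > 0, ∃ q : A, L (g ^ 2 * (1 - t * q) ^ 2) < ε)
    {G : A} (hG : G ∈ Submonoid.closure T) :
    ∀ g : A, ∀ ε > 0, ∃ q : A, L (g ^ 2 * (1 - G * q) ^ 2) < ε := by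
  induction hG using Submonoid.closure_induction with
  | mem t ht => exact hT t ht
  | one => exact fun g ε hε => ⟨1, by simpa using hε⟩
  | mul G₁ G₂ _ _ h₁ h₂ =>
    intro g ε hε
    obtain ⟨q₁, hq₁⟩ := h₁ g (ε / 4) (by linarith)
    obtain ⟨q₂, hq₂⟩ := h₂ (g * (G₁ * q₁)) (ε / 4) (by linarith)
    refine ⟨q₁ * q₂, ?_⟩
    have h : g ^ 2 * (1 - G₁ * G₂ * (q₁ * q₂)) ^ 2 +
        (g * ((1 - G₁ * q₁) - G₁ * q₁ * (1 - G₂ * q₂))) ^ 2 =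
        g ^ 2 * (1 - G₁ * q₁) ^ 2 + g ^ 2 * (1 - G₁ * q₁) ^ 2 +
        ((g * (G₁ * q₁)) ^ 2 * (1 - G₂ * q₂) ^ 2 + (g * (G₁ * q₁)) ^ 2 * (1 - G₂ * q₂) ^ 2) := by
      ring
    have h' := congrArg L h
    simp only [map_add] at h'
    have := hsq (g * ((1 - G₁ * q₁) - G₁ * q₁ * (1 - G₂ * q₂)))
    linarith

end Approximation

/-- The M. Riesz extension theorem for a functional given along a linear map. -/
theorem PointedCone.exists_extension {W E : Type*} [AddCommGroup W] [Module ℝ W] [AddCommGroup E]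
    [Module ℝ E] (s : PointedCone ℝ E) (T : W →ₗ[ℝ] E) (l : W →ₗ[ℝ] ℝ)
    (nonneg : ∀ w, T w ∈ s → 0 ≤ l w) (dense : ∀ y, ∃ w, T w + y ∈ s) :
    ∃ g : E →ₗ[ℝ] ℝ, (∀ w, g (T w) = l w) ∧ ∀ x ∈ s, 0 ≤ g x := by
  have hker : T.ker ≤ l.ker := by
    intro w hw
    rw [LinearMap.mem_ker] at hw ⊢
    refine le_antisymm ?_ (nonneg w (by rw [hw]; exact zero_mem s))
    have := nonneg (-w) (by rw [map_neg, hw, neg_zero]; exact zero_mem s)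
    rw [map_neg] at this
    linarith
  let φ : E →ₗ.[ℝ] ℝ := ⟨T.range, T.ker.liftQ l hker ∘ₗ T.quotKerEquivRange.symm.toLinearMap⟩
  have hφ : ∀ w, φ ⟨T w, LinearMap.mem_range_self T w⟩ = l w := by
    intro w
    change T.ker.liftQ l hker (T.quotKerEquivRange.symm ⟨T w, LinearMap.mem_range_self T w⟩) = l w
    rw [LinearMap.quotKerEquivRange_symm_apply_image]
    simp
  obtain ⟨g, hg, hs⟩ := riesz_extension s φ
    (by
      rintro ⟨_, w, rfl⟩ hw
      rw [hφ]
      exact nonneg w hw)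
    (fun y => by
      obtain ⟨w, hw⟩ := dense y
      exact ⟨⟨T w, LinearMap.mem_range_self T w⟩, hw⟩)
  exact ⟨g, fun w => (hg ⟨T w, LinearMap.mem_range_self T w⟩).trans (hφ w), hs⟩

section QuadraticModule

variable {ι A : Type*} [CommRing A] [Algebra ℝ A]

/-- The quadratic module generated by a family. -/
def quadraticModule (f : ι → A) : PointedCone ℝ A :=
  PointedCone.hull ℝ ({x | ∃ b, x = b ^ 2} ∪ {x | ∃ j b, x = f j * b ^ 2})

theorem sq_mem_quadraticModule (f : ι → A) (b : A) : b ^ 2 ∈ quadraticModule f :=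
  Submodule.subset_span (Or.inl ⟨b, rfl⟩)

theorem mul_sq_mem_quadraticModule (f : ι → A) (j : ι) (b : A) :
    f j * b ^ 2 ∈ quadraticModule f :=
  Submodule.subset_span (Or.inr ⟨j, b, rfl⟩)

theorem sq_mul_mem_quadraticModule {f : ι → A} (a : A) {x : A} (hx : x ∈ quadraticModule f) :
    a ^ 2 * x ∈ quadraticModule f := by
  induction hx using Submodule.span_induction with
  | mem x hx =>
    rcases hx with ⟨b, rfl⟩ | ⟨j, b, rfl⟩
    · rw [← mul_pow]; exact sq_mem_quadraticModule f _
    · rw [mul_left_comm, ← mul_pow]; exact mul_sq_mem_quadraticModule f _ _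
  | zero => rw [mul_zero]; exact zero_mem _
  | add x y _ _ hx hy => rw [mul_add]; exact add_mem hx hy
  | smul c x _ hx =>
    rw [mul_smul_comm]
    exact Submodule.smul_mem _ c hx

theorem apply_nonneg_of_mem_quadraticModule {f : ι → A} (L : A →ₗ[ℝ] ℝ)
    (hsq : ∀ p : A, 0 ≤ L (p ^ 2)) (hfsq : ∀ j, ∀ p : A, 0 ≤ L (f j * p ^ 2)) {x : A}
    (hx : x ∈ quadraticModule f) : 0 ≤ L x := by
  induction hx using Submodule.span_induction with
  | mem x hx =>
    rcases hx with ⟨b, rfl⟩ | ⟨j, b, rfl⟩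
    exacts [hsq b, hfsq j b]
  | zero => rw [map_zero]
  | add x y _ _ hx hy => rw [map_add]; exact add_nonneg hx hy
  | smul c x _ hx =>
    have : L (c • x) = (c : ℝ) * L x := L.map_smul (c : ℝ) x
    rw [this]
    exact mul_nonneg c.2 hx

theorem sq_sub_one_mem_quadraticModule (f : ι → A) {G : A}
    (hG : G ∈ Submonoid.closure (Set.range fun j => 1 + f j)) :
    G ^ 2 - 1 ∈ quadraticModule f := by
  induction hG using Submonoid.closure_induction with
  | mem t ht =>
    obtain ⟨j, rfl⟩ := ht
    have : (1 + f j) ^ 2 - 1 = f j * 1 ^ 2 + f j * 1 ^ 2 + f j ^ 2 := by ring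
    change (1 + f j) ^ 2 - 1 ∈ _
    rw [this]
    exact add_mem (add_mem (mul_sq_mem_quadraticModule f _ _) (mul_sq_mem_quadraticModule f _ _))
      (sq_mem_quadraticModule f _)
  | one => rw [one_pow, sub_self]; exact zero_mem _
  | mul x y _ _ hx hy =>
    have : (x * y) ^ 2 - 1 = x ^ 2 * (y ^ 2 - 1) + (x ^ 2 - 1) := by ring
    rw [this]
    exact add_mem (sq_mul_mem_quadraticModule x hy) hx

variable {R : Type*} [CommRing R] [Algebra ℝ R] [Algebra A R] [IsScalarTower ℝ A R]

theorem map_mem_quadraticModule {f : ι → A} {x : A} (hx : x ∈ quadraticModule f) :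
    algebraMap A R x ∈ quadraticModule (fun j => algebraMap A R (f j)) := by
  induction hx using Submodule.span_induction with
  | mem x hx =>
    rcases hx with ⟨b, rfl⟩ | ⟨j, b, rfl⟩
    · rw [map_pow]; exact sq_mem_quadraticModule _ _
    · rw [map_mul, map_pow]
      exact mul_sq_mem_quadraticModule (fun j => algebraMap A R (f j)) j _
  | zero => rw [map_zero]; exact zero_mem _
  | add x y _ _ hx hy => rw [map_add]; exact add_mem hx hy
  | smul c x _ hx =>
    have : algebraMap A R (c • x) = c • algebraMap A R x := by
      change algebraMap A R ((c : ℝ) • x) = (c : ℝ) • algebraMap A R x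
      exact map_smul (IsScalarTower.toAlgHom ℝ A R) (c : ℝ) x
    rw [this]
    exact Submodule.smul_mem _ c hx

theorem exists_sq_mul_eq_of_mem_quadraticModule {f : ι → A} (S : Submonoid A)
    [IsLocalization S R] {x : R} (hx : x ∈ quadraticModule (fun j => algebraMap A R (f j))) :
    ∃ G ∈ S, ∃ z ∈ quadraticModule f, algebraMap A R (G ^ 2) * x = algebraMap A R z := by
  induction hx using Submodule.span_induction with
  | mem x hx =>
    rcases hx with ⟨b, rfl⟩ | ⟨j, b, rfl⟩ <;>
      obtain ⟨⟨a, s⟩, hs⟩ := IsLocalization.surj S b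
    · refine ⟨s, s.2, a ^ 2, sq_mem_quadraticModule f a, ?_⟩
      rw [map_pow, map_pow, ← hs]
      ring
    · refine ⟨s, s.2, f j * a ^ 2, mul_sq_mem_quadraticModule f j a, ?_⟩
      rw [map_mul, map_pow, map_pow, ← hs]
      ring
  | zero => exact ⟨1, one_mem S, 0, zero_mem _, by simp⟩
  | add x y _ _ hx hy =>
    obtain ⟨G, hG, z, hz, hGz⟩ := hx
    obtain ⟨H, hH, w, hw, hHw⟩ := hy
    refine ⟨G * H, mul_mem hG hH, H ^ 2 * z + G ^ 2 * w,
      add_mem (sq_mul_mem_quadraticModule H hz) (sq_mul_mem_quadraticModule G hw), ?_⟩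
    rw [map_add, map_mul, map_mul, ← hGz, ← hHw]
    simp only [map_mul, map_pow]
    ring
  | smul c x _ hx =>
    obtain ⟨G, hG, z, hz, hGz⟩ := hx
    refine ⟨G, hG, c • z, Submodule.smul_mem _ c hz, ?_⟩
    change algebraMap A R (G ^ 2) * ((c : ℝ) • x) = algebraMap A R ((c : ℝ) • z)
    rw [mul_smul_comm, hGz]
    exact (map_smul (IsScalarTower.toAlgHom ℝ A R) (c : ℝ) z).symm

theorem apply_nonneg_of_forall_mul_sq (L : A →ₗ[ℝ] ℝ) (hsq : ∀ p : A, 0 ≤ L (p ^ 2)) {a G : A}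
    (hG : ∀ g : A, ∀ ε > 0, ∃ q : A, L (g ^ 2 * (1 - G * q) ^ 2) < ε)
    (ha : ∀ q, 0 ≤ L (a * (G * q) ^ 2)) : 0 ≤ L a := by
  by_contra! hneg
  have h1 : 0 ≤ L 1 := by simpa using hsq 1
  obtain ⟨q, hq⟩ := hG (1 + a ^ 2) (min (-L a / 2) (L a ^ 2 / (16 * (L 1 + 1))))
    (lt_min (by linarith) (by have := pow_pos (neg_pos.2 hneg) 2; rw [neg_sq] at this; positivity))
  set r := 1 - G * q with hr
  set η := L ((1 + a ^ 2) ^ 2 * r ^ 2) with hη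
  have hη1 := lt_of_lt_of_le hq (min_le_left _ _)
  have hη2 := lt_of_lt_of_le hq (min_le_right _ _)
  have e1 : a * (G * q) ^ 2 + a * r + a * r = a + a * r ^ 2 := by rw [hr]; ring
  have e1' := congrArg L e1
  simp only [map_add] at e1'
  have e2 : (1 + a ^ 2) ^ 2 * r ^ 2 = (a * r) ^ 2 + r ^ 2 + (a * r) ^ 2 + (a ^ 2 * r) ^ 2 := by
    ring
  have e2' := congrArg L e2
  simp only [map_add] at e2'
  have hcs := sq_apply_mul_le L 1 (by simpa using hsq) 1 (a * r)
  simp only [one_mul, one_pow] at hcs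
  have e4 : (4 : ℝ) • ((1 + a ^ 2) ^ 2 * r ^ 2) =
      (4 : ℝ) • (a * r ^ 2) +
      (((2 * a - 1) * r) ^ 2 + ((2 * a ^ 2) * r) ^ 2 + (4 : ℝ) • (a * r) ^ 2 +
        (3 : ℝ) • r ^ 2) := by
    simp only [Algebra.smul_def, map_ofNat]
    ring
  have e4' := congrArg L e4
  simp only [map_add, map_smul, smul_eq_mul] at e4'
  have p1 := hsq ((2 * a - 1) * r)
  have p2 := hsq (2 * a ^ 2 * r)
  have p3 := hsq (a * r)
  have p4 := hsq r
  have p5 := hsq (a ^ 2 * r)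
  have hx := ha q
  have hxr : L (a * r) < L a / 4 := by linarith
  have h2 : L a ^ 2 / 16 < L (a * r) ^ 2 := by nlinarith
  have h3 : L 1 * L ((a * r) ^ 2) ≤ (L 1 + 1) * (L a ^ 2 / (16 * (L 1 + 1))) :=
    mul_le_mul (by linarith) (by linarith) p3 (by linarith)
  have h4 : (L 1 + 1) * (L a ^ 2 / (16 * (L 1 + 1))) = L a ^ 2 / 16 := by
    have : L 1 + 1 ≠ 0 := by linarith
    field_simp
  linarith

/-- A functional which is nonnegative on a quadratic module extends to the localization at the
elements `1 + f j` if multiplication by these elements has dense range. -/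
theorem exists_extension_localization {f : ι → A}
    [IsLocalization (Submonoid.closure (Set.range fun j => 1 + f j)) R]
    (L : A →ₗ[ℝ] ℝ) (hsq : ∀ p : A, 0 ≤ L (p ^ 2)) (hfsq : ∀ j, ∀ p : A, 0 ≤ L (f j * p ^ 2))
    (hdense : ∀ j, ∀ g : A, ∀ ε > 0, ∃ q : A, L (g ^ 2 * (1 - (1 + f j) * q) ^ 2) < ε) :
    ∃ L' : R →ₗ[ℝ] ℝ, (∀ a, L' (algebraMap A R a) = L a) ∧ (∀ b : R, 0 ≤ L' (b ^ 2)) ∧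
      ∀ j, ∀ b : R, 0 ≤ L' (algebraMap A R (f j) * b ^ 2) := by
  set S := Submonoid.closure (Set.range fun j => 1 + f j) with hS
  have hG : ∀ G ∈ S, ∀ g : A, ∀ ε > 0, ∃ q : A, L (g ^ 2 * (1 - G * q) ^ 2) < ε :=
    fun G hG => exists_apply_one_sub_mul_sq_lt_of_mem_closure L hsq
      (by rintro _ ⟨j, rfl⟩; exact hdense j) hG
  obtain ⟨L', h1, h2⟩ := PointedCone.exists_extension
    (quadraticModule fun j => algebraMap A R (f j)) (IsScalarTower.toAlgHom ℝ A R).toLinearMap L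
    (by
      intro a ha
      obtain ⟨G, hGS, z, hz, hGz⟩ := exists_sq_mul_eq_of_mem_quadraticModule S ha
      have h0 : algebraMap A R (G ^ 2 * a - z) = 0 := by
        rw [map_sub, map_mul, ← hGz]
        exact sub_self _
      obtain ⟨c, hc⟩ := (IsLocalization.map_eq_zero_iff S R _).1 h0
      refine apply_nonneg_of_forall_mul_sq L hsq (hG _ (mul_mem c.2 hGS)) fun q => ?_
      have : a * ((c : A) * G * q) ^ 2 = q ^ 2 * ((c : A) ^ 2 * z) := by
        linear_combination (c * q ^ 2 : A) * hc
      rw [this]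
      exact apply_nonneg_of_mem_quadraticModule L hsq hfsq
        (sq_mul_mem_quadraticModule _ (sq_mul_mem_quadraticModule _ hz)))
    (by
      intro y
      obtain ⟨⟨b, s⟩, hb⟩ := IsLocalization.surj S y
      obtain ⟨v, hv⟩ := (IsLocalization.map_units R s).exists_right_inv
      refine ⟨(1 / 2 : ℝ) • (1 + b ^ 2), ?_⟩
      have key : (algebraMap A R) ((1 / 2 : ℝ) • (1 + b ^ 2)) + y =
          (1 / 2 : ℝ) • ((y + 1) ^ 2 +
            (algebraMap A R b * v) ^ 2 * algebraMap A R ((s : A) ^ 2 - 1)) := by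
        have hm : algebraMap A R ((1 / 2 : ℝ) • (1 + b ^ 2)) =
            (1 / 2 : ℝ) • algebraMap A R (1 + b ^ 2) :=
          map_smul (IsScalarTower.toAlgHom ℝ A R) (1 / 2 : ℝ) (1 + b ^ 2)
        rw [hm]
        have hy : y = (1 / 2 : ℝ) • (2 * y) := by
          rw [Algebra.smul_def, ← mul_assoc, ← map_ofNat (algebraMap ℝ R), ← map_mul]
          norm_num
        nth_rewrite 1 [hy]
        rw [← smul_add]
        congr 1
        simp only [map_add, map_one, map_pow, map_sub]
        have hyv : y = algebraMap A R b * v := by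
          rw [← hb, mul_assoc, hv, mul_one]
        rw [hyv]
        linear_combination (-(algebraMap A R b) ^ 2 * (algebraMap A R s * v + 1)) * hv
      change (algebraMap A R) ((1 / 2 : ℝ) • (1 + b ^ 2)) + y ∈ _
      rw [key]
      exact PointedCone.smul_mem _ (by norm_num) (add_mem (sq_mem_quadraticModule _ _)
        (sq_mul_mem_quadraticModule _
          (map_mem_quadraticModule (sq_sub_one_mem_quadraticModule f s.2)))))
  exact ⟨L', h1, fun b => h2 _ (sq_mem_quadraticModule _ b),
    fun j b => h2 _ (mul_sq_mem_quadraticModule (fun j => algebraMap A R (f j)) j b)⟩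

end QuadraticModule

theorem MvPolynomial.exists_bound_of_cube {σ : Type*} {T : PointedCone ℝ (MvPolynomial σ ℝ)}
    (h1 : 1 ∈ T) (hX : ∀ i, ∀ p ∈ T, X i * p ∈ T) (hX' : ∀ i, ∀ p ∈ T, (1 - X i) * p ∈ T)
    (p : MvPolynomial σ ℝ) : ∃ N : ℝ, C N + p ∈ T ∧ C N - p ∈ T := by
  have hC : ∀ c : ℝ, 0 ≤ c → C c ∈ T := fun c hc => by
    have := T.smul_mem hc h1
    rwa [MvPolynomial.smul_eq_C_mul, mul_one] at this
  induction p using MvPolynomial.induction_on with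
  | C a =>
    refine ⟨|a|, ?_, ?_⟩
    · rw [← C_add]; exact hC _ (by linarith [neg_abs_le a])
    · rw [← C_sub]; exact hC _ (by linarith [le_abs_self a])
  | add p q hp hq =>
    obtain ⟨N, h₁, h₂⟩ := hp
    obtain ⟨M, h₃, h₄⟩ := hq
    refine ⟨N + M, ?_, ?_⟩
    · convert add_mem h₁ h₃ using 1; rw [C_add]; ring
    · convert add_mem h₂ h₄ using 1; rw [C_add]; ring
  | mul_X p i hp =>
    obtain ⟨N, h₁, h₂⟩ := hp
    have h3 : C (max N 0) + p ∈ T := by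
      convert add_mem h₁ (hC (max N 0 - N) (by linarith [le_max_left N 0])) using 1
      rw [C_sub]; ring
    have h4 : C (max N 0) - p ∈ T := by
      convert add_mem h₂ (hC (max N 0 - N) (by linarith [le_max_left N 0])) using 1
      rw [C_sub]; ring
    refine ⟨max N 0, ?_, ?_⟩
    · convert add_mem (hX i _ h3) (hX' i _ (hC _ (le_max_right N 0))) using 1; ring
    · convert add_mem (hX i _ h4) (hX' i _ (hC _ (le_max_right N 0))) using 1; ring

theorem MvPolynomial.eq_eval_of_forall_mul_X {σ : Type*} (l : MvPolynomial σ ℝ →ₗ[ℝ] ℝ)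
    (h1 : l 1 = 1) (hl : ∀ i p, l (X i * p) = l (X i) * l p) (p : MvPolynomial σ ℝ) :
    l p = eval (fun i => l (X i)) p := by
  induction p using MvPolynomial.induction_on with
  | C a =>
    rw [eval_C, ← mul_one (C a), ← MvPolynomial.smul_eq_C_mul, map_smul, h1, smul_eq_mul, mul_one]
  | add p q hp hq => rw [map_add, hp, hq, map_add]
  | mul_X p i hp => rw [mul_comm, hl, hp, map_mul, eval_X]

/-- A functional which is nonnegative on a cone stable under multiplication by the coordinates and
their complements to one is nonnegative on polynomials nonnegative on the unit cube. -/
theorem MvPolynomial.apply_nonneg_of_nonneg_on_cube {σ : Type*}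
    {T : PointedCone ℝ (MvPolynomial σ ℝ)}
    (h1 : 1 ∈ T) (hX : ∀ i, ∀ p ∈ T, X i * p ∈ T) (hX' : ∀ i, ∀ p ∈ T, (1 - X i) * p ∈ T)
    (l : MvPolynomial σ ℝ →ₗ[ℝ] ℝ) (hl : ∀ p ∈ T, 0 ≤ l p) {φ : MvPolynomial σ ℝ}
    (hφ : ∀ x : σ → ℝ, (∀ i, x i ∈ Set.Icc (0 : ℝ) 1) → 0 ≤ eval x φ) : 0 ≤ l φ := by
  choose N hN hN' using MvPolynomial.exists_bound_of_cube h1 hX hX'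
  have hlC : ∀ (l : MvPolynomial σ ℝ →ₗ[ℝ] ℝ) (c : ℝ), l (C c) = c * l 1 := fun l c => by
    rw [← mul_one (C c), ← MvPolynomial.smul_eq_C_mul, map_smul, smul_eq_mul]
  have hbound : ∀ l : MvPolynomial σ ℝ →ₗ[ℝ] ℝ, (∀ p ∈ T, 0 ≤ l p) → ∀ p,
      |l p| ≤ N p * l 1 := by
    intro l hl p
    have h₁ := hl _ (hN p)
    have h₂ := hl _ (hN' p)
    rw [map_add, hlC] at h₁
    rw [map_sub, hlC] at h₂
    rw [abs_le]
    constructor <;> linarith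
  set K : Set (MvPolynomial σ ℝ → ℝ) :=
    {g | ∃ l : MvPolynomial σ ℝ →ₗ[ℝ] ℝ, ⇑l = g ∧ l 1 = 1 ∧ ∀ p ∈ T, 0 ≤ l p} with hK
  have hKeq : K = ({g | ∀ p q, g (p + q) = g p + g q} ∩ {g | ∀ (c : ℝ) p, g (c • p) = c * g p}) ∩
      ({g | g 1 = 1} ∩ {g | ∀ p ∈ T, 0 ≤ g p}) := by
    ext g
    constructor
    · rintro ⟨l, rfl, h₁, h₂⟩
      exact ⟨⟨fun p q => map_add l p q, fun c p => map_smul l c p⟩, h₁, h₂⟩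
    · rintro ⟨⟨h₁, h₂⟩, h₃, h₄⟩
      exact ⟨{ toFun := g, map_add' := h₁, map_smul' := h₂ }, rfl, h₃, h₄⟩
  have hclosed : IsClosed K := by
    rw [hKeq]
    refine (IsClosed.inter ?_ ?_).inter (IsClosed.inter ?_ ?_)
    · simp only [Set.ofPred_forall]
      exact isClosed_iInter fun p => isClosed_iInter fun q =>
        isClosed_eq (continuous_apply _) (by fun_prop)
    · simp only [Set.ofPred_forall]
      exact isClosed_iInter fun c => isClosed_iInter fun q =>
        isClosed_eq (continuous_apply _) (by fun_prop)
    · exact isClosed_eq (continuous_apply _) continuous_const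
    · simp only [Set.ofPred_forall]
      exact isClosed_iInter fun p => isClosed_iInter fun _ =>
        isClosed_le continuous_const (continuous_apply _)
  have hcompact : IsCompact K := by
    refine IsCompact.of_isClosed_subset
      (isCompact_univ_pi fun p => isCompact_Icc (a := -N p) (b := N p)) hclosed ?_
    rintro _ ⟨l, rfl, h₁, h₂⟩ p -
    have := hbound l h₂ p
    rw [h₁, mul_one, abs_le] at this
    exact this
  have hconvex : Convex ℝ K := by
    rintro _ ⟨l, rfl, h₁, h₂⟩ _ ⟨l', rfl, h₃, h₄⟩ a b ha hb hab
    refine ⟨a • l + b • l', rfl, ?_, fun p hp => ?_⟩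
    · simp [h₁, h₃, hab]
    · have := h₂ p hp
      have := h₄ p hp
      simp only [LinearMap.add_apply, LinearMap.smul_apply, smul_eq_mul]
      positivity
  have hmul : ∀ l : MvPolynomial σ ℝ →ₗ[ℝ] ℝ, l 1 = 1 → (∀ p ∈ T, 0 ≤ l p) →
      ⇑l ∈ K.extremePoints ℝ → ∀ i p, l (X i * p) = l (X i) * l p := by
    intro l hl1 hlT hext i p
    have ht0 : 0 ≤ l (X i) := by simpa using hlT _ (hX i 1 h1)
    have ht1 : 0 ≤ 1 - l (X i) := by simpa [hl1] using hlT _ (hX' i 1 h1)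
    set l₁ : MvPolynomial σ ℝ →ₗ[ℝ] ℝ := l ∘ₗ LinearMap.mulLeft ℝ (X i)
    set l₂ : MvPolynomial σ ℝ →ₗ[ℝ] ℝ := l ∘ₗ LinearMap.mulLeft ℝ (1 - X i)
    have hl₁ : ∀ p, l₁ p = l (X i * p) := fun p => rfl
    have hl₂ : ∀ p, l₂ p = l ((1 - X i) * p) := fun p => rfl
    have hl₂' : ∀ p, l₂ p = l p - l (X i * p) := fun p => by
      rw [hl₂, sub_mul, one_mul, map_sub]
    have hT₁ : ∀ p ∈ T, 0 ≤ l₁ p := fun p hp => hlT _ (hX i p hp)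
    have hT₂ : ∀ p ∈ T, 0 ≤ l₂ p := fun p hp => hlT _ (hX' i p hp)
    have e₁ : l₁ 1 = l (X i) := by rw [hl₁, mul_one]
    have e₂ : l₂ 1 = 1 - l (X i) := by rw [hl₂', mul_one, hl1]
    rcases ht0.eq_or_lt with h0 | h0
    · have := hbound l₁ hT₁ p
      rw [e₁, ← h0, mul_zero, hl₁] at this
      rw [← h0, zero_mul]
      exact abs_nonpos_iff.1 this
    rcases ht1.eq_or_lt with h0' | h0'
    · have := hbound l₂ hT₂ p
      rw [e₂, ← h0', mul_zero, hl₂'] at this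
      have h := abs_nonpos_iff.1 this
      have : l (X i) = 1 := by linarith
      rw [this]
      linarith
    have hmem₁ : ⇑((l (X i))⁻¹ • l₁) ∈ K := by
      refine ⟨_, rfl, ?_, fun p hp => ?_⟩
      · rw [LinearMap.smul_apply, e₁, smul_eq_mul, inv_mul_cancel₀ h0.ne']
      · exact mul_nonneg (inv_nonneg.2 h0.le) (hT₁ p hp)
    have hmem₂ : ⇑((1 - l (X i))⁻¹ • l₂) ∈ K := by
      refine ⟨_, rfl, ?_, fun p hp => ?_⟩
      · rw [LinearMap.smul_apply, e₂, smul_eq_mul, inv_mul_cancel₀ h0'.ne']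
      · exact mul_nonneg (inv_nonneg.2 h0'.le) (hT₂ p hp)
    have hseg : ⇑l ∈ openSegment ℝ ⇑((l (X i))⁻¹ • l₁) ⇑((1 - l (X i))⁻¹ • l₂) := by
      refine ⟨l (X i), 1 - l (X i), h0, h0', by ring, ?_⟩
      funext p
      simp only [Pi.add_apply, Pi.smul_apply, LinearMap.smul_apply, smul_eq_mul]
      rw [mul_inv_cancel_left₀ h0.ne', mul_inv_cancel_left₀ h0'.ne', hl₁, hl₂']
      ring
    have := congrFun ((mem_extremePoints.1 hext).2 _ hmem₁ _ hmem₂ hseg).1 p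
    rw [LinearMap.smul_apply, smul_eq_mul, hl₁, inv_mul_eq_iff_eq_mul₀ h0.ne'] at this
    exact this
  have hKφ : K ⊆ {g | 0 ≤ g φ} := by
    rw [← closure_convexHull_extremePoints hcompact hconvex]
    refine closure_minimal (convexHull_min ?_ ?_)
      (isClosed_le continuous_const (continuous_apply _))
    · intro g hg
      obtain ⟨l, rfl, h₁, h₂⟩ := hg.1
      have hm := hmul l h₁ h₂ hg
      change 0 ≤ l φ
      rw [MvPolynomial.eq_eval_of_forall_mul_X l h₁ hm]
      refine hφ _ fun i => ⟨?_, ?_⟩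
      · simpa using h₂ _ (hX i 1 h1)
      · simpa [h₁] using h₂ _ (hX' i 1 h1)
    · intro g hg g' hg' a b ha hb _
      exact add_nonneg (mul_nonneg ha hg) (mul_nonneg hb hg')
  rcases (hl 1 h1).eq_or_lt with h0 | h0
  · have := hbound l hl φ
    rw [← h0, mul_zero] at this
    rw [abs_nonpos_iff.1 this]
  · have : 0 ≤ ((l 1)⁻¹ • l) φ := hKφ ⟨(l 1)⁻¹ • l, rfl, by simp [h0.ne'], fun p hp =>
      mul_nonneg (inv_nonneg.2 h0.le) (hl p hp)⟩
    rw [LinearMap.smul_apply, smul_eq_mul] at this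
    exact nonneg_of_mul_nonneg_right this (inv_pos.2 h0)

section

variable {R : Type*} [CommRing R] [Algebra ℝ R] (L : R →ₗ[ℝ] ℝ)

theorem apply_mul_mul_sq_nonneg (hsq : ∀ b : R, 0 ≤ L (b ^ 2)) {a b : R}
    (ha : ∀ c, 0 ≤ L (a * c ^ 2)) (hb : ∀ c, 0 ≤ L (b * c ^ 2))
    (hb' : ∀ c, 0 ≤ L ((1 - b) * c ^ 2)) (c : R) : 0 ≤ L (a * b * c ^ 2) := by
  let u : ℕ → R := fun n => (fun x => x - x ^ 2)^[n] b
  have hu : ∀ n, u (n + 1) = u n - u n ^ 2 := fun n => Function.iterate_succ_apply' _ _ _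
  have hpos : ∀ n, (∀ c, 0 ≤ L (u n * c ^ 2)) ∧ ∀ c, 0 ≤ L ((1 - u n) * c ^ 2) := by
    intro n
    induction n with
    | zero => exact ⟨hb, hb'⟩
    | succ n ih =>
      refine ⟨fun c => ?_, fun c => ?_⟩
      · have : u (n + 1) * c ^ 2 = (1 - u n) * (u n * c) ^ 2 + u n * ((1 - u n) * c) ^ 2 := by
          rw [hu]; ring
        rw [this, map_add]
        exact add_nonneg (ih.2 _) (ih.1 _)
      · have : (1 - u (n + 1)) * c ^ 2 = (1 - u n) * c ^ 2 + (u n * c) ^ 2 := by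
          rw [hu]; ring
        rw [this, map_add]
        exact add_nonneg (ih.2 _) (hsq _)
  have hsum : ∀ (x : R) (n : ℕ), L (x * b) =
      ∑ k ∈ Finset.range n, L (x * u k ^ 2) + L (x * u n) := by
    intro x n
    induction n with
    | zero => simp [u]
    | succ n ih =>
      rw [ih, Finset.sum_range_succ, hu, mul_sub, map_sub]
      ring
  have hle : ∀ n, ∑ k ∈ Finset.range n, L (c ^ 2 * u k ^ 2) ≤ L (c ^ 2 * b) := by
    intro n
    rw [hsum (c ^ 2) n]
    have := (hpos n).1 c
    rw [mul_comm] at this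
    linarith
  have hlim : Filter.Tendsto (fun n => L (c ^ 2 * u n ^ 2)) Filter.atTop (nhds 0) :=
    (summable_of_sum_range_le (fun n => by rw [← mul_pow]; exact hsq _) hle).tendsto_atTop_zero
  by_contra! hneg
  have hn : ∀ n, L (a * b * c ^ 2) ^ 2 ≤ L ((a * c) ^ 2) * L (c ^ 2 * u n ^ 2) := by
    intro n
    have h1 := hsum (a * c ^ 2) n
    have h2 : 0 ≤ ∑ k ∈ Finset.range n, L (a * c ^ 2 * u k ^ 2) :=
      Finset.sum_nonneg fun k _ => by rw [mul_assoc, ← mul_pow]; exact ha _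
    have h3 := sq_apply_mul_le L 1 (by simpa using hsq) (a * c) (c * u n)
    simp only [one_mul] at h3
    rw [show a * c * (c * u n) = a * c ^ 2 * u n by ring, mul_pow c] at h3
    rw [show a * c ^ 2 * b = a * b * c ^ 2 by ring] at h1
    refine le_trans ?_ h3
    nlinarith
  have := le_of_tendsto_of_tendsto tendsto_const_nhds (hlim.const_mul (L ((a * c) ^ 2)))
    (Filter.Eventually.of_forall hn)
  rw [mul_zero] at this
  exact absurd this (not_le.2 (by have := pow_pos (neg_pos.2 hneg) 2; rwa [neg_sq] at this))

theorem apply_aeval_mul_sq_nonneg {ι : Type*} (hsq : ∀ b : R, 0 ≤ L (b ^ 2)) {y : ι → R}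
    (hy : ∀ j c, 0 ≤ L (y j * c ^ 2)) (hy' : ∀ j c, 0 ≤ L ((1 - y j) * c ^ 2))
    {φ : MvPolynomial ι ℝ}
    (hφ : ∀ x : ι → ℝ, (∀ i, x i ∈ Set.Icc (0 : ℝ) 1) → 0 ≤ MvPolynomial.eval x φ) (c : R) :
    0 ≤ L (MvPolynomial.aeval y φ * c ^ 2) := by
  let T : PointedCone ℝ (MvPolynomial ι ℝ) :=
    { carrier := {p | ∀ c, 0 ≤ L (MvPolynomial.aeval y p * c ^ 2)}
      add_mem' := fun {p q} hp hq c => by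
        rw [map_add, add_mul, map_add]
        exact add_nonneg (hp c) (hq c)
      zero_mem' := fun c => by simp
      smul_mem' := fun r p hp c => by
        change 0 ≤ L (MvPolynomial.aeval y ((r : ℝ) • p) * c ^ 2)
        rw [map_smul, smul_mul_assoc, map_smul]
        exact mul_nonneg r.2 (hp c) }
  refine MvPolynomial.apply_nonneg_of_nonneg_on_cube (T := T) (fun c => by simpa using hsq c)
    (fun i p hp c => ?_) (fun i p hp c => ?_)
    (L ∘ₗ LinearMap.mulRight ℝ (c ^ 2) ∘ₗ (MvPolynomial.aeval y).toLinearMap)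
    (fun p hp => hp c) hφ
  · rw [mul_comm (MvPolynomial.X i), map_mul (MvPolynomial.aeval y), MvPolynomial.aeval_X]
    exact apply_mul_mul_sq_nonneg L hsq hp (hy i) (hy' i) c
  · have : MvPolynomial.aeval y ((1 - MvPolynomial.X i) * p) =
        MvPolynomial.aeval y p * (1 - y i) := by simp [mul_comm]
    rw [this]
    exact apply_mul_mul_sq_nonneg L hsq hp (hy' i) (by simpa using hy i) c

end

/-- A functional that is positive along a linear map into the continuous functions on a compact
space is given by integration. -/
theorem ContinuousMap.exists_measure_integral_eq {X W : Type*} [TopologicalSpace X] [CompactSpace X]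
    [T2Space X] [MeasurableSpace X] [BorelSpace X] [AddCommGroup W] [Module ℝ W]
    (T : W →ₗ[ℝ] C(X, ℝ)) (l : W →ₗ[ℝ] ℝ) (h : ∀ w, (∀ x, 0 ≤ T w x) → 0 ≤ l w)
    (w₁ : W) (hw₁ : T w₁ = 1) :
    ∃ μ : MeasureTheory.Measure X, MeasureTheory.IsFiniteMeasure μ ∧
      ∀ w, ∫ x, T w x ∂μ = l w := by
  obtain ⟨g, hg, hpos⟩ := PointedCone.exists_extension (PointedCone.positive ℝ C(X, ℝ)) T l
    (fun w hw => h w fun x => by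
      have : 0 ≤ T w := by simpa using hw
      exact this x)
    (fun y => ⟨‖y‖ • w₁, by
      rw [PointedCone.mem_positive]
      intro x
      have := y.norm_coe_le_norm x
      rw [Real.norm_eq_abs] at this
      rw [map_smul, hw₁]
      change (0 : ℝ) ≤ ‖y‖ * 1 + y x
      linarith [neg_abs_le (y x)]⟩)
  let Λ₀ : CompactlySupportedContinuousMap X ℝ →ₗ[ℝ] ℝ :=
    { toFun := fun u => g u.toContinuousMap
      map_add' := fun u v => by rw [← map_add]; rfl
      map_smul' := fun c u => by rw [RingHom.id_apply, ← map_smul]; rfl }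
  let Λ : CompactlySupportedContinuousMap X ℝ →ₚ[ℝ] ℝ := PositiveLinearMap.mk₀ Λ₀ fun u hu =>
    hpos _ (by rw [PointedCone.mem_positive]; exact fun x => hu x)
  refine ⟨RealRMK.rieszMeasure Λ, inferInstance, fun w => ?_⟩
  have := RealRMK.integral_rieszMeasure Λ
    ⟨T w, HasCompactSupport.of_compactSpace _⟩
  rw [← hg]
  exact this

/-- A functional dominated by the seminorm induced from a Hilbert space is represented by a
vector. -/
theorem LinearMap.exists_inner_eq {W E : Type*} [AddCommGroup W] [Module ℝ W]
    [NormedAddCommGroup E] [InnerProductSpace ℝ E] [CompleteSpace E]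
    (T : W →ₗ[ℝ] E) (l : W →ₗ[ℝ] ℝ) (C : ℝ) (h : ∀ w, l w ^ 2 ≤ C * ‖T w‖ ^ 2) :
    ∃ e : E, ∀ w, l w = inner ℝ e (T w) := by
  have hker : T.ker ≤ l.ker := by
    intro w hw
    rw [LinearMap.mem_ker] at hw ⊢
    have := h w
    rw [hw] at this
    simpa using le_antisymm (by simpa using this) (sq_nonneg (l w))
  let φ : T.range →ₗ[ℝ] ℝ := T.ker.liftQ l hker ∘ₗ T.quotKerEquivRange.symm.toLinearMap
  have hφ : ∀ w, φ ⟨T w, LinearMap.mem_range_self T w⟩ = l w := by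
    intro w
    change T.ker.liftQ l hker (T.quotKerEquivRange.symm ⟨T w, LinearMap.mem_range_self T w⟩) = l w
    rw [LinearMap.quotKerEquivRange_symm_apply_image]
    simp
  let ψ : StrongDual ℝ T.range := φ.mkContinuous (√C) (by
    rintro ⟨_, w, rfl⟩
    rw [hφ, Real.norm_eq_abs]
    change |l w| ≤ √C * ‖T w‖
    rw [← Real.sqrt_sq_eq_abs, ← Real.sqrt_sq (norm_nonneg (T w)),
      ← Real.sqrt_mul' _ (sq_nonneg _)]
    exact Real.sqrt_le_sqrt (h w))
  obtain ⟨g, hg, -⟩ := exists_extension_norm_eq T.range ψ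
  refine ⟨(InnerProductSpace.toDual ℝ E).symm g, fun w => ?_⟩
  rw [InnerProductSpace.toDual_symm_apply, ← hφ w]
  exact (hg ⟨T w, LinearMap.mem_range_self T w⟩).symm

namespace UnitCube

/-- Polynomials as continuous functions on the cube. -/
noncomputable def poly (m : ℕ) : MvPolynomial (Fin m) ℝ →ₐ[ℝ] C(Fin m → unitInterval, ℝ) :=
  MvPolynomial.aeval fun j => ⟨fun x => (x j : ℝ), by fun_prop⟩

theorem poly_apply {m : ℕ} (φ : MvPolynomial (Fin m) ℝ) (x : Fin m → unitInterval) :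
    poly m φ x = MvPolynomial.eval (fun j => (x j : ℝ)) φ := by
  induction φ using MvPolynomial.induction_on with
  | C a => simp [poly]
  | add p q hp hq => simp [hp, hq]
  | mul_X p i hp =>
    rw [map_mul, ContinuousMap.mul_apply, hp, map_mul]
    simp [poly]

theorem poly_dense (m : ℕ) : Dense (Set.range (poly m)) := by
  have := ContinuousMap.subalgebra_topologicalClosure_eq_top_of_separatesPoints (poly m).range
    (by
      intro x y hxy
      obtain ⟨j, hj⟩ := Function.ne_iff.mp hxy
      refine ⟨_, ⟨poly m (MvPolynomial.X j), ⟨_, rfl⟩, rfl⟩, ?_⟩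
      simpa [poly_apply, Subtype.ext_iff] using hj)
  intro u
  have h2 : u ∈ (poly m).range.topologicalClosure := by rw [this]; trivial
  exact h2

open MeasureTheory

theorem measure_ext {m : ℕ} {μ ν : Measure (Fin m → unitInterval)} [IsFiniteMeasure μ]
    [IsFiniteMeasure ν] (h : ∀ φ, ∫ x, poly m φ x ∂μ = ∫ x, poly m φ x ∂ν) : μ = ν := by
  have key : ∀ u : C(Fin m → unitInterval, ℝ), ∫ x, u x ∂μ = ∫ x, u x ∂ν := by
    have cont : ∀ μ : Measure (Fin m → unitInterval), IsFiniteMeasure μ →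
        Continuous fun u : C(Fin m → unitInterval, ℝ) => ∫ x, u x ∂μ := by
      intro μ hμ
      have h2 := continuous_integral.comp (ContinuousMap.toLp (p := 1) μ ℝ (E := ℝ)
        (α := Fin m → unitInterval)).continuous
      convert h2 using 2 with u
      exact integral_congr_ae (ContinuousMap.coeFn_toLp μ u).symm
    intro u
    have := Continuous.ext_on (poly_dense m) (cont μ inferInstance) (cont ν inferInstance)
      (by rintro _ ⟨φ, rfl⟩; exact h φ)
    exact congrFun this u
  refine ext_of_forall_integral_eq_of_IsFiniteMeasure fun u => key u.toContinuousMap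

theorem integrable_poly_mul {m : ℕ} {μ : Measure (Fin m → unitInterval)}
    {u : (Fin m → unitInterval) → ℝ} (hu : Integrable u μ) (φ : MvPolynomial (Fin m) ℝ) :
    Integrable (fun x => poly m φ x * u x) μ :=
  hu.bdd_mul (c := ‖poly m φ‖) (poly m φ).continuous.aestronglyMeasurable
    (Filter.Eventually.of_forall fun x => (poly m φ).norm_coe_le_norm x)

theorem ae_nonneg {m : ℕ} {μ : Measure (Fin m → unitInterval)} [IsFiniteMeasure μ]
    {u : (Fin m → unitInterval) → ℝ} (hu : Integrable u μ)
    (h : ∀ φ, (∀ x, 0 ≤ poly m φ x) → 0 ≤ ∫ x, poly m φ x * u x ∂μ) : ∀ᵐ x ∂μ, 0 ≤ u x := by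
  obtain ⟨ν, hν, hνu⟩ := ContinuousMap.exists_measure_integral_eq (poly m).toLinearMap
    { toFun := fun φ => ∫ x, poly m φ x * u x ∂μ
      map_add' := fun φ ψ => by
        rw [← integral_add (integrable_poly_mul hu φ) (integrable_poly_mul hu ψ)]
        simp [add_mul]
      map_smul' := fun c φ => by
        rw [RingHom.id_apply, smul_eq_mul, ← integral_const_mul]
        simp [mul_assoc] }
    h 1 (map_one (poly m))
  have f1 : IsFiniteMeasure (μ.withDensity fun x => ENNReal.ofReal (u x)) :=
    isFiniteMeasure_withDensity_ofReal hu.2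
  have f2 : IsFiniteMeasure (μ.withDensity fun x => ENNReal.ofReal (-u x)) :=
    isFiniteMeasure_withDensity_ofReal hu.neg.2
  have intd : ∀ v : (Fin m → unitInterval) → ℝ, Integrable v μ → ∀ φ,
      ∫ x, poly m φ x ∂(μ.withDensity fun x => ENNReal.ofReal (v x)) =
        ∫ x, poly m φ x * max (v x) 0 ∂μ := by
    intro v hv φ
    rw [integral_withDensity_eq_integral_toReal_smul₀ hv.aemeasurable.ennreal_ofReal
      (Filter.Eventually.of_forall fun _ => ENNReal.ofReal_lt_top)]
    simp [ENNReal.toReal_ofReal', mul_comm]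
  have fi : ∀ (ρ : Measure (Fin m → unitInterval)) [IsFiniteMeasure ρ] φ,
      Integrable (fun x => poly m φ x) ρ := fun ρ _ φ => by
    simpa using integrable_poly_mul (integrable_const (1 : ℝ)) φ
  have heq : ν + (μ.withDensity fun x => ENNReal.ofReal (-u x)) =
      μ.withDensity fun x => ENNReal.ofReal (u x) := by
    refine measure_ext fun φ => ?_
    have hn : Integrable (fun x => -u x) μ := hu.neg
    have := hνu φ
    simp only [LinearMap.coe_mk, AddHom.coe_mk, AlgHom.toLinearMap_apply] at this
    rw [integral_add_measure (fi _ _) (fi _ _), this, intd _ hu, intd _ hn,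
      ← integral_add (integrable_poly_mul hu φ) (integrable_poly_mul hn.pos_part φ)]
    refine integral_congr_ae (Filter.Eventually.of_forall fun x => ?_)
    beta_reduce
    rw [← mul_add]
    congr 1
    rcases le_total 0 (u x) with h | h
    · rw [max_eq_right (by linarith), max_eq_left h, add_zero]
    · rw [max_eq_left (by linarith), max_eq_right h]; ring
  have hle := ae_le_of_forall_setLIntegral_le_of_sigmaFinite₀ (μ := μ)
    (f := fun x => ENNReal.ofReal (-u x)) (g := fun x => ENNReal.ofReal (u x))
    hu.neg.aemeasurable.ennreal_ofReal (fun s hs _ => by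
      rw [← withDensity_apply _ hs, ← withDensity_apply _ hs, ← heq]
      simp)
  filter_upwards [hle] with x hx
  by_contra hneg
  push Not at hneg
  rw [ENNReal.ofReal_of_nonpos hneg.le, nonpos_iff_eq_zero, ENNReal.ofReal_eq_zero] at hx
  linarith

theorem ae_eq_zero {m : ℕ} {μ : Measure (Fin m → unitInterval)} [IsFiniteMeasure μ]
    {u : (Fin m → unitInterval) → ℝ} (hu : Integrable u μ)
    (h : ∀ φ, ∫ x, poly m φ x * u x ∂μ = 0) : ∀ᵐ x ∂μ, u x = 0 := by
  filter_upwards [ae_nonneg hu fun φ _ => (h φ).ge, ae_nonneg hu.neg fun φ _ => by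
    simp [integral_neg, h φ]] with x h1 h2
  simp only [Pi.neg_apply] at h2
  linarith

end UnitCube

open MeasureTheory in
theorem MeasureTheory.Measure.exists_map_eq_of_isCompact {X Z : Type*} [TopologicalSpace X]
    [CompactSpace X] [MeasurableSpace X] [BorelSpace X] [HasOuterApproxClosed X]
    [TopologicalSpace Z] [T2Space Z] [MeasurableSpace Z] [BorelSpace Z]
    {Y : Z → X} (hY : Continuous Y) {K : Set Z} (hK : IsCompact K) (μ : Measure X)
    [IsFiniteMeasure μ] (hμ : ∀ᵐ x ∂μ, x ∈ Y '' K) :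
    ∃ ν : Measure Z, ν Kᶜ = 0 ∧ ν.map Y = μ := by
  have : CompactSpace K := isCompact_iff_compactSpace.mp hK
  let YK : C(K, X) := ⟨fun z => Y z, by fun_prop⟩
  obtain ⟨ν, hν, h⟩ := ContinuousMap.exists_measure_integral_eq (X := K) (W := C(X, ℝ))
    { toFun := fun u => u.comp YK
      map_add' := fun u v => rfl
      map_smul' := fun c u => rfl }
    { toFun := fun u => ∫ x, u x ∂μ
      map_add' := fun u v => by
        simpa using integral_add (u.continuous.integrable_of_hasCompactSupport
          (HasCompactSupport.of_compactSpace _)) (v.continuous.integrable_of_hasCompactSupport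
          (HasCompactSupport.of_compactSpace _))
      map_smul' := fun c u => by simpa using integral_const_mul c (fun x => u x) }
    (fun u hu => integral_nonneg_of_ae (by
      filter_upwards [hμ] with x hx
      obtain ⟨z, hz, rfl⟩ := hx
      exact hu ⟨z, hz⟩))
    1 rfl
  refine ⟨ν.map Subtype.val, ?_, ?_⟩
  · rw [Measure.map_apply measurable_subtype_coe hK.measurableSet.compl]
    simp
  · rw [Measure.map_map hY.measurable measurable_subtype_coe]
    have : IsFiniteMeasure (ν.map (Y ∘ Subtype.val)) := inferInstance
    refine ext_of_forall_integral_eq_of_IsFiniteMeasure fun u => ?_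
    rw [integral_map (hY.measurable.comp measurable_subtype_coe).aemeasurable
      u.continuous.aestronglyMeasurable]
    exact h u.toContinuousMap

open MeasureTheory in
/-- A finite measure concentrated on the image of a `σ`-compact set lifts to a measure concentrated
on that set. -/
theorem MeasureTheory.Measure.exists_map_eq_of_iUnion_isCompact {X Z : Type*} [TopologicalSpace X]
    [CompactSpace X] [T2Space X] [MeasurableSpace X] [BorelSpace X] [HasOuterApproxClosed X]
    [TopologicalSpace Z] [T2Space Z] [MeasurableSpace Z] [BorelSpace Z]
    {Y : Z → X} (hY : Continuous Y) {K : ℕ → Set Z} (hK : ∀ n, IsCompact (K n)) (μ : Measure X)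
    [IsFiniteMeasure μ] (hμ : ∀ᵐ x ∂μ, x ∈ Y '' ⋃ n, K n) :
    ∃ ν : Measure Z, ν (⋃ n, K n)ᶜ = 0 ∧ ν.map Y = μ := by
  have hm : ∀ n, MeasurableSet (Y '' K n) := fun n => ((hK n).image hY).measurableSet
  have hd : ∀ n, MeasurableSet (disjointed (fun n => Y '' K n) n) := fun n =>
    MeasurableSet.disjointed hm n
  have key : ∀ n, ∃ ν : Measure Z, ν (K n)ᶜ = 0 ∧
      ν.map Y = μ.restrict (disjointed (fun n => Y '' K n) n) := fun n =>
    Measure.exists_map_eq_of_isCompact hY (hK n) _ (by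
      filter_upwards [ae_restrict_mem (hd n)] with x hx
      exact disjointed_subset (fun n => Y '' K n) n hx)
  choose ν hν hν' using key
  refine ⟨Measure.sum ν, ?_, ?_⟩
  · refine Measure.sum_apply_eq_zero.mpr fun n => measure_mono_null ?_ (hν n)
    exact Set.compl_subset_compl.mpr (Set.subset_iUnion _ n)
  · rw [Measure.map_sum hY.aemeasurable]
    simp_rw [hν']
    rw [← Measure.restrict_iUnion (disjoint_disjointed _) hd, iUnion_disjointed, ← Set.image_iUnion]
    exact Measure.restrict_eq_self_of_ae_mem hμ

namespace UnitCube

open MeasureTheory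

section

variable {m : ℕ} {R : Type*} [CommRing R] [Algebra ℝ R] (L : R →ₗ[ℝ] ℝ) (y : Fin m → R)

theorem exists_measure (hsq : ∀ b, 0 ≤ L (b ^ 2))
    (hy : ∀ j c, 0 ≤ L (y j * c ^ 2)) (hy' : ∀ j c, 0 ≤ L ((1 - y j) * c ^ 2)) :
    ∃ μ : Measure (Fin m → unitInterval), IsFiniteMeasure μ ∧
      ∀ φ, ∫ x, poly m φ x ∂μ = L (MvPolynomial.aeval y φ) := by
  refine ContinuousMap.exists_measure_integral_eq (poly m).toLinearMap
    (L ∘ₗ (MvPolynomial.aeval y).toLinearMap) (fun φ hφ => ?_) 1 (map_one (poly m))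
  have := apply_aeval_mul_sq_nonneg L hsq hy hy' (φ := φ) (fun x hx => by
    have := hφ fun i => ⟨x i, hx i⟩
    rw [AlgHom.toLinearMap_apply, poly_apply] at this
    exact this) 1
  simpa using this

variable {L y} {μ : Measure (Fin m → unitInterval)} [IsFiniteMeasure μ]

theorem exists_density (hsq : ∀ b, 0 ≤ L (b ^ 2))
    (hμ : ∀ φ, ∫ x, poly m φ x ∂μ = L (MvPolynomial.aeval y φ)) (b : R) :
    ∃ h : (Fin m → unitInterval) → ℝ, MemLp h 2 μ ∧
      ∀ φ, ∫ x, poly m φ x * h x ∂μ = L (MvPolynomial.aeval y φ * b) := by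
  let T : MvPolynomial (Fin m) ℝ →ₗ[ℝ] Lp ℝ 2 μ :=
    (ContinuousMap.toLp 2 μ ℝ).toLinearMap ∘ₗ (poly m).toLinearMap
  have hT : ∀ φ, (T φ : (Fin m → unitInterval) → ℝ) =ᵐ[μ] poly m φ := fun φ =>
    ContinuousMap.coeFn_toLp μ (poly m φ)
  have hnorm : ∀ φ, ‖T φ‖ ^ 2 = L (MvPolynomial.aeval y φ ^ 2) := by
    intro φ
    rw [← real_inner_self_eq_norm_sq, L2.inner_def, ← map_pow, ← hμ]
    refine integral_congr_ae ?_
    filter_upwards [hT φ] with x hx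
    rw [hx]
    simp [sq]
  obtain ⟨e, he⟩ := T.exists_inner_eq
    (L ∘ₗ LinearMap.mulRight ℝ b ∘ₗ (MvPolynomial.aeval y).toLinearMap) (L (b ^ 2)) (fun φ => by
      rw [hnorm]
      have := sq_apply_mul_le L 1 (by simpa using hsq) (MvPolynomial.aeval y φ) b
      simp only [one_mul] at this
      rw [mul_comm]
      exact this)
  refine ⟨e, Lp.memLp e, fun φ => ?_⟩
  have := he φ
  rw [L2.inner_def] at this
  refine Eq.trans (integral_congr_ae ?_) this.symm
  filter_upwards [hT φ] with x hx
  rw [hx]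
  simp

theorem exists_linearMap (hsq : ∀ b, 0 ≤ L (b ^ 2))
    (hμ : ∀ φ, ∫ x, poly m φ x ∂μ = L (MvPolynomial.aeval y φ))
    {σ : Type*} (i : MvPolynomial σ ℝ →ₐ[ℝ] R) :
    ∃ l : (Fin m → unitInterval) → MvPolynomial σ ℝ →ₗ[ℝ] ℝ,
      (∀ p, Integrable (fun x => l x p) μ) ∧
      ∀ p φ, ∫ x, poly m φ x * l x p ∂μ = L (MvPolynomial.aeval y φ * i p) := by
  choose h hh hL using fun s : σ →₀ ℕ =>
    exists_density hsq hμ (i (MvPolynomial.monomial s 1))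
  have hi : ∀ s, Integrable (h s) μ := fun s => (hh s).integrable (by norm_num)
  let l : (Fin m → unitInterval) → MvPolynomial σ ℝ →ₗ[ℝ] ℝ := fun x =>
    (MvPolynomial.basisMonomials σ ℝ).constr ℝ fun s => h s x
  have hl : ∀ x s a, l x (MvPolynomial.monomial s a) = a * h s x := by
    intro x s a
    have h1 : MvPolynomial.monomial s a = a • MvPolynomial.basisMonomials σ ℝ s := by
      simp [MvPolynomial.smul_monomial]
    rw [h1, map_smul, Module.Basis.constr_basis, smul_eq_mul]
  have key : ∀ p, Integrable (fun x => l x p) μ ∧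
      ∀ φ, ∫ x, poly m φ x * l x p ∂μ = L (MvPolynomial.aeval y φ * i p) := by
    intro p
    induction p using MvPolynomial.induction_on' with
    | monomial s a =>
      simp only [hl]
      refine ⟨(hi s).const_mul a, fun φ => ?_⟩
      simp only [mul_left_comm _ a]
      rw [integral_const_mul, hL]
      have h1 : MvPolynomial.monomial s a = a • MvPolynomial.monomial s (1 : ℝ) := by
        simp [MvPolynomial.smul_monomial]
      rw [h1, map_smul, mul_smul_comm, map_smul, smul_eq_mul]
    | add p q hp hq =>
      simp only [map_add, mul_add]
      refine ⟨hp.1.add hq.1, fun φ => ?_⟩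
      rw [integral_add (integrable_poly_mul hp.1 φ) (integrable_poly_mul hq.1 φ), hp.2, hq.2]
  exact ⟨l, fun p => (key p).1, fun p => (key p).2⟩

end

end UnitCube

/-- A positive functional on which `f` acts by scalars `r` forces a common real point where `f`
takes the values `r`. -/
theorem MvPolynomial.exists_eval_eq_of_positive {d m : ℕ} {f : Fin m → MvPolynomial (Fin d) ℝ}
    {l : MvPolynomial (Fin d) ℝ →ₗ[ℝ] ℝ} (h1 : l 1 = 1) (hsq : ∀ p, 0 ≤ l (p ^ 2))
    {r : Fin m → ℝ} (hf : ∀ j p, l (f j * p) = r j * l p) :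
    ∃ z : Fin d → ℝ, ∀ j, eval z (f j) = r j := by
  let J : Ideal (MvPolynomial (Fin d) ℝ) :=
    { carrier := {a | ∀ b, l (a * b) = 0}
      add_mem' := fun {a a'} ha ha' b => by rw [add_mul, map_add, ha, ha', add_zero]
      zero_mem' := fun b => by rw [zero_mul, map_zero]
      smul_mem' := fun c a ha b => by
        rw [smul_eq_mul, mul_comm c, mul_assoc]; exact ha _ }
  have hs : ∀ s : MvPolynomial (Fin d) ℝ, IsSumSq s → 0 ≤ l s := by
    intro s hs
    induction hs with
    | zero => rw [map_zero]
    | sq_add a hs ih =>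
      rw [map_add, ← sq]; exact add_nonneg (hsq a) ih
  obtain ⟨z, hz⟩ := MvPolynomial.exists_real_zero J
    (fun s h hmem => by
      have h2 := hmem 1
      rw [mul_one, map_add, h1] at h2
      linarith [hs s h])
    (Finset.univ.image fun j => f j - C (r j))
    (fun p hp => by
      obtain ⟨j, -, rfl⟩ := Finset.mem_image.mp hp
      intro b
      rw [sub_mul, map_sub, hf, ← smul_eq_C_mul, map_smul, smul_eq_mul, sub_self])
  refine ⟨z, fun j => ?_⟩
  have := hz _ (Finset.mem_image_of_mem _ (Finset.mem_univ j))
  rwa [map_sub, eval_C, sub_eq_zero] at this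

theorem MvPolynomial.apply_aeval_mul {σ A : Type*} [CommRing A] [Algebra ℝ A] {f : σ → A}
    {l : A →ₗ[ℝ] ℝ} {r : σ → ℝ} (hf : ∀ j p, l (f j * p) = r j * l p) (F : MvPolynomial σ ℝ)
    (a : A) : l (aeval f F * a) = eval r F * l a := by
  induction F using MvPolynomial.induction_on generalizing a with
  | C c => rw [aeval_C, eval_C, ← Algebra.smul_def, map_smul, smul_eq_mul]
  | add p q hp hq => rw [map_add, map_add, add_mul, add_mul, map_add, hp, hq]
  | mul_X p i hp =>
    rw [map_mul (aeval f), map_mul (eval r), mul_assoc, hp, aeval_X, eval_X, hf, mul_assoc]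

/-- Positivity on squares with rational coefficients extends to all squares. -/
theorem MvPolynomial.apply_sq_nonneg_of_rat {σ : Type*} (l : MvPolynomial σ ℝ →ₗ[ℝ] ℝ)
    (h : ∀ (S : Finset (σ →₀ ℕ)) (c : S → ℚ), 0 ≤ l ((∑ s, monomial s.1 (c s : ℝ)) ^ 2))
    (p : MvPolynomial σ ℝ) : 0 ≤ l (p ^ 2) := by
  have key : ∀ (S : Finset (σ →₀ ℕ)) (c : S → ℝ), 0 ≤ l ((∑ s, monomial s.1 (c s)) ^ 2) := by
    intro S c
    have hG : ∀ c : S → ℝ, l ((∑ s, monomial s.1 (c s)) ^ 2) =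
        ∑ s, ∑ t, c s * c t * l (monomial (s.1 + t.1) 1) := by
      intro c
      rw [sq, Finset.sum_mul_sum, map_sum]
      refine Finset.sum_congr rfl fun s _ => ?_
      rw [map_sum]
      refine Finset.sum_congr rfl fun t _ => ?_
      rw [monomial_mul, ← smul_eq_mul (_ * _), ← map_smul, smul_monomial, smul_eq_mul, mul_one]
    have hcl : IsClosed {c : S → ℝ | 0 ≤ l ((∑ s, monomial s.1 (c s)) ^ 2)} := by
      simp only [hG]
      exact isClosed_le continuous_const (by fun_prop)
    have hd : DenseRange (fun c : S → ℚ => fun s => (c s : ℝ)) :=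
      DenseRange.piMap fun _ => Rat.denseRange_cast
    have := hcl.closure_subset_iff.mpr (Set.range_subset_iff.mpr (h S)) (hd c)
    exact this
  have := key p.support fun s => coeff s.1 p
  rwa [Finset.sum_coe_sort p.support (fun s => monomial s (coeff s p)),
    support_sum_monomial_coeff] at this

namespace UnitCube

open MeasureTheory

theorem ae_mul_apply_eq {d m : ℕ} {R : Type*} [CommRing R] [Algebra ℝ R] {L : R →ₗ[ℝ] ℝ}
    {y : Fin m → R} {μ : Measure (Fin m → unitInterval)} [IsFiniteMeasure μ]
    (i : MvPolynomial (Fin d) ℝ →ₐ[ℝ] R) {f : Fin m → MvPolynomial (Fin d) ℝ}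
    (hyf : ∀ j, y j * i (f j) = 1 - y j)
    {l : (Fin m → unitInterval) → MvPolynomial (Fin d) ℝ →ₗ[ℝ] ℝ}
    (l_integrable : ∀ p, Integrable (fun x => l x p) μ)
    (hl : ∀ p φ, ∫ x, poly m φ x * l x p ∂μ = L (MvPolynomial.aeval y φ * i p))
    (j : Fin m) (p : MvPolynomial (Fin d) ℝ) :
    ∀ᵐ x ∂μ, (x j : ℝ) * l x (f j * p) - (1 - (x j : ℝ)) * l x p = 0 := by
  have hX : ∀ x, poly m (MvPolynomial.X j) x = (x j : ℝ) := fun x => by simp [poly]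
  have hX' : ∀ x, poly m (1 - MvPolynomial.X j) x = 1 - (x j : ℝ) := fun x => by simp [poly]
  have i1 := integrable_poly_mul (l_integrable (f j * p)) (MvPolynomial.X j)
  have i2 := integrable_poly_mul (l_integrable p) (1 - MvPolynomial.X j)
  simp only [hX, hX'] at i1 i2
  refine ae_eq_zero (i1.sub i2) fun φ => ?_
  have h1 := hl (f j * p) (φ * MvPolynomial.X j)
  have h2 := hl p (φ * (1 - MvPolynomial.X j))
  simp only [map_mul, ContinuousMap.mul_apply, hX, hX', mul_assoc] at h1 h2
  simp only [mul_sub _ (_ * _) (_ * _)]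
  rw [integral_sub (integrable_poly_mul i1 φ) (integrable_poly_mul i2 φ), h1, h2, ← map_sub,
    ← mul_sub]
  simp only [MvPolynomial.aeval_X, map_sub, map_one]
  rw [← mul_assoc (y j), hyf, sub_self, mul_zero, map_zero]

theorem ae_properties {d m : ℕ} {R : Type*} [CommRing R] [Algebra ℝ R] {L : R →ₗ[ℝ] ℝ}
    {y : Fin m → R} {μ : Measure (Fin m → unitInterval)} [IsFiniteMeasure μ]
    (hsq : ∀ b, 0 ≤ L (b ^ 2))
    (hy : ∀ j c, 0 ≤ L (y j * c ^ 2)) (hy' : ∀ j c, 0 ≤ L ((1 - y j) * c ^ 2))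
    (hμ : ∀ φ, ∫ x, poly m φ x ∂μ = L (MvPolynomial.aeval y φ))
    (i : MvPolynomial (Fin d) ℝ →ₐ[ℝ] R) {f : Fin m → MvPolynomial (Fin d) ℝ}
    (hyf : ∀ j, y j * i (f j) = 1 - y j)
    {l : (Fin m → unitInterval) → MvPolynomial (Fin d) ℝ →ₗ[ℝ] ℝ}
    (l_integrable : ∀ p, Integrable (fun x => l x p) μ)
    (hl : ∀ p φ, ∫ x, poly m φ x * l x p ∂μ = L (MvPolynomial.aeval y φ * i p)) :
    ∀ᵐ x ∂μ, l x 1 = 1 ∧ (∀ p, 0 ≤ l x (p ^ 2)) ∧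
      ∀ j p, (x j : ℝ) * l x (f j * p) = (1 - (x j : ℝ)) * l x p := by
  have e1 : ∀ᵐ x ∂μ, l x 1 - 1 = 0 := by
    refine ae_eq_zero ((l_integrable 1).sub (integrable_const 1)) fun φ => ?_
    simp only [mul_sub]
    rw [integral_sub (integrable_poly_mul (l_integrable 1) φ)
      (integrable_poly_mul (integrable_const 1) φ), hl]
    simp [hμ]
  have e2 : ∀ p, ∀ᵐ x ∂μ, 0 ≤ l x (p ^ 2) := by
    refine fun p => ae_nonneg (l_integrable _) fun φ hφ => ?_
    rw [hl, map_pow]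
    refine apply_aeval_mul_sq_nonneg L hsq hy hy' (fun x hx => ?_) _
    have := hφ fun i => ⟨x i, hx i⟩
    rwa [poly_apply] at this
  have a2 : ∀ᵐ x ∂μ, ∀ (S : Finset (Fin d →₀ ℕ)) (c : S → ℚ),
      0 ≤ l x ((∑ s, MvPolynomial.monomial s.1 (c s : ℝ)) ^ 2) :=
    ae_all_iff.mpr fun S => ae_all_iff.mpr fun c => e2 _
  have a3 : ∀ᵐ x ∂μ, ∀ (j : Fin m) (s : Fin d →₀ ℕ),
      (x j : ℝ) * l x (f j * MvPolynomial.monomial s 1) -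
        (1 - (x j : ℝ)) * l x (MvPolynomial.monomial s 1) = 0 :=
    ae_all_iff.mpr fun j => ae_all_iff.mpr fun s => ae_mul_apply_eq i hyf l_integrable hl j _
  filter_upwards [e1, a2, a3] with x h1 h2 h3
  refine ⟨sub_eq_zero.mp h1, MvPolynomial.apply_sq_nonneg_of_rat _ h2, fun j p => ?_⟩
  induction p using MvPolynomial.induction_on' with
  | monomial s a =>
    have h4 : MvPolynomial.monomial s a = a • MvPolynomial.monomial s (1 : ℝ) := by
      simp [MvPolynomial.smul_monomial]
    have := h3 j s
    rw [h4, mul_smul_comm, map_smul, map_smul, smul_eq_mul, smul_eq_mul]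
    linear_combination a * this
  | add p q hp hq => rw [mul_add, map_add, map_add, mul_add, mul_add, hp, hq]

/-- The coordinates `1 / (1 + max 0 (g j z))` of a point. -/
noncomputable def resolvent {d m : ℕ} (f : Fin m → MvPolynomial (Fin d) ℝ) (z : Fin d → ℝ)
    (j : Fin m) : unitInterval :=
  ⟨(1 + max 0 (MvPolynomial.eval z (f j)))⁻¹, by
    have h : 0 ≤ max 0 (MvPolynomial.eval z (f j)) := le_max_left _ _
    exact ⟨by positivity, inv_le_one_of_one_le₀ (by linarith)⟩⟩

theorem continuous_resolvent {d m : ℕ} (f : Fin m → MvPolynomial (Fin d) ℝ) :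
    Continuous (resolvent f) := by
  refine continuous_pi fun j => Continuous.subtype_mk ?_ _
  refine Continuous.inv₀ ?_ fun z => ?_
  · have := MvPolynomial.continuous_eval (f j)
    fun_prop
  · have h : 0 ≤ max 0 (MvPolynomial.eval z (f j)) := le_max_left _ _
    positivity

theorem resolvent_inv {d m : ℕ} {f : Fin m → MvPolynomial (Fin d) ℝ} {z : Fin d → ℝ} {j : Fin m}
    (hz : 0 ≤ MvPolynomial.eval z (f j)) :
    (1 - (resolvent f z j : ℝ)) / (resolvent f z j : ℝ) = MvPolynomial.eval z (f j) := by
  have : (1 + MvPolynomial.eval z (f j)) ≠ 0 := by positivity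
  simp only [resolvent, max_eq_right hz]
  field_simp
  ring

open MvPolynomial in
theorem mem_image_resolvent {d m : ℕ} {f : Fin m → MvPolynomial (Fin d) ℝ}
    {l : MvPolynomial (Fin d) ℝ →ₗ[ℝ] ℝ} {x : Fin m → unitInterval}
    (h1 : l 1 = 1) (hsq : ∀ p, 0 ≤ l (p ^ 2))
    (hf : ∀ j p, (x j : ℝ) * l (f j * p) = (1 - (x j : ℝ)) * l p) :
    x ∈ resolvent f '' {z | ∀ j, 0 ≤ eval z (f j)} ∧
      ∀ F, l (aeval f F) = eval (fun j => (1 - (x j : ℝ)) / (x j : ℝ)) F := by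
  have hx : ∀ j, 0 < (x j : ℝ) := fun j => by
    refine lt_of_le_of_ne (x j).2.1 fun h0 => ?_
    have := hf j 1
    rw [← h0, h1] at this
    norm_num at this
  have hf' : ∀ j p, l (f j * p) = (1 - (x j : ℝ)) / (x j : ℝ) * l p := fun j p => by
    have := hx j
    rw [div_mul_eq_mul_div, eq_div_iff this.ne', ← hf, mul_comm]
  refine ⟨?_, fun F => ?_⟩
  · obtain ⟨z, hz⟩ := exists_eval_eq_of_positive h1 hsq hf'
    have h0 : ∀ j, 0 ≤ eval z (f j) := fun j => by
      rw [hz]; exact div_nonneg (by linarith [(x j).2.2]) (hx j).le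
    refine ⟨z, h0, funext fun j => Subtype.ext ?_⟩
    have := hx j
    simp only [resolvent, max_eq_right (h0 j)]
    rw [hz]
    field_simp
    ring
  · have := apply_aeval_mul hf' F 1
    rwa [mul_one, h1, mul_one] at this

end UnitCube

open MeasureTheory MvPolynomial

/-- Variant of Theorem 2 without the generation assumption: the representation of `L`
holds for all polynomials in the subalgebra generated by `f₁,…,f_m`, and the measure
is supported on `K(f)`. -/
theorem semialgebraic_moment_problem_subalgebra
    (d m : ℕ) (f : Fin m → MvPolynomial (Fin d) ℝ)
    (L : MvPolynomial (Fin d) ℝ →ₗ[ℝ] ℝ)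
    (hsq : ∀ p : MvPolynomial (Fin d) ℝ, 0 ≤ L (p ^ 2))
    (hfsq : ∀ (j : Fin m) (p : MvPolynomial (Fin d) ℝ), 0 ≤ L (f j * p ^ 2))
    (hstieltjes : ∀ j : Fin m,
      ∑' n : ℕ,
        (ENNReal.ofReal (L (f j ^ (n + 1)))) ^ (-(1 / (2 * ((n : ℝ) + 1)))) = ⊤) :
    ∃ μ : Measure (Fin d → ℝ),
      μ {x | ¬ ∀ j : Fin m, 0 ≤ eval x (f j)} = 0 ∧
      ∀ q ∈ Algebra.adjoin ℝ (Set.range f),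
        Integrable (fun x => eval x q) μ ∧ L q = ∫ x, eval x q ∂μ := by
  let S : Submonoid (MvPolynomial (Fin d) ℝ) := Submonoid.closure (Set.range fun j => 1 + f j)
  obtain ⟨L', hL, hsq', hfsq'⟩ := exists_extension_localization (R := Localization S) L hsq hfsq
    (fun j g ε hε => exists_apply_one_sub_mul_sq_lt L hsq (hfsq j) (hstieltjes j) g hε)
  let i : MvPolynomial (Fin d) ℝ →ₐ[ℝ] Localization S := Algebra.algHom ℝ _ _
  have hi : ∀ p, i p = algebraMap _ (Localization S) p := fun p => rfl
  have hunit : ∀ j, ∃ y : Localization S, y * (1 + i (f j)) = 1 := fun j => by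
    have := IsLocalization.map_units (Localization S)
      (⟨1 + f j, Submonoid.subset_closure ⟨j, rfl⟩⟩ : S)
    obtain ⟨y, hy⟩ := this.exists_left_inv
    exact ⟨y, by rwa [map_add, map_one] at hy⟩
  choose y hy using hunit
  have hyf : ∀ j, y j * i (f j) = 1 - y j := fun j => by linear_combination hy j
  have hyn : ∀ j c, 0 ≤ L' (y j * c ^ 2) := fun j c => by
    have h1 : y j * c ^ 2 = (y j * c) ^ 2 + i (f j) * (y j * c) ^ 2 := by
      linear_combination (-y j * c ^ 2) * hy j
    rw [h1, map_add]
    exact add_nonneg (hsq' _) (hfsq' j _)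
  have hyn' : ∀ j c, 0 ≤ L' ((1 - y j) * c ^ 2) := fun j c => by
    have h1 : (1 - y j) * c ^ 2 = i (f j) * (y j * c) ^ 2 + (i (f j) * (y j * c)) ^ 2 := by
      rw [← hyf]
      linear_combination (-y j * i (f j) * c ^ 2) * hy j
    rw [h1, map_add]
    exact add_nonneg (hfsq' j _) (hsq' _)
  obtain ⟨μ, hμf, hμ⟩ := UnitCube.exists_measure L' y hsq' hyn hyn'
  obtain ⟨l, l_integrable, hl⟩ := UnitCube.exists_linearMap hsq' hμ i
  have hae : ∀ᵐ x ∂μ, x ∈ UnitCube.resolvent f '' {z | ∀ j, 0 ≤ eval z (f j)} ∧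
      ∀ F, l x (aeval f F) = eval (fun j => (1 - (x j : ℝ)) / (x j : ℝ)) F := by
    filter_upwards [UnitCube.ae_properties hsq' hyn hyn' hμ i hyf l_integrable hl] with x hx
    exact UnitCube.mem_image_resolvent hx.1 hx.2.1 hx.2.2
  have hcl : IsClosed {z : Fin d → ℝ | ∀ j, 0 ≤ eval z (f j)} := by
    simp only [Set.ofPred_forall]
    exact isClosed_iInter fun j => isClosed_le continuous_const (MvPolynomial.continuous_eval _)
  have hU : (⋃ n : ℕ, {z : Fin d → ℝ | ∀ j, 0 ≤ eval z (f j)} ∩ Metric.closedBall 0 n) =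
      {z | ∀ j, 0 ≤ eval z (f j)} := by
    rw [← Set.inter_iUnion, Metric.iUnion_closedBall_nat, Set.inter_univ]
  have hY := UnitCube.continuous_resolvent f
  obtain ⟨ν, hν, hmap⟩ := Measure.exists_map_eq_of_iUnion_isCompact hY
    (fun n : ℕ => (isCompact_closedBall (0 : Fin d → ℝ) n).inter_left hcl) μ (by
      rw [hU]
      exact hae.mono fun x hx => hx.1)
  rw [hU] at hν
  refine ⟨ν, hν, fun q hq => ?_⟩
  rw [Algebra.adjoin_range_eq_range_aeval] at hq
  obtain ⟨F, rfl⟩ := hq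
  change Integrable (fun x => eval x (aeval f F)) ν ∧ L (aeval f F) = ∫ x, eval x (aeval f F) ∂ν
  have hK : ∀ᵐ z ∂ν, ∀ j, 0 ≤ eval z (f j) := hν
  have heq : (fun z => eval z (aeval f F)) =ᵐ[ν]
      fun z => l (UnitCube.resolvent f z) (aeval f F) := by
    rw [← hmap] at hae
    filter_upwards [hK, ae_of_ae_map hY.aemeasurable hae] with z hz hz'
    rw [hz'.2]
    simp only [UnitCube.resolvent_inv (hz _)]
    induction F using MvPolynomial.induction_on with
    | C a => simp
    | add p q hp hq => rw [map_add, map_add, map_add, hp, hq]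
    | mul_X p i hp => rw [map_mul, map_mul, map_mul, hp, aeval_X, eval_X]
  have hi' := l_integrable (aeval f F)
  rw [← hmap] at hi'
  refine ⟨(hi'.comp_aemeasurable hY.aemeasurable).congr heq.symm, ?_⟩
  rw [integral_congr_ae heq,
    ← integral_map (f := fun x => l x (aeval f F)) hY.aemeasurable hi'.aestronglyMeasurable, hmap]
  have := hl (aeval f F) 1
  simp only [map_one, ContinuousMap.one_apply, one_mul, hi, hL] at this
  exact this.symm
end

section
/- Let s = (sₙ)_{n∈ℕ₀} be a real sequence with s₀ = 1 such that both s and the shifted sequence Es = (s_{n+1})_{n∈ℕ₀} are positive semidefinite, i.e., Σ_{k,l=0}^n s_{k+l} ξ_k ξ_l ≥ 0 and Σ_{k,l=0}^n s_{k+l+1} ξ_k ξ_l ≥ 0 for all ξ₀,…,ξₙ ∈ ℝ and all n. Let m ≥ 1 be a natural number. Then the series Σ_{n=1}^∞ sₙ^{-1/(2n)} diverges to +∞ if and only if the series Σ_{n=1}^∞ s_{nm}^{-1/(2nm)} diverges to +∞. -/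
/-- Positive semidefiniteness of the Hankel form of `a`, tested on vectors supported on two
consecutive indices. -/
theorem hankel_two_term_nonneg {a : ℕ → ℝ}
    (ha : ∀ (n : ℕ) (ξ : ℕ → ℝ),
      0 ≤ ∑ k ∈ Finset.range (n + 1), ∑ l ∈ Finset.range (n + 1), a (k + l) * ξ k * ξ l)
    (j : ℕ) (x y : ℝ) :
    0 ≤ a (2 * j) * x ^ 2 + 2 * a (2 * j + 1) * x * y + a (2 * j + 2) * y ^ 2 := by
  let ξ : ℕ → ℝ := fun k ↦ if k = j then x else if k = j + 1 then y else 0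
  have hzero : ∀ k ∈ Finset.range j, ξ k = 0 := fun k hk ↦ by
    have hkj := Finset.mem_range.1 hk
    simp [ξ, hkj.ne, (hkj.trans j.lt_succ_self).ne]
  have hsum (f : ℕ → ℝ) (hf : ∀ k ∈ Finset.range j, f k = 0) :
      ∑ k ∈ Finset.range (j + 1 + 1), f k = f j + f (j + 1) := by
    rw [Finset.sum_range_succ, Finset.sum_range_succ, Finset.sum_eq_zero hf, zero_add]
  have h := ha (j + 1) ξ
  rw [hsum _ fun k hk ↦ by simp [hzero k hk], hsum _ fun l hl ↦ by simp [hzero l hl],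
    hsum _ fun l hl ↦ by simp [hzero l hl]] at h
  have hξ : ξ j = x := by simp [ξ]
  have hξ' : ξ (j + 1) = y := by simp [ξ]
  rw [hξ, hξ', show j + j = 2 * j by ring, show j + (j + 1) = 2 * j + 1 by ring,
    show j + 1 + j = 2 * j + 1 by ring, show j + 1 + (j + 1) = 2 * j + 2 by ring] at h
  linarith

theorem hankel_even_nonneg {a : ℕ → ℝ}
    (ha : ∀ (n : ℕ) (ξ : ℕ → ℝ),
      0 ≤ ∑ k ∈ Finset.range (n + 1), ∑ l ∈ Finset.range (n + 1), a (k + l) * ξ k * ξ l)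
    (j : ℕ) : 0 ≤ a (2 * j) := by
  simpa using hankel_two_term_nonneg ha j 1 0

theorem hankel_sq_le_mul {a : ℕ → ℝ}
    (ha : ∀ (n : ℕ) (ξ : ℕ → ℝ),
      0 ≤ ∑ k ∈ Finset.range (n + 1), ∑ l ∈ Finset.range (n + 1), a (k + l) * ξ k * ξ l)
    (j : ℕ) : a (2 * j + 1) ^ 2 ≤ a (2 * j) * a (2 * j + 2) := by
  have h := discrim_le_zero (a := a (2 * j)) (b := 2 * a (2 * j + 1)) (c := a (2 * j + 2))
    fun x ↦ by simpa [sq] using hankel_two_term_nonneg ha j x 1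
  rw [discrim] at h
  linarith

/-- For a nonnegative log-convex sequence with `s 0 = 1`, the roots `s n ^ (1 / n)` increase. -/
theorem pow_succ_le_pow_of_logConvex {s : ℕ → ℝ} (hs0 : s 0 = 1) (hs : ∀ n, 0 ≤ s n)
    (hlog : ∀ n, s (n + 1) ^ 2 ≤ s n * s (n + 2)) (n : ℕ) :
    s n ^ (n + 1) ≤ s (n + 1) ^ n := by
  induction n with
  | zero => simp [hs0]
  | succ n ih =>
    rcases (hs (n + 1)).eq_or_lt with h | h
    · rw [← h, zero_pow (by lia)]
      exact pow_nonneg (hs _) _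
    · refine le_of_mul_le_mul_left ?_ (pow_pos h n)
      calc s (n + 1) ^ n * s (n + 1) ^ (n + 1 + 1)
          = (s (n + 1) ^ 2) ^ (n + 1) := by ring
        _ ≤ (s n * s (n + 2)) ^ (n + 1) := by gcongr; exact hlog n
        _ = s n ^ (n + 1) * s (n + 2) ^ (n + 1) := mul_pow ..
        _ ≤ s (n + 1) ^ n * s (n + 1 + 1) ^ (n + 1) :=
          mul_le_mul_of_nonneg_right ih (pow_nonneg (hs _) _)

theorem antitone_rpow_of_pow_succ_le_pow {s : ℕ → ℝ} (hs : ∀ n, 0 ≤ s n)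
    (h : ∀ n, s n ^ (n + 1) ≤ s (n + 1) ^ n) :
    Antitone fun n : ℕ ↦ ENNReal.ofReal (s (n + 1)) ^ (-(1 / (2 * ((n : ℝ) + 1)))) := by
  refine antitone_nat_of_succ_le fun n ↦ ?_
  have hpow := ENNReal.ofReal_le_ofReal (h (n + 1))
  rw [ENNReal.ofReal_pow (hs _), ENNReal.ofReal_pow (hs _), ← ENNReal.rpow_natCast,
    ← ENNReal.rpow_natCast] at hpow
  have hroot := ENNReal.rpow_le_rpow hpow
    (show 0 ≤ 1 / (2 * ((n : ℝ) + 1) * ((n : ℝ) + 1 + 1)) by positivity)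
  rw [← ENNReal.rpow_mul, ← ENNReal.rpow_mul] at hroot
  rw [ENNReal.rpow_neg, ENNReal.rpow_neg, ENNReal.inv_le_inv]
  convert hroot using 2 <;> push_cast <;> field_simp

/-- Condensation to an arithmetic progression for antitone extended nonnegative series. -/
theorem tsum_eq_top_iff_of_antitone {u : ℕ → ENNReal} (hu : Antitone u) {m : ℕ} (hm : 1 ≤ m)
    (h0 : u 0 = ⊤ → u (m - 1) = ⊤) :
    ∑' n, u n = ⊤ ↔ ∑' n, u ((n + 1) * m - 1) = ⊤ := by
  have : NeZero m := ⟨by lia⟩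
  have hinj : Function.Injective fun n : ℕ ↦ (n + 1) * m - 1 := fun a b hab ↦ by
    have ha : 1 ≤ (a + 1) * m := Nat.mul_pos a.succ_pos hm
    have hb : 1 ≤ (b + 1) * m := Nat.mul_pos b.succ_pos hm
    have hmul : (a + 1) * m = (b + 1) * m := by dsimp only at hab; lia
    simpa using Nat.eq_of_mul_eq_mul_right hm hmul
  refine ⟨fun h ↦ ?_, fun h ↦ ?_⟩
  · by_contra hne
    have hu0 : u 0 ≠ ⊤ := fun h' ↦ by
      refine ENNReal.ne_top_of_tsum_ne_top hne 0 ?_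
      simpa using h0 h'
    have hblock : ∑' n, u n ≤ m * (u 0 + ∑' n, u ((n + 1) * m - 1)) := by
      calc ∑' n, u n = ∑' p : ℕ × Fin m, u ((Nat.divModEquiv m).symm p) :=
            ((Nat.divModEquiv m).symm.tsum_eq u).symm
        _ = ∑' (q : ℕ) (r : Fin m), u ((Nat.divModEquiv m).symm (q, r)) :=
            ENNReal.tsum_prod' ..
        _ ≤ ∑' q : ℕ, m * u (q * m) := by
            refine ENNReal.tsum_le_tsum fun q ↦ ?_
            rw [tsum_fintype]
            refine (Finset.sum_le_card_nsmul _ _ (u (q * m)) fun r _ ↦ hu ?_).trans ?_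
            · simp [Nat.divModEquiv]
            · simp
        _ = m * (u 0 + ∑' q : ℕ, u ((q + 1) * m)) := by
            rw [ENNReal.tsum_mul_left, tsum_eq_zero_add' ENNReal.summable, zero_mul]
        _ ≤ m * (u 0 + ∑' n, u ((n + 1) * m - 1)) := by
            gcongr with q
            exact hu (Nat.sub_le _ _)
    rw [h, top_le_iff] at hblock
    exact ENNReal.mul_ne_top (ENNReal.natCast_ne_top m) (ENNReal.add_ne_top.2 ⟨hu0, hne⟩) hblock
  · exact top_le_iff.1 (h ▸ ENNReal.tsum_comp_le_tsum_of_injective hinj u)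

/-- Lemma 2 (technical lemma): for a positive semidefinite Stieltjes sequence `s` with
`s₀ = 1` and any `m ≥ 1`, the series `∑ₙ sₙ^{-1/(2n)}` diverges iff the series
`∑ₙ s_{nm}^{-1/(2nm)}` diverges. -/
theorem stieltjes_condition_subsequence
    (s : ℕ → ℝ) (hs0 : s 0 = 1)
    (hpsd : ∀ (n : ℕ) (ξ : ℕ → ℝ),
      0 ≤ ∑ k ∈ Finset.range (n + 1), ∑ l ∈ Finset.range (n + 1), s (k + l) * ξ k * ξ l)
    (hpsd' : ∀ (n : ℕ) (ξ : ℕ → ℝ),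
      0 ≤ ∑ k ∈ Finset.range (n + 1), ∑ l ∈ Finset.range (n + 1), s (k + l + 1) * ξ k * ξ l)
    (m : ℕ) (hm : 1 ≤ m) :
    (∑' n : ℕ, (ENNReal.ofReal (s (n + 1))) ^ (-(1 / (2 * ((n : ℝ) + 1)))) = ⊤) ↔
    (∑' n : ℕ,
        (ENNReal.ofReal (s ((n + 1) * m))) ^ (-(1 / (2 * ((n : ℝ) + 1) * (m : ℝ)))) = ⊤) := by
  have hs : ∀ n, 0 ≤ s n := fun n ↦ by
    obtain ⟨j, rfl | rfl⟩ := n.even_or_odd'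
    · exact hankel_even_nonneg hpsd j
    · exact hankel_even_nonneg (a := fun n ↦ s (n + 1)) hpsd' j
  have hlog : ∀ n, s (n + 1) ^ 2 ≤ s n * s (n + 2) := fun n ↦ by
    obtain ⟨j, rfl | rfl⟩ := n.even_or_odd'
    · exact hankel_sq_le_mul hpsd j
    · exact hankel_sq_le_mul (a := fun n ↦ s (n + 1)) hpsd' j
  have hu := antitone_rpow_of_pow_succ_le_pow hs (pow_succ_le_pow_of_logConvex hs0 hs hlog)
  rw [tsum_eq_top_iff_of_antitone hu hm]
  · have hcast (n : ℕ) : (((n + 1) * m - 1 : ℕ) : ℝ) + 1 = ((n : ℝ) + 1) * m := by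
      rw [Nat.cast_sub (Nat.mul_pos n.succ_pos hm)]
      push_cast
      ring
    have hidx (n : ℕ) : (n + 1) * m - 1 + 1 = (n + 1) * m :=
      Nat.sub_add_cancel (Nat.mul_pos n.succ_pos hm)
    simp only [hcast, hidx, mul_assoc]
  · intro h0
    have h1 : s 1 = 0 := by
      rcases ENNReal.rpow_eq_top_iff.1 h0 with ⟨h, -⟩ | ⟨h, -⟩
      · exact le_antisymm (ENNReal.ofReal_eq_zero.1 h) (hs 1)
      · exact absurd h ENNReal.ofReal_ne_top
    have hall (n : ℕ) : s (n + 1) = 0 := by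
      induction n with
      | zero => exact h1
      | succ n ih => simpa [ih] using hlog (n + 1)
    rw [hall, ENNReal.ofReal_zero, ENNReal.zero_rpow_of_neg]
    exact neg_neg_of_pos (by positivity)
end

section
/- Let (sₙ)_{n≥1} be a sequence of positive real numbers such that s_k^{1/k} ≤ s_l^{1/l} whenever 1 ≤ k ≤ l (i.e., the sequence (sₙ^{-1/n}) is nonincreasing). Then for every natural number m ≥ 1 one has the inequality Σ_{n=m}^∞ sₙ^{-1/(2n)} ≤ m · Σ_{n=1}^∞ s_{nm}^{-1/(2nm)} (as an inequality of sums in the extended nonnegative reals). In particular, if the series Σ_{n=1}^∞ s_{nm}^{-1/(2nm)} converges, then the series Σ_{n=1}^∞ sₙ^{-1/(2n)} converges. -/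
open scoped ENNReal

/-- The tail of a series of extended nonnegative reals whose terms are nonincreasing from index `m`
on is at most `m` times the series along the multiples of `m`. -/
theorem tsum_add_le_mul_tsum_multiples (f : ℕ → ℝ≥0∞) (m : ℕ) (hm : 1 ≤ m)
    (hf : AntitoneOn f (Set.Ici m)) :
    ∑' n, f (n + m) ≤ (m : ℝ≥0∞) * ∑' n, f ((n + 1) * m) := by
  have : NeZero m := ⟨by omega⟩
  rw [← (Nat.divModEquiv m).symm.tsum_eq fun n => f (n + m), ENNReal.tsum_prod',
    ← ENNReal.tsum_mul_left]
  refine ENNReal.tsum_le_tsum fun q => ?_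
  rw [tsum_fintype]
  calc ∑ r : Fin m, f ((Nat.divModEquiv m).symm (q, r) + m)
      ≤ ∑ _r : Fin m, f ((q + 1) * m) := by
        refine Finset.sum_le_sum fun r _ => hf ?_ ?_ ?_
        · exact Nat.le_mul_of_pos_left m q.succ_pos
        · exact Nat.le_add_left _ _
        · simp only [Nat.divModEquiv_symm_apply]
          linarith [Nat.zero_le (r : ℕ)]
    _ = m * f ((q + 1) * m) := by simp

/-- A series of finite extended nonnegative reals with a finite tail is finite. -/
theorem tsum_ne_top_of_tsum_add_ne_top {f : ℕ → ℝ≥0∞} (k : ℕ) (hf : ∀ n, f n ≠ ⊤)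
    (h : ∑' n, f (n + k) ≠ ⊤) : ∑' n, f n ≠ ⊤ := by
  rw [← Summable.sum_add_tsum_nat_add' (k := k) ENNReal.summable]
  exact ENNReal.add_ne_top.2 ⟨ENNReal.sum_ne_top.2 fun n _ => hf n, h⟩

/-- If `x ^ (1 / k) ≤ y ^ (1 / l)` for positive `x` and `y`, then
`y ^ (-1 / (2 l)) ≤ x ^ (-1 / (2 k))`. -/
theorem rpow_neg_one_div_two_mul_le {x y k l : ℝ} (hx : 0 < x) (hy : 0 < y)
    (h : x ^ (1 / k) ≤ y ^ (1 / l)) :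
    y ^ (-(1 / (2 * l))) ≤ x ^ (-(1 / (2 * k))) := by
  have key (z t : ℝ) (hz : 0 < z) : z ^ (-(1 / (2 * t))) = (z ^ (1 / t)) ^ (-(1 / 2) : ℝ) := by
    rw [← Real.rpow_mul hz.le]
    congr 1
    rw [one_div_mul_eq_div, one_div, mul_inv]
    ring
  rw [key x k hx, key y l hy]
  exact Real.rpow_le_rpow_of_nonpos (Real.rpow_pos_of_pos hx _) h (by norm_num)

/-- If `(sₙ)_{n≥1}` is a sequence of positive reals with `(sₙ^{1/n})` nondecreasing
(equivalently `(sₙ^{-1/n})` nonincreasing), then for every `m ≥ 1` one has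
`∑_{n=m}^∞ sₙ^{-1/(2n)} ≤ m · ∑_{n=1}^∞ s_{nm}^{-1/(2nm)}` in `[0,∞]`; in particular,
convergence of `∑ₙ s_{nm}^{-1/(2nm)}` implies convergence of `∑ₙ sₙ^{-1/(2n)}`. -/
theorem stieltjes_series_tail_bound
    (s : ℕ → ℝ)
    (hpos : ∀ n : ℕ, 1 ≤ n → 0 < s n)
    (hmono : ∀ k l : ℕ, 1 ≤ k → k ≤ l →
      s k ^ (1 / (k : ℝ)) ≤ s l ^ (1 / (l : ℝ)))
    (m : ℕ) (hm : 1 ≤ m) :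
    (∑' n : ℕ, ENNReal.ofReal (s (n + m) ^ (-(1 / (2 * ((n : ℝ) + (m : ℝ))))))) ≤
      (m : ℝ≥0∞) *
        ∑' n : ℕ, ENNReal.ofReal (s ((n + 1) * m) ^ (-(1 / (2 * ((n : ℝ) + 1) * (m : ℝ))))) ∧
    ((∑' n : ℕ,
        ENNReal.ofReal (s ((n + 1) * m) ^ (-(1 / (2 * ((n : ℝ) + 1) * (m : ℝ))))) ≠ ⊤) →
      (∑' n : ℕ, ENNReal.ofReal (s (n + 1) ^ (-(1 / (2 * ((n : ℝ) + 1)))))) ≠ ⊤) := by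
  let f : ℕ → ℝ≥0∞ := fun n => ENNReal.ofReal (s n ^ (-(1 / (2 * (n : ℝ)))))
  have hf : AntitoneOn f (Set.Ici m) := fun k hk l _ hkl =>
    ENNReal.ofReal_le_ofReal <| rpow_neg_one_div_two_mul_le (hpos k (hm.trans hk))
      (hpos l ((hm.trans hk).trans hkl)) (hmono k l (hm.trans hk) hkl)
  have tail := tsum_add_le_mul_tsum_multiples f m hm hf
  have e : ∀ n : ℕ, f ((n + 1) * m) =
      ENNReal.ofReal (s ((n + 1) * m) ^ (-(1 / (2 * ((n : ℝ) + 1) * (m : ℝ))))) := fun n => by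
    simp only [f, Nat.cast_mul, Nat.cast_add, Nat.cast_one, mul_assoc]
  simp only [e] at tail
  refine ⟨by simpa only [f, Nat.cast_add] using tail, fun h => ?_⟩
  have tail_ne_top : ∑' n, f (n + m) ≠ ⊤ :=
    ne_top_of_le_ne_top (ENNReal.mul_ne_top (ENNReal.natCast_ne_top m) h) tail
  have hsum : ∑' n, f (n + 1) ≠ ⊤ := by
    refine tsum_ne_top_of_tsum_add_ne_top (f := fun n => f (n + 1)) (m - 1)
      (fun n => ENNReal.ofReal_ne_top) ?_
    simpa only [add_assoc, Nat.sub_add_cancel hm] using tail_ne_top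
  simpa only [f, Nat.cast_add, Nat.cast_one] using hsum
end

section
/- Let L be a linear functional on ℝ[x₁,…,x_d] with L(1) = 1 such that L(p²) ≥ 0 and L(x_j·p²) ≥ 0 for all p ∈ ℝ[x₁,…,x_d] and all j = 1,…,d. Fix j ∈ {1,…,d} and a natural number m ≥ 1. Then the series Σ_{n=1}^∞ L(x_jⁿ)^{-1/(2n)} diverges to +∞ if and only if the series Σ_{n=1}^∞ L(x_j^{mn})^{-1/(2nm)} diverges to +∞. (In particular, the Stieltjes condition Σ_{n} L(x_jⁿ)^{-1/(2n)} = +∞ is equivalent to Σ_{n} L(x_j^{4n})^{-1/(8n)} = +∞.) -/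
open MvPolynomial

open scoped ENNReal in
/-- For an antitone `a : ℕ → ℝ≥0∞` whose initial value is finite, passing to the terms whose index
is congruent to `-1` modulo `m` does not affect divergence of the series. -/
theorem tsum_mul_add_pred_eq_top_of_antitone {a : ℕ → ℝ≥0∞} (ha : Antitone a) (h0 : a 0 ≠ ⊤)
    {m : ℕ} (hm : 1 ≤ m) (h : ∑' n, a n = ⊤) : ∑' n, a (m * (n + 1) - 1) = ⊤ := by
  have : NeZero m := ⟨by omega⟩
  have hle : ∑' n, a n ≤ m * (a 0 + ∑' n, a (m * (n + 1) - 1)) := by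
    calc ∑' n, a n = ∑' q : ℕ × Fin m, a ((Nat.divModEquiv m).symm q) :=
          ((Nat.divModEquiv m).symm.tsum_eq a).symm
      _ = ∑' (k : ℕ) (r : Fin m), a ((Nat.divModEquiv m).symm (k, r)) := ENNReal.tsum_prod'
      _ ≤ ∑' k : ℕ, m * a (m * k) := by
          refine ENNReal.tsum_le_tsum fun k => ?_
          rw [tsum_fintype]
          refine (Finset.sum_le_card_nsmul _ _ (a (m * k)) fun r _ => ha ?_).trans (by simp)
          simp [Nat.divModEquiv, mul_comm]
      _ = m * ∑' k : ℕ, a (m * k) := ENNReal.tsum_mul_left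
      _ ≤ m * (a 0 + ∑' n, a (m * (n + 1) - 1)) := by
          gcongr
          rw [tsum_eq_zero_add' ENNReal.summable, mul_zero]
          gcongr with n
          exact ha (Nat.sub_le _ _)
  by_contra hc
  rw [h] at hle
  exact (ENNReal.mul_ne_top (by simp) (ENNReal.add_ne_top.2 ⟨h0, hc⟩)) (top_le_iff.1 hle)

/-- A nonnegative log-convex sequence with `s 0 = 1` satisfies `s n ^ (n + 1) ≤ s (n + 1) ^ n`. -/
theorem pow_succ_le_pow_of_sq_le_mul {s : ℕ → ℝ} (h0 : s 0 = 1) (hs : ∀ n, 0 ≤ s n)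
    (hlc : ∀ n, s (n + 1) ^ 2 ≤ s n * s (n + 2)) (n : ℕ) : s n ^ (n + 1) ≤ s (n + 1) ^ n := by
  induction n with
  | zero => simp [h0]
  | succ n ih =>
    rcases (hs (n + 1)).eq_or_lt with h | h
    · rw [← h, zero_pow (by omega)]
      exact pow_nonneg (hs _) _
    · refine le_of_mul_le_mul_left ?_ (pow_pos h n)
      calc s (n + 1) ^ n * s (n + 1) ^ (n + 1 + 1) = (s (n + 1) ^ 2) ^ (n + 1) := by ring
        _ ≤ (s n * s (n + 2)) ^ (n + 1) := pow_le_pow_left₀ (sq_nonneg _) (hlc n) _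
        _ = s n ^ (n + 1) * s (n + 2) ^ (n + 1) := mul_pow _ _ _
        _ ≤ s (n + 1) ^ n * s (n + 2) ^ (n + 1) :=
          mul_le_mul_of_nonneg_right ih (pow_nonneg (hs _) _)

/-- For a nonnegative log-convex sequence with `s 0 = 1`, the terms `s n ^ (-1 / (2 n))`, `n ≥ 1`,
are decreasing. -/
theorem antitone_ofReal_rpow_of_sq_le_mul {s : ℕ → ℝ} (h0 : s 0 = 1) (hs : ∀ n, 0 ≤ s n)
    (hlc : ∀ n, s (n + 1) ^ 2 ≤ s n * s (n + 2)) :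
    Antitone fun n : ℕ => ENNReal.ofReal (s (n + 1)) ^ (-(1 / (2 * ((n : ℝ) + 1)))) := by
  refine antitone_nat_of_succ_le fun n => ?_
  rw [ENNReal.rpow_neg, ENNReal.rpow_neg, ENNReal.inv_le_inv]
  have h := ENNReal.ofReal_le_ofReal (pow_succ_le_pow_of_sq_le_mul h0 hs hlc (n + 1))
  rw [ENNReal.ofReal_pow (hs _), ENNReal.ofReal_pow (hs _)] at h
  have h' := ENNReal.rpow_le_rpow h
    (show (0 : ℝ) ≤ 1 / (2 * ((n : ℝ) + 1) * ((n : ℝ) + 2)) by positivity)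
  rw [← ENNReal.rpow_natCast, ← ENNReal.rpow_natCast, ← ENNReal.rpow_mul, ← ENNReal.rpow_mul] at h'
  convert h' using 2
  · push_cast
    field_simp
    ring
  · push_cast
    field_simp
    ring

/-- If `L` is nonnegative on all `y * (t • u + v) ^ 2`, then it satisfies the Cauchy–Schwarz
inequality for the weight `y`. -/
theorem sq_le_mul_of_forall_nonneg {A : Type*} [CommRing A] [Algebra ℝ A] (L : A →ₗ[ℝ] ℝ) (y : A)
    (h : ∀ p : A, 0 ≤ L (y * p ^ 2)) (u v : A) :
    L (y * (u * v)) ^ 2 ≤ L (y * u ^ 2) * L (y * v ^ 2) := by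
  have hd := discrim_le_zero (a := L (y * u ^ 2)) (b := 2 * L (y * (u * v))) (c := L (y * v ^ 2))
    fun t => by
      have e : y * (t • u + v) ^ 2
          = (t * t) • (y * u ^ 2) + (2 * t) • (y * (u * v)) + y * v ^ 2 := by
        simp only [Algebra.smul_def, map_mul, map_ofNat]
        ring
      have := h (t • u + v)
      rw [e, map_add, map_add, map_smul, map_smul, smul_eq_mul, smul_eq_mul] at this
      linarith
  rw [discrim] at hd
  linarith

/-- For a normalized linear functional `L` on `ℝ[x₁,…,x_d]` satisfying the Stieltjes
positivity conditions, the Stieltjes condition `∑ₙ L(x_jⁿ)^{-1/(2n)} = +∞` is equivalent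
to `∑ₙ L(x_j^{mn})^{-1/(2nm)} = +∞` for any fixed `m ≥ 1`. -/
theorem stieltjes_condition_powers_equivalent
    (d : ℕ) (L : MvPolynomial (Fin d) ℝ →ₗ[ℝ] ℝ)
    (h1 : L 1 = 1)
    (hsq : ∀ p : MvPolynomial (Fin d) ℝ, 0 ≤ L (p ^ 2))
    (hxsq : ∀ (i : Fin d) (p : MvPolynomial (Fin d) ℝ), 0 ≤ L (X i * p ^ 2))
    (j : Fin d) (m : ℕ) (hm : 1 ≤ m) :
    (∑' n : ℕ, (ENNReal.ofReal (L (X j ^ (n + 1)))) ^ (-(1 / (2 * ((n : ℝ) + 1)))) = ⊤) ↔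
    (∑' n : ℕ,
        (ENNReal.ofReal (L (X j ^ (m * (n + 1))))) ^
          (-(1 / (2 * ((n : ℝ) + 1) * (m : ℝ)))) = ⊤) := by
  have h0 : L (X j ^ 0) = 1 := by rw [pow_zero, h1]
  have hs : ∀ n, 0 ≤ L (X j ^ n) := fun n => by
    obtain ⟨k, rfl | rfl⟩ := n.even_or_odd'
    · rw [mul_comm, pow_mul]
      exact hsq _
    · rw [pow_succ', mul_comm 2, pow_mul]
      exact hxsq j _
  have hlc : ∀ n, L (X j ^ (n + 1)) ^ 2 ≤ L (X j ^ n) * L (X j ^ (n + 2)) := fun n => by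
    obtain ⟨k, rfl | rfl⟩ := n.even_or_odd'
    · convert sq_le_mul_of_forall_nonneg L 1 (by simpa using hsq) (X j ^ k) (X j ^ (k + 1)) using 3
      all_goals ring_nf
    · convert sq_le_mul_of_forall_nonneg L (X j) (hxsq j) (X j ^ k) (X j ^ (k + 1)) using 3
      all_goals ring_nf
  set a : ℕ → ENNReal :=
    fun n => ENNReal.ofReal (L (X j ^ (n + 1))) ^ (-(1 / (2 * ((n : ℝ) + 1)))) with ha_def
  have ha : Antitone a := antitone_ofReal_rpow_of_sq_le_mul h0 hs hlc
  have hpos : ∀ n, 1 ≤ m * (n + 1) := fun n => Nat.mul_pos hm n.succ_pos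
  have hsub : ∀ n : ℕ, ENNReal.ofReal (L (X j ^ (m * (n + 1)))) ^
      (-(1 / (2 * ((n : ℝ) + 1) * (m : ℝ)))) = a (m * (n + 1) - 1) := fun n => by
    simp only [ha_def, Nat.sub_add_cancel (hpos n)]
    rw [Nat.cast_sub (hpos n)]
    push_cast
    congr 3
    ring
  simp only [hsub]
  constructor
  · intro h
    by_cases hz : L (X j ^ 1) = 0
    · have hzero : ∀ n, L (X j ^ (n + 1)) = 0 := fun n => by
        induction n with
        | zero => exact hz
        | succ n ih =>
          have := hlc (n + 1)
          rw [ih, zero_mul] at this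
          exact pow_eq_zero_iff two_ne_zero |>.1 (le_antisymm this (sq_nonneg _))
      refine ENNReal.tsum_eq_top_of_eq_top ⟨0, ?_⟩
      simp only [ha_def, hzero, ENNReal.ofReal_zero]
      exact ENNReal.zero_rpow_of_neg (by rw [neg_lt_zero]; positivity)
    · refine tsum_mul_add_pred_eq_top_of_antitone ha ?_ hm h
      refine ENNReal.rpow_ne_top_of_ne_zero ?_ ENNReal.ofReal_ne_top
      simpa using (hs 1).lt_of_ne' hz
  · intro h
    refine top_le_iff.1 (h ▸ ENNReal.tsum_comp_le_tsum_of_injective ?_ a)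
    intro x y hxy
    have hx := hpos x
    have hy := hpos y
    have : m * (x + 1) = m * (y + 1) := by
      simp only at hxy
      omega
    have := Nat.eq_of_mul_eq_mul_left hm this
    omega
end
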